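/- Let K be a quadratic number field with Dedekind zeta function ζ_K, and let m₁, m₂ be nonnegative integers. Then, as T → ∞, ∫_T^{2T} |ζ_K( (1+it)/2 )|² / ( |ζ(1+it)|^{m₁} |ζ_K(1+it)|^{m₂} ) dt ≪ T (log T)² (log log T)^{m₁+m₂}. -/

import Mathlib

open Complex Filter Asymptotics

/-- `rK K n` is the number of nonzero integral ideals of the ring of integers of `K`
of absolute norm `n`. -/
noncomputable def rK (K : Type*) [Field K] [NumberField K] (n : ℕ) : ℕ :=
  Nat.card {I : Ideal (NumberField.RingOfIntegers K) // Ideal.absNorm I = n ∧ I ≠ ⊥}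

namespace MSW
open MeasureTheory

lemma gaussian_fourier_norm (b : ℝ) (hb : 0 < b) (t0 lam : ℝ) :
    Integrable (fun t : ℝ => Complex.exp (-(b:ℂ) * (t - t0) ^ 2 + I * lam * t)) ∧
    ‖∫ t : ℝ, Complex.exp (-(b:ℂ) * (t - t0) ^ 2 + I * lam * t)‖
      = Real.sqrt (Real.pi / b) * Real.exp (-lam ^ 2 / (4 * b)) := by
  have h1 : (fun t : ℝ => Complex.exp (-(b:ℂ) * (t - t0) ^ 2 + I * lam * t))
      = fun t : ℝ => Complex.exp (-(b:ℂ) * t ^ 2 + (2 * b * t0 + I * lam) * t + (-b * t0 ^ 2)) := by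
    funext t; congr 1; ring
  have hb' : (-(b:ℂ)).re < 0 := by simpa using hb
  rw [h1]
  refine ⟨integrable_cexp_quadratic (by simpa using hb) _ _, ?_⟩
  rw [integral_cexp_quadratic hb']
  rw [norm_mul, Complex.norm_exp]
  congr 1
  · rw [neg_neg, ← Complex.ofReal_div, show (1 / 2 : ℂ) = ((1 / 2 : ℝ) : ℂ) by push_cast; ring,
      ← Complex.ofReal_cpow (by positivity), Complex.norm_real, Real.sqrt_eq_rpow]
    exact abs_of_nonneg (by positivity)
  · congr 1
    have : (-(b:ℂ) * t0 ^ 2 - (2 * b * t0 + I * lam) ^ 2 / (4 * -b))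
        = ((-lam ^ 2 / (4 * b) : ℝ) : ℂ) + ((t0 * lam : ℝ) : ℂ) * I := by
      have : (b:ℂ) ≠ 0 := by exact_mod_cast hb.ne'
      push_cast
      field_simp
      ring_nf
      simp only [I_sq]
      ring
    rw [this, Complex.add_re, Complex.ofReal_re, Complex.re_ofReal_mul, Complex.I_re, mul_zero,
      add_zero]

lemma norm_sq_sum_eq {S : Finset ℕ} (z : ℕ → ℂ) :
    ((‖∑ n ∈ S, z n‖ ^ 2 : ℝ) : ℂ) = ∑ n ∈ S, ∑ m ∈ S, z n * (starRingEnd ℂ) (z m) := by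
  rw [← Complex.normSq_eq_norm_sq, ← Complex.mul_conj, map_sum, Finset.sum_mul_sum]

lemma schur_gauss (S : Finset ℕ) (n : ℕ) :
    ∑ m ∈ S, Real.exp (-((n:ℝ) - m) ^ 2 / 4) ≤ 20 := by
  have key : ∀ k : ℕ, Real.exp (-(k:ℝ) ^ 2 / 4) ≤ 2 * (4 / 5 : ℝ) ^ k := by
    intro k
    have h1 : Real.exp (-(k:ℝ) ^ 2 / 4) ≤ Real.exp (1/4 - k / 2 * (1/2) - k/2*(1/2)) := by
      apply Real.exp_le_exp.mpr; nlinarith [sq_nonneg ((k:ℝ) - 1)]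
    have h2 : Real.exp (1/4 - k / 2 * (1/2) - k/2*(1/2)) = Real.exp (1/4) * Real.exp (-1/2) ^ k := by
      rw [← Real.exp_nat_mul, ← Real.exp_add]; congr 1; ring
    have h3 : Real.exp (1/4) ≤ 2 := by
      have := Real.exp_bound_div_one_sub_of_interval (x := 1/4) (by norm_num) (by norm_num)
      refine this.trans (by norm_num)
    have h4 : Real.exp (-1/2) ≤ 4/5 := by
      have := Real.add_one_le_exp (1/2 : ℝ)
      rw [show (-1/2 : ℝ) = -(1/2) by ring, Real.exp_neg]
      rw [inv_le_comm₀ (Real.exp_pos _) (by norm_num)]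
      linarith
    calc _ ≤ _ := h1
      _ = _ := h2
      _ ≤ _ := by gcongr
  have hg : Summable (fun k : ℕ => 2 * (4 / 5 : ℝ) ^ k) :=
    (summable_geometric_of_lt_one (by norm_num) (by norm_num)).mul_left _
  have hgs : ∑' k : ℕ, 2 * (4 / 5 : ℝ) ^ k = 10 := by
    rw [tsum_mul_left, tsum_geometric_of_lt_one (by norm_num) (by norm_num)]; norm_num
  have split := Finset.sum_filter_add_sum_filter_not S (fun m => m ≤ n)
    (fun m => Real.exp (-((n:ℝ) - m) ^ 2 / 4))
  rw [← split]
  have a1 : ∑ m ∈ S.filter (fun m => m ≤ n), Real.exp (-((n:ℝ) - m) ^ 2 / 4) ≤ 10 := by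
    calc _ ≤ ∑ m ∈ S.filter (fun m => m ≤ n), 2 * (4 / 5 : ℝ) ^ (n - m) := by
          apply Finset.sum_le_sum
          intro m hm
          have hm' := (Finset.mem_filter.mp hm).2
          have := key (n - m)
          rwa [Nat.cast_sub hm'] at this
      _ = ∑ k ∈ (S.filter (fun m => m ≤ n)).image (fun m => n - m), 2 * (4 / 5 : ℝ) ^ k := by
          rw [Finset.sum_image]
          intro a ha b hb hab
          simp at ha hb hab
          omega
      _ ≤ _ := by
          rw [← hgs]; exact hg.sum_le_tsum _ (fun _ _ => by positivity)
  have a2 : ∑ m ∈ S.filter (fun m => ¬ m ≤ n), Real.exp (-((n:ℝ) - m) ^ 2 / 4) ≤ 10 := by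
    calc _ ≤ ∑ m ∈ S.filter (fun m => ¬ m ≤ n), 2 * (4 / 5 : ℝ) ^ (m - n) := by
          apply Finset.sum_le_sum
          intro m hm
          have hm' := (Finset.mem_filter.mp hm).2
          have := key (m - n)
          rw [Nat.cast_sub (by omega)] at this
          rw [show ((n:ℝ) - m) ^ 2 = (m - n) ^ 2 by ring]; exact this
      _ = ∑ k ∈ (S.filter (fun m => ¬ m ≤ n)).image (fun m => m - n), 2 * (4 / 5 : ℝ) ^ k := by
          rw [Finset.sum_image]
          intro a ha b hb hab
          simp at ha hb hab
          omega
      _ ≤ _ := by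
          rw [← hgs]; exact hg.sum_le_tsum _ (fun _ _ => by positivity)
  linarith

lemma abs_log_sub_ge {M : ℝ} {m n : ℕ} (hm : 1 ≤ m) (hn : 1 ≤ n) (hmM : (m:ℝ) ≤ M) (hnM : (n:ℝ) ≤ M) :
    ((n:ℝ) - m) ^ 2 ≤ M ^ 2 * (Real.log m - Real.log n) ^ 2 := by
  have main : ∀ a b : ℝ, 0 < a → a ≤ b → b ≤ M → (b - a) ≤ M * (Real.log b - Real.log a) := by
    intro a b ha hab hb
    have hb0 : 0 < b := ha.trans_le hab
    have h1 := Real.log_le_sub_one_of_pos (div_pos ha hb0)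
    rw [Real.log_div ha.ne' hb0.ne'] at h1
    have h2 : 1 - a / b ≤ Real.log b - Real.log a := by linarith
    have h3 : b - a = b * (1 - a / b) := by field_simp
    rw [h3]
    have : 0 ≤ 1 - a / b := by rw [sub_nonneg, div_le_one hb0]; exact hab
    calc b * (1 - a/b) ≤ M * (1 - a / b) := by gcongr
      _ ≤ _ := by gcongr; linarith
  rw [← mul_pow]
  have hm0 : (0:ℝ) < m := by exact_mod_cast hm
  have hn0 : (0:ℝ) < n := by exact_mod_cast hn
  rcases le_total (m:ℝ) n with h | h
  · rw [sq_le_sq, abs_of_nonneg (by linarith : (0:ℝ) ≤ n - m)]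
    have := main m n hm0 h hnM
    rw [show M * (Real.log m - Real.log n) = -(M * (Real.log n - Real.log m)) by ring, abs_neg]
    exact this.trans (le_abs_self _)
  · rw [sq_le_sq, abs_sub_comm, abs_of_nonneg (by linarith : (0:ℝ) ≤ m - n)]
    exact (main n m hn0 h hmM).trans (le_abs_self _)

/-- Mean value theorem for Dirichlet polynomials, distinct frequencies. -/
lemma mean_value_nat (S : Finset ℕ) (y : ℕ → ℂ) (M T t0 : ℝ) (hT : 0 < T)
    (hS : ∀ n ∈ S, 1 ≤ n ∧ (n:ℝ) ≤ M) :
    ∫ t in (t0 - T)..(t0 + T), ‖∑ n ∈ S, y n * (n:ℂ) ^ (-(t * I))‖ ^ 2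
      ≤ 200 * (T + M) * ∑ n ∈ S, ‖y n‖ ^ 2 := by
  rcases S.eq_empty_or_nonempty with rfl | ⟨n0, hn0⟩
  · simp
  have hM : 1 ≤ M := by
    have := hS n0 hn0
    have h1 : (1:ℝ) ≤ n0 := by exact_mod_cast this.1
    linarith [this.2]
  set T' := T + M with hT'
  have hT'0 : 0 < T' := by positivity
  set b : ℝ := 1 / T' ^ 2 with hb
  have hb0 : 0 < b := by positivity
  set w : ℝ → ℝ := fun t => Real.exp (-b * (t - t0) ^ 2) with hw
  have hnn : ∀ n ∈ S, (n:ℂ) ≠ 0 := fun n hn => by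
    have := (hS n hn).1
    exact_mod_cast (by omega : n ≠ 0)
  have hcp : ∀ n ∈ S, ∀ t : ℝ, (n:ℂ) ^ (-(t * I)) = Complex.exp (-(I * Real.log n * t)) := by
    intro n hn t
    rw [Complex.cpow_def_of_ne_zero (hnn n hn), ← Complex.natCast_log]
    congr 1; ring
  set F : ℝ → ℂ := fun t => ∑ n ∈ S, y n * (n:ℂ) ^ (-(t * I)) with hF
  have hFc : Continuous F := by
    have : F = fun t : ℝ => ∑ n ∈ S, y n * Complex.exp (-(I * Real.log n * t)) := by
      funext t
      exact Finset.sum_congr rfl fun n hn => by rw [hcp n hn]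
    rw [this]; fun_prop
  have expand : ∀ t : ℝ, ((w t * ‖F t‖ ^ 2 : ℝ) : ℂ) = ∑ n ∈ S, ∑ m ∈ S,
      (y n * (starRingEnd ℂ) (y m)) *
        Complex.exp (-(b:ℂ) * (t - t0) ^ 2 + I * ((Real.log m - Real.log n : ℝ) : ℂ) * t) := by
    intro t
    rw [Complex.ofReal_mul, norm_sq_sum_eq, Finset.mul_sum]
    refine Finset.sum_congr rfl fun n hn => ?_
    rw [Finset.mul_sum]
    refine Finset.sum_congr rfl fun m hm => ?_
    rw [hcp n hn, hcp m hm, map_mul, ← Complex.exp_conj, hw]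
    simp only [map_neg, map_mul, Complex.conj_I, Complex.conj_ofReal, Complex.ofReal_exp]
    push_cast
    rw [show -(b:ℂ) * (t - t0) ^ 2 + I * (Complex.log m - Complex.log n) * t
      = -(b:ℂ) * (t - t0) ^ 2 + -(I * Complex.log n * t) + -(-I * Complex.log m * t) by ring,
      Complex.exp_add, Complex.exp_add]
    ring
  have hint : ∀ n ∈ S, ∀ m ∈ S, Integrable fun t : ℝ => (y n * (starRingEnd ℂ) (y m)) *
        Complex.exp (-(b:ℂ) * (t - t0) ^ 2 + I * ((Real.log m - Real.log n : ℝ) : ℂ) * t) :=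
    fun n _ m _ => ((gaussian_fourier_norm b hb0 t0 _).1).const_mul _
  have hintC : Integrable (fun t : ℝ => ((w t * ‖F t‖ ^ 2 : ℝ) : ℂ)) := by
    simp_rw [expand]
    exact integrable_finsetSum _ fun n hn => integrable_finsetSum _ fun m hm => hint n hn m hm
  have hintR : Integrable (fun t : ℝ => w t * ‖F t‖ ^ 2) := by
    exact hintC.re.congr (Filter.Eventually.of_forall fun t => Complex.ofReal_re _)
  have hsq : Real.sqrt (Real.pi / b) ≤ 2 * T' := by
    rw [Real.sqrt_le_left (by positivity), hb]
    have := Real.pi_le_four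
    field_simp
    nlinarith
  have hterm : ∀ n ∈ S, ∀ m ∈ S, ‖∫ t : ℝ, (y n * (starRingEnd ℂ) (y m)) *
        Complex.exp (-(b:ℂ) * (t - t0) ^ 2 + I * ((Real.log m - Real.log n : ℝ) : ℂ) * t)‖
      ≤ T' * (‖y n‖ ^ 2 * Real.exp (-((n:ℝ) - m) ^ 2 / 4)
          + ‖y m‖ ^ 2 * Real.exp (-((m:ℝ) - n) ^ 2 / 4)) := by
    intro n hn m hm
    rw [integral_const_mul, norm_mul, (gaussian_fourier_norm b hb0 t0 _).2, norm_mul,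
      RCLike.norm_conj]
    have h1 : Real.exp (-(Real.log m - Real.log n) ^ 2 / (4 * b)) ≤ Real.exp (-((n:ℝ) - m) ^ 2 / 4) := by
      apply Real.exp_le_exp.mpr
      have := abs_log_sub_ge (M := T') (hS m hm).1 (hS n hn).1 ((hS m hm).2.trans (by linarith))
        ((hS n hn).2.trans (by linarith))
      have e : -(Real.log m - Real.log n) ^ 2 / (4 * b) = -(T' ^ 2 * (Real.log m - Real.log n) ^ 2) / 4 := by
        rw [hb]; field_simp
      rw [e]; linarith
    have h2 : ‖y n‖ * ‖y m‖ ≤ (‖y n‖ ^ 2 + ‖y m‖ ^ 2) / 2 := by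
      nlinarith [sq_nonneg (‖y n‖ - ‖y m‖)]
    calc _ ≤ ((‖y n‖ ^ 2 + ‖y m‖ ^ 2) / 2) * (2 * T' * Real.exp (-((n:ℝ) - m) ^ 2 / 4)) := by
          gcongr
      _ = _ := by
          rw [show ((m:ℝ) - n) ^ 2 = (n - m) ^ 2 by ring]; ring
  have hbig : ∫ t : ℝ, w t * ‖F t‖ ^ 2 ≤ 40 * T' * ∑ n ∈ S, ‖y n‖ ^ 2 := by
    have h0 : ((∫ t : ℝ, w t * ‖F t‖ ^ 2 : ℝ) : ℂ) = ∑ n ∈ S, ∑ m ∈ S, ∫ t : ℝ,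
        (y n * (starRingEnd ℂ) (y m)) *
        Complex.exp (-(b:ℂ) * (t - t0) ^ 2 + I * ((Real.log m - Real.log n : ℝ) : ℂ) * t) := by
      rw [← integral_complex_ofReal]
      simp_rw [expand]
      rw [integral_finsetSum _ fun n hn => integrable_finsetSum _ fun m hm => hint n hn m hm]
      exact Finset.sum_congr rfl fun n hn => integral_finsetSum _ fun m hm => hint n hn m hm
    have h1 : ∫ t : ℝ, w t * ‖F t‖ ^ 2 ≤ ‖((∫ t : ℝ, w t * ‖F t‖ ^ 2 : ℝ) : ℂ)‖ := by
      rw [Complex.norm_real]; exact le_abs_self _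
    refine h1.trans ?_
    rw [h0]
    refine (norm_sum_le _ _).trans ?_
    refine (Finset.sum_le_sum fun n hn => (norm_sum_le _ _).trans
      (Finset.sum_le_sum fun m hm => hterm n hn m hm)).trans ?_
    simp_rw [← Finset.mul_sum, Finset.sum_add_distrib]
    rw [Finset.sum_comm (f := fun n m : ℕ => ‖y m‖ ^ 2 * Real.exp (-((m:ℝ) - n) ^ 2 / 4))]
    simp_rw [← Finset.mul_sum]
    have h3 : ∑ n ∈ S, ‖y n‖ ^ 2 * ∑ m ∈ S, Real.exp (-((n:ℝ) - m) ^ 2 / 4)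
        ≤ ∑ n ∈ S, ‖y n‖ ^ 2 * 20 :=
      Finset.sum_le_sum fun n _ => by gcongr; exact schur_gauss S n
    rw [← Finset.sum_mul] at h3
    nlinarith
  have hloc : ∫ t in (t0 - T)..(t0 + T), ‖F t‖ ^ 2 ≤ 3 * ∫ t : ℝ, w t * ‖F t‖ ^ 2 := by
    rw [intervalIntegral.integral_of_le (by linarith)]
    calc _ ≤ ∫ t in Set.Ioc (t0 - T) (t0 + T), 3 * (w t * ‖F t‖ ^ 2) := by
          refine setIntegral_mono_on ?_ (hintR.const_mul 3).integrableOn measurableSet_Ioc ?_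
          · exact (hFc.norm.pow 2).integrableOn_Ioc
          · intro t ht
            have : 1 ≤ 3 * w t := by
              have hsm : (t - t0) ^ 2 ≤ T' ^ 2 := by
                rw [sq_le_sq, abs_of_pos hT'0]
                rw [abs_le]; constructor <;> linarith [ht.1, ht.2]
              have h1 : Real.exp (-1) ≤ w t := by
                apply Real.exp_le_exp.mpr
                rw [hb, neg_mul, neg_le_neg_iff, div_mul_eq_mul_div, one_mul, div_le_one (by positivity)]
                exact hsm
              have h2 : (1/3 : ℝ) ≤ Real.exp (-1) := by
                rw [Real.exp_neg, one_div]
                apply inv_anti₀ (Real.exp_pos _)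
                linarith [Real.exp_one_lt_d9]
              linarith
            nlinarith [sq_nonneg ‖F t‖]
      _ ≤ ∫ t, 3 * (w t * ‖F t‖ ^ 2) := by
          refine setIntegral_le_integral (hintR.const_mul 3) ?_
          refine Filter.Eventually.of_forall fun t => ?_
          have : 0 ≤ w t := (Real.exp_pos _).le
          simp only [Pi.zero_apply]; positivity
      _ = _ := integral_const_mul _ _
  have hpos : 0 ≤ T' * ∑ n ∈ S, ‖y n‖ ^ 2 := by positivity
  calc _ ≤ _ := hloc
    _ ≤ _ := by nlinarith

/-- Mean value theorem for families with bounded multiplicity. -/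
lemma mean_value_family {ι : Type*} (s : Finset ι) (x : ι → ℂ) (m : ι → ℕ) (M T t0 W : ℝ)
    (hT : 0 < T) (hm : ∀ i ∈ s, 1 ≤ m i ∧ (m i:ℝ) ≤ M)
    (hW : ∀ n : ℕ, ((s.filter fun i => m i = n).card : ℝ) ≤ W) (hM : 0 ≤ M) :
    ∫ t in (t0 - T)..(t0 + T), ‖∑ i ∈ s, x i * (m i:ℂ) ^ (-(t * I))‖ ^ 2
      ≤ 200 * (T + M) * W * ∑ i ∈ s, ‖x i‖ ^ 2 := by
  classical
  set y : ℕ → ℂ := fun n => ∑ i ∈ s.filter (fun i => m i = n), x i with hy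
  have h1 : ∀ t : ℝ, ∑ i ∈ s, x i * (m i:ℂ) ^ (-(t * I))
      = ∑ n ∈ s.image m, y n * (n:ℂ) ^ (-(t * I)) := by
    intro t
    rw [← Finset.sum_fiberwise_of_maps_to (g := m) (t := s.image m)
      (fun i hi => Finset.mem_image_of_mem m hi)]
    refine Finset.sum_congr rfl fun n _ => ?_
    rw [hy, Finset.sum_mul]
    refine Finset.sum_congr rfl fun i hi => ?_
    rw [(Finset.mem_filter.mp hi).2]
  simp_rw [h1]
  refine (mean_value_nat (s.image m) y M T t0 hT ?_).trans ?_
  · intro n hn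
    obtain ⟨i, hi, rfl⟩ := Finset.mem_image.mp hn
    exact hm i hi
  · have hW0 : 0 ≤ W := le_trans (by positivity) (hW 0)
    rw [mul_assoc (200 * (T + M)) W]
    refine mul_le_mul_of_nonneg_left ?_ (by positivity)
    rw [← Finset.sum_fiberwise_of_maps_to (s := s) (g := m) (t := s.image m)
      (fun i hi => Finset.mem_image_of_mem m hi) (fun i => ‖x i‖ ^ 2), Finset.mul_sum]
    refine Finset.sum_le_sum fun n _ => ?_
    have h2 : ‖y n‖ ^ 2 ≤ (∑ i ∈ s.filter (fun i => m i = n), ‖x i‖) ^ 2 := by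
      gcongr; exact norm_sum_le _ _
    refine h2.trans ((sq_sum_le_card_mul_sum_sq).trans ?_)
    gcongr
    exact hW n

end MSW

namespace MSW

/-- Cauchy's formula at the centre of a rectangle, as an inequality. -/
theorem norm_center_le_boundary (F : ℂ → ℂ) (H : ℝ) (hH : 1 ≤ H)
    (hF : DifferentiableOn ℂ F (Set.uIcc (-1:ℝ) 1 ×ℂ Set.uIcc (-H) H)) :
    ‖F 0‖ ≤ (∫ x in (-1:ℝ)..1, ‖F (x + (-H:ℝ) * I)‖) + (∫ x in (-1:ℝ)..1, ‖F (x + H * I)‖)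
      + (∫ y in (-H)..H, ‖F ((1:ℝ) + y * I)‖) + ∫ y in (-H)..H, ‖F ((-1:ℝ) + y * I)‖ := by
  have hH0 : 0 < H := by linarith
  set R : Set ℂ := Set.uIcc (-1:ℝ) 1 ×ℂ Set.uIcc (-H) H with hR
  have hRn : R ∈ nhds (0:ℂ) := by
    have : Set.Ioo (-1:ℝ) 1 ×ℂ Set.Ioo (-H) H ⊆ R := by
      rw [hR, Set.uIcc_of_le (by norm_num), Set.uIcc_of_le (by linarith)]
      exact Set.inter_subset_inter (Set.preimage_mono Set.Ioo_subset_Icc_self)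
        (Set.preimage_mono Set.Ioo_subset_Icc_self)
    refine Filter.mem_of_superset ((isOpen_Ioo.reProdIm isOpen_Ioo).mem_nhds ?_) this
    simp [Complex.mem_reProdIm, hH0]
  have hd : DifferentiableOn ℂ (dslope F 0) R := (Complex.differentiableOn_dslope hRn).mpr hF
  have h0 := Complex.integral_boundary_rect_eq_zero_of_differentiableOn (dslope F 0)
    ((-1:ℝ) + (-H:ℝ) * I) ((1:ℝ) + H * I) (by simpa [hR] using hd)
  simp only [add_re, add_im, mul_re, mul_im, ofReal_re, ofReal_im, I_re, I_im, mul_zero, mul_one,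
    sub_zero, add_zero, zero_add, zero_mul, smul_eq_mul] at h0
  have key : ∀ (a b : ℝ) (γ : ℝ → ℂ), a ≤ b → Continuous γ → (∀ x ∈ Set.Icc a b, γ x ∈ R) →
      (∀ x ∈ Set.Icc a b, 1 ≤ ‖γ x‖) →
      ∃ E : ℂ, ‖E‖ ≤ ∫ x in a..b, ‖F (γ x)‖ ∧
        (∫ x in a..b, dslope F 0 (γ x)) = E - F 0 * ∫ x in a..b, (γ x)⁻¹ := by
    intro a b γ hab hγ hγR hγ1
    have hne : ∀ x ∈ Set.Icc a b, γ x ≠ 0 := fun x hx h => by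
      have := hγ1 x hx; rw [h, norm_zero] at this; linarith
    have hcF : ContinuousOn (fun x => F (γ x)) (Set.Icc a b) :=
      hF.continuousOn.comp hγ.continuousOn hγR
    have hci : ContinuousOn (fun x => (γ x)⁻¹) (Set.Icc a b) := hγ.continuousOn.inv₀ hne
    refine ⟨∫ x in a..b, (γ x)⁻¹ * F (γ x), ?_, ?_⟩
    · refine intervalIntegral.norm_integral_le_of_norm_le hab ?_ ?_
      · refine Filter.Eventually.of_forall fun x hx => ?_
        have hx' := Set.Ioc_subset_Icc_self hx
        rw [norm_mul, norm_inv]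
        have h1 := hγ1 x hx'
        have : ‖γ x‖⁻¹ ≤ 1 := inv_le_one_of_one_le₀ h1
        nlinarith [norm_nonneg (F (γ x))]
      · exact (hcF.norm.mono (by rw [Set.uIcc_of_le hab])).intervalIntegrable
    · rw [← intervalIntegral.integral_const_mul, ← intervalIntegral.integral_sub]
      · refine intervalIntegral.integral_congr fun x hx => ?_
        rw [Set.uIcc_of_le hab] at hx
        rw [dslope_of_ne _ (hne x hx), slope_def_field]
        field_simp [hne x hx]
        ring
      · exact ((hci.mul hcF).mono (by rw [Set.uIcc_of_le hab])).intervalIntegrable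
      · exact ((continuousOn_const.mul hci).mono (by rw [Set.uIcc_of_le hab])).intervalIntegrable
  have memR : ∀ z : ℂ, z ∈ R ↔ (-1 ≤ z.re ∧ z.re ≤ 1) ∧ (-H ≤ z.im ∧ z.im ≤ H) := by
    intro z
    rw [hR, Complex.mem_reProdIm, Set.uIcc_of_le (by norm_num), Set.uIcc_of_le (by linarith)]
    rfl
  obtain ⟨E1, hE1, e1⟩ := key (-1) 1 (fun x => x + (-H:ℝ) * I) (by norm_num) (by fun_prop)
    (by intro x hx; rw [memR]; simp; exact ⟨hx, by linarith⟩)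
    (by intro x hx
        refine le_trans ?_ (Complex.abs_im_le_norm _)
        simp [abs_of_pos hH0, hH])
  obtain ⟨E2, hE2, e2⟩ := key (-1) 1 (fun x => x + H * I) (by norm_num) (by fun_prop)
    (by intro x hx; rw [memR]; simp; exact ⟨hx, by linarith⟩)
    (by intro x hx
        refine le_trans ?_ (Complex.abs_im_le_norm _)
        simp [abs_of_pos hH0, hH])
  obtain ⟨E3, hE3, e3⟩ := key (-H) H (fun y => (1:ℝ) + y * I) (by linarith) (by fun_prop)
    (by intro x hx; rw [memR]; simp; exact hx)
    (by intro x hx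
        refine le_trans ?_ (Complex.abs_re_le_norm _)
        simp)
  obtain ⟨E4, hE4, e4⟩ := key (-H) H (fun y => (-1:ℝ) + y * I) (by linarith) (by fun_prop)
    (by intro x hx; rw [memR]; simp; exact hx)
    (by intro x hx
        refine le_trans ?_ (Complex.abs_re_le_norm _)
        simp)
  rw [e1, e2, e3, e4] at h0
  set J1 := ∫ x in (-1:ℝ)..1, ((x:ℂ) + (-H:ℝ) * I)⁻¹
  set J2 := ∫ x in (-1:ℝ)..1, ((x:ℂ) + H * I)⁻¹
  set J3 := ∫ y in (-H)..H, (((1:ℝ):ℂ) + y * I)⁻¹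
  set J4 := ∫ y in (-H)..H, (((-1:ℝ):ℂ) + y * I)⁻¹
  have heq : F 0 * (J1 - J2 + I * J3 - I * J4) = E1 - E2 + I * E3 - I * E4 := by
    linear_combination -h0
  have imJ : ∀ (a b : ℝ) (γ : ℝ → ℂ), a ≤ b → Continuous γ → (∀ x, γ x ≠ 0) →
      (∫ x in a..b, (γ x)⁻¹).im = ∫ x in a..b, ((γ x)⁻¹).im ∧
      (∫ x in a..b, (γ x)⁻¹).re = ∫ x in a..b, ((γ x)⁻¹).re := by
    intro a b γ hab hγ hne
    have hi : IntervalIntegrable (fun x => (γ x)⁻¹) MeasureTheory.volume a b :=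
      (hγ.inv₀ hne).intervalIntegrable _ _
    exact ⟨(Complex.imCLM.intervalIntegral_comp_comm hi).symm,
      (Complex.reCLM.intervalIntegral_comp_comm hi).symm⟩
  have hn1 : ∀ x : ℝ, ((x:ℂ) + (-H:ℝ) * I) ≠ 0 := fun x h => by
    have := congrArg Complex.im h; simp at this; linarith
  have hn2 : ∀ x : ℝ, ((x:ℂ) + H * I) ≠ 0 := fun x h => by
    have := congrArg Complex.im h; simp at this; linarith
  have hn3 : ∀ y : ℝ, (((1:ℝ):ℂ) + y * I) ≠ 0 := fun x h => by
    have := congrArg Complex.re h; simp at this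
  have hn4 : ∀ y : ℝ, (((-1:ℝ):ℂ) + y * I) ≠ 0 := fun x h => by
    have := congrArg Complex.re h; simp at this
  have i1 : 0 ≤ J1.im := by
    rw [(imJ (-1) 1 _ (by norm_num) (by fun_prop) hn1).1]
    refine intervalIntegral.integral_nonneg (by norm_num) fun x _ => ?_
    rw [Complex.inv_im]; simp
    exact div_nonneg hH0.le (Complex.normSq_nonneg _)
  have i2 : J2.im ≤ 0 := by
    rw [(imJ (-1) 1 _ (by norm_num) (by fun_prop) hn2).1]
    rw [← neg_nonneg, ← intervalIntegral.integral_neg]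
    refine intervalIntegral.integral_nonneg (by norm_num) fun x _ => ?_
    rw [Complex.inv_im]; simp
    rw [neg_div, neg_nonpos]
    exact div_nonneg hH0.le (Complex.normSq_nonneg _)
  have i4 : J4.re ≤ 0 := by
    rw [(imJ (-H) H _ (by linarith) (by fun_prop) hn4).2]
    rw [← neg_nonneg, ← intervalIntegral.integral_neg]
    refine intervalIntegral.integral_nonneg (by linarith) fun x _ => ?_
    rw [Complex.inv_re]; simp
    rw [neg_div, neg_nonpos]
    exact div_nonneg zero_le_one (Complex.normSq_nonneg _)
  have i3 : 1 ≤ J3.re := by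
    rw [(imJ (-H) H _ (by linarith) (by fun_prop) hn3).2]
    have hc : Continuous fun y : ℝ => ((((1:ℝ):ℂ) + y * I)⁻¹).re :=
      Complex.continuous_re.comp (Continuous.inv₀ (by fun_prop) hn3)
    have hpt : ∀ y : ℝ, ((((1:ℝ):ℂ) + y * I)⁻¹).re = 1 / (1 + y ^ 2) := by
      intro y
      rw [Complex.inv_re]; simp [Complex.normSq_apply]; ring_nf
    have h1 : ∫ y in (-1:ℝ)..1, (1/2:ℝ) ≤ ∫ y in (-1:ℝ)..1, ((((1:ℝ):ℂ) + y * I)⁻¹).re := by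
      refine intervalIntegral.integral_mono_on (by norm_num) (by simp) (hc.intervalIntegrable _ _) ?_
      intro y hy
      rw [hpt]
      rw [div_le_div_iff₀ (by norm_num) (by positivity)]
      nlinarith [hy.1, hy.2]
    have h2 : ∫ y in (-1:ℝ)..1, ((((1:ℝ):ℂ) + y * I)⁻¹).re
        ≤ ∫ y in (-H)..H, ((((1:ℝ):ℂ) + y * I)⁻¹).re := by
      refine intervalIntegral.integral_mono_interval (by linarith) (by norm_num) hH ?_
        (hc.intervalIntegrable _ _)
      refine Filter.Eventually.of_forall fun y => ?_
      simp only [hpt, Pi.zero_apply]; positivity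
    refine le_trans ?_ (h1.trans h2)
    simp; norm_num
  have hJ : 1 ≤ ‖J1 - J2 + I * J3 - I * J4‖ := by
    refine le_trans ?_ ((le_abs_self _).trans (Complex.abs_im_le_norm _))
    simp
    linarith
  calc ‖F 0‖ ≤ ‖F 0‖ * ‖J1 - J2 + I * J3 - I * J4‖ := le_mul_of_one_le_right (norm_nonneg _) hJ
    _ = ‖E1 - E2 + I * E3 - I * E4‖ := by rw [← norm_mul, heq]
    _ ≤ ‖E1‖ + ‖E2‖ + ‖E3‖ + ‖E4‖ := by
      refine (norm_sub_le _ _).trans ?_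
      refine add_le_add ((norm_add_le _ _).trans (add_le_add (norm_sub_le _ _) ?_)) ?_ <;> simp
    _ ≤ _ := by gcongr

/-- Gaussian-weighted convexity bound across the strip `-1/2 ≤ Re s ≤ 3/2`. -/
theorem sq_norm_le_edges (G : ℂ → ℂ) (τ H M : ℝ) (hH : 1 ≤ H)
    (hG : ∀ s : ℂ, -1/2 ≤ s.re → s.re ≤ 3/2 → |s.im - τ| ≤ H → DifferentiableAt ℂ G s)
    (hM : ∀ s : ℂ, -1/2 ≤ s.re → s.re ≤ 3/2 → |s.im - τ| = H → ‖G s‖ ≤ M) :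
    ‖G ((1/2:ℝ) + τ * I)‖ ^ 2 ≤ 3 * ((∫ t in (τ-H)..(τ+H), ‖G ((3/2:ℝ) + t * I)‖ ^ 2 *
        Real.exp (-(t-τ)^2)) + (∫ t in (τ-H)..(τ+H), ‖G ((-1/2:ℝ) + t * I)‖ ^ 2 *
        Real.exp (-(t-τ)^2))) + 12 * M ^ 2 * Real.exp (-H^2) := by
  have hH0 : 0 < H := by linarith
  set s0 : ℂ := (1/2:ℝ) + τ * I with hs0
  set F : ℂ → ℂ := fun z => G (s0 + z) ^ 2 * Complex.exp (z ^ 2) with hFdef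
  have memR : ∀ z : ℂ, z ∈ Set.uIcc (-1:ℝ) 1 ×ℂ Set.uIcc (-H) H ↔
      (-1 ≤ z.re ∧ z.re ≤ 1) ∧ (-H ≤ z.im ∧ z.im ≤ H) := by
    intro z
    rw [Complex.mem_reProdIm, Set.uIcc_of_le (by norm_num), Set.uIcc_of_le (by linarith)]
    rfl
  have re0 : ∀ z, (s0 + z).re = 1/2 + z.re := by intro z; simp [hs0]
  have im0 : ∀ z, (s0 + z).im = τ + z.im := by intro z; simp [hs0]
  have hF : DifferentiableOn ℂ F (Set.uIcc (-1:ℝ) 1 ×ℂ Set.uIcc (-H) H) := by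
    intro z hz
    rw [memR] at hz
    have : DifferentiableAt ℂ G (s0 + z) := hG _ (by rw [re0]; linarith) (by rw [re0]; linarith)
      (by rw [im0, abs_le]; constructor <;> linarith)
    have h2 : DifferentiableAt ℂ (fun z => G (s0 + z)) z :=
      DifferentiableAt.comp z (g := G) this (by fun_prop)
    exact ((h2.pow 2).mul (by fun_prop)).differentiableWithinAt
  have hb := norm_center_le_boundary F H hH hF
  have hnorm : ∀ z : ℂ, ‖F z‖ = ‖G (s0 + z)‖ ^ 2 * Real.exp (z.re ^ 2 - z.im ^ 2) := by
    intro z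
    simp only [hFdef, norm_mul, norm_pow, Complex.norm_exp]
    congr 2
    simp [pow_two]
  have hF0 : ‖F 0‖ = ‖G s0‖ ^ 2 := by rw [hnorm]; simp
  have he : Real.exp 1 ≤ 3 := by have := Real.exp_one_lt_d9; linarith
  have hor : ∀ h : ℝ, |h| = H → ∫ x in (-1:ℝ)..1, ‖F (x + h * I)‖ ≤ 6 * M ^ 2 * Real.exp (-H^2) := by
    intro h hh
    have hpt : ∀ x ∈ Set.uIoc (-1:ℝ) 1, ‖(‖F (x + h * I)‖:ℝ)‖ ≤ 3 * M ^ 2 * Real.exp (-H^2) := by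
      intro x hx
      rw [Set.uIoc_of_le (by norm_num)] at hx
      rw [norm_norm, hnorm]
      have h1 : ‖G (s0 + (x + h * I))‖ ≤ M := by
        refine hM _ ?_ ?_ ?_
        · rw [re0]; simp; linarith [hx.1]
        · rw [re0]; simp; linarith [hx.2]
        · rw [im0]; simp [hh]
      have h2 : Real.exp (((x:ℂ) + h * I).re ^ 2 - ((x:ℂ) + h * I).im ^ 2) ≤ 3 * Real.exp (-H^2) := by
        refine le_trans ?_ (mul_le_mul_of_nonneg_right he (Real.exp_pos _).le)
        rw [← Real.exp_add]
        refine Real.exp_le_exp.mpr ?_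
        simp
        rw [← sq_abs h, hh]
        nlinarith [hx.1, hx.2]
      calc _ ≤ M ^ 2 * (3 * Real.exp (-H^2)) := by gcongr
        _ = _ := by ring
    have := intervalIntegral.norm_integral_le_of_norm_le_const hpt
    refine (Real.le_norm_self _).trans (this.trans (le_of_eq ?_))
    norm_num; ring
  have ver : ∀ x : ℝ, x ^ 2 = 1 → ∫ y in (-H)..H, ‖F (x + y * I)‖ ≤
      3 * ∫ t in (τ-H)..(τ+H), ‖G (((1/2 + x : ℝ):ℂ) + t * I)‖ ^ 2 * Real.exp (-(t-τ)^2) := by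
    intro x hx
    have e : ∀ y : ℝ, ‖F (x + y * I)‖ = Real.exp 1 * ((fun t : ℝ =>
        ‖G (((1/2 + x : ℝ):ℂ) + t * I)‖ ^ 2 * Real.exp (-(t-τ)^2)) (y + τ)) := by
      intro y
      rw [hnorm]
      have : s0 + (x + y * I) = ((1/2 + x : ℝ):ℂ) + ((y + τ : ℝ):ℂ) * I := by
        rw [hs0]; push_cast; ring
      rw [this]
      simp only
      rw [mul_left_comm, ← Real.exp_add]
      congr 2
      simp [hx]; ring
    simp_rw [e]
    rw [intervalIntegral.integral_const_mul, intervalIntegral.integral_comp_add_right (fun t : ℝ =>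
        ‖G (((1/2 + x : ℝ):ℂ) + t * I)‖ ^ 2 * Real.exp (-(t-τ)^2)) τ]
    rw [show -H + τ = τ - H by ring, show H + τ = τ + H by ring]
    refine mul_le_mul_of_nonneg_right he ?_
    refine intervalIntegral.integral_nonneg (by linarith) fun t _ => by positivity
  rw [hF0] at hb
  have a1 := hor (-H) (by rw [abs_neg, abs_of_pos hH0])
  have a2 := hor H (abs_of_pos hH0)
  have a3 := ver 1 (by norm_num)
  have a4 := ver (-1) (by norm_num)
  norm_num at a3 a4 a1 a2 hb ⊢
  linarith

end MSW

namespace MSW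

/-- Abel summation bound by total variation, for sums over `Ico`. -/
theorem norm_sum_telescope_le (w z : ℕ → ℂ) (a b : ℕ) (hab : a ≤ b) (hz : ∀ n, ‖z n‖ ≤ 1) :
    ‖∑ n ∈ Finset.Ico a (b+1), w n * (z n - z (n+1))‖
      ≤ ‖w a‖ + ‖w b‖ + ∑ n ∈ Finset.Ico a b, ‖w (n+1) - w n‖ := by
  have key : ∑ n ∈ Finset.Ico a (b+1), w n * (z n - z (n+1))
      = w a * z a - w b * z (b+1) + ∑ n ∈ Finset.Ico a b, (w (n+1) - w n) * z (n+1) := by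
    induction b, hab using Nat.le_induction with
    | base => simp; ring
    | succ b hab ih =>
      rw [Finset.sum_Ico_succ_top (by omega), ih, Finset.sum_Ico_succ_top hab]
      ring
  rw [key]
  refine (norm_add_le _ _).trans (add_le_add ((norm_sub_le _ _).trans (add_le_add ?_ ?_))
    ((norm_sum_le _ _).trans (Finset.sum_le_sum fun n _ => ?_)))
  all_goals
    rw [norm_mul]
    exact mul_le_of_le_one_right (norm_nonneg _) (hz _)

theorem inv_one_sub_exp (δ : ℝ) (h0 : 0 < δ) (h1 : δ ≤ Real.pi) :
    (1 - Complex.exp (δ * I))⁻¹ = (1/2 : ℂ) + ((Real.cos (δ/2) / Real.sin (δ/2) / 2 : ℝ) : ℂ) * I := by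
  have hs : 0 < Real.sin (δ/2) := Real.sin_pos_of_pos_of_lt_pi (by linarith) (by linarith [Real.pi_pos])
  have e : 1 - Complex.exp (δ * I) = -2 * I * Complex.sin (δ/2) * Complex.exp (δ/2 * I) := by
    rw [Complex.sin]
    have : Complex.exp (δ * I) = Complex.exp (δ/2 * I) * Complex.exp (δ/2 * I) := by
      rw [← Complex.exp_add]; congr 1; ring
    have h2 : Complex.exp (-(δ/2) * I) * Complex.exp (δ/2 * I) = 1 := by
      rw [← Complex.exp_add]; simp
    linear_combination (-1) * this + (-1) * h2 + (Complex.exp (-(δ/2) * I) * Complex.exp (δ/2 * I) - Complex.exp (δ/2 * I) * Complex.exp (δ/2 * I)) * I_sq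
  have hsc : Complex.sin (δ/2) ≠ 0 := by
    have : Complex.sin (δ/2) = ((Real.sin (δ/2) : ℝ) : ℂ) := by push_cast; rfl
    rw [this]; exact_mod_cast hs.ne'
  rw [e]
  push_cast
  have hexp : Complex.exp (δ/2 * I) = Complex.cos (δ/2) + Complex.sin (δ/2) * I := by
    rw [Complex.exp_mul_I]
  have hne : Complex.exp (δ/2 * I) ≠ 0 := Complex.exp_ne_zero _
  refine inv_eq_of_mul_eq_one_right ?_
  rw [hexp]
  have hcs := Complex.cos_sq_add_sin_sq (δ/2 : ℂ)
  field_simp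
  linear_combination hcs + (-Complex.cos (δ/2) ^ 2) * I_sq + (-Complex.sin (δ/2) ^ 2) * I_sq - Complex.cos (δ/2) * Complex.sin (δ/2) * I * I_sq

/-- Kusmin–Landau inequality for phases with decreasing increments. -/
theorem kusmin_landau (φ : ℕ → ℝ) (a b : ℕ) (l : ℝ) (hl : 0 < l)
    (h1 : ∀ n ∈ Finset.Ico a b, φ (n+1) - φ n ≤ Real.pi)
    (h2 : ∀ n ∈ Finset.Ico a b, l ≤ φ (n+1) - φ n)
    (h3 : ∀ n, n ∈ Finset.Ico a b → n + 1 ∈ Finset.Ico a b →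
      φ (n+2) - φ (n+1) ≤ φ (n+1) - φ n) :
    ‖∑ n ∈ Finset.Ico a b, Complex.exp (φ n * I)‖ ≤ 12 / l := by
  rcases le_or_gt b a with hba | hab
  · rw [Finset.Ico_eq_empty_of_le hba]; simp; positivity
  obtain ⟨c, rfl⟩ : ∃ c, b = c + 1 := ⟨b - 1, by omega⟩
  have hac : a ≤ c := by omega
  set δ : ℕ → ℝ := fun n => φ (n+1) - φ n with hδ
  set w : ℕ → ℂ := fun n => (1 - Complex.exp (δ n * I))⁻¹ with hw
  set z : ℕ → ℂ := fun n => Complex.exp (φ n * I) with hz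
  set ct : ℕ → ℝ := fun n => Real.cos (δ n/2) / Real.sin (δ n/2) / 2 with hct
  have hpi := Real.pi_pos
  have hwe : ∀ n ∈ Finset.Ico a (c+1), w n = (1/2 : ℂ) + (ct n : ℂ) * I := fun n hn =>
    inv_one_sub_exp (δ n) (hl.trans_le (h2 n hn)) (h1 n hn)
  have hsin : ∀ n ∈ Finset.Ico a (c+1), l / Real.pi ≤ Real.sin (δ n / 2) := by
    intro n hn
    have hd1 := h1 n hn
    have hd2 := h2 n hn
    have := Real.mul_le_sin (x := δ n / 2) (by simp only [hδ]; linarith) (by simp only [hδ]; linarith)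
    refine le_trans ?_ this
    rw [show 2 / Real.pi * (δ n / 2) = δ n / Real.pi by ring]
    gcongr
  have hctb : ∀ n ∈ Finset.Ico a (c+1), |ct n| ≤ 2 / l := by
    intro n hn
    have hs := hsin n hn
    have hs0 : 0 < Real.sin (δ n / 2) := lt_of_lt_of_le (by positivity) hs
    simp only [hct]
    rw [abs_div, abs_div, abs_of_pos hs0, abs_two, div_div]
    have hc : |Real.cos (δ n / 2)| ≤ 1 := Real.abs_cos_le_one _
    rw [div_le_div_iff₀ (by positivity) hl]
    rw [div_le_iff₀ hpi] at hs
    have := Real.pi_lt_four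
    nlinarith
  have hl4 : l ≤ 4 := by
    have := (h2 a (by simp; omega)).trans (h1 a (by simp; omega))
    linarith [Real.pi_lt_four]
  have hwb : ∀ n ∈ Finset.Ico a (c+1), ‖w n‖ ≤ 1/2 + 2 / l := by
    intro n hn
    rw [hwe n hn]
    refine (norm_add_le _ _).trans ?_
    have := hctb n hn
    simp only [norm_mul, Complex.norm_real, norm_I, mul_one, Real.norm_eq_abs]
    norm_num; exact this
  have hdiff : ∀ n ∈ Finset.Ico a c, ‖w (n+1) - w n‖ = ct (n+1) - ct n := by
    intro n hn
    have hn1 : n ∈ Finset.Ico a (c+1) := by simp at hn ⊢; omega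
    have hn2 : n + 1 ∈ Finset.Ico a (c+1) := by simp at hn ⊢; omega
    rw [hwe _ hn1, hwe _ hn2]
    have : (1/2 : ℂ) + (ct (n+1) : ℂ) * I - ((1/2 : ℂ) + (ct n : ℂ) * I)
        = ((ct (n+1) - ct n : ℝ) : ℂ) * I := by push_cast; ring
    rw [this, norm_mul, norm_I, mul_one, Complex.norm_real, Real.norm_eq_abs, abs_of_nonneg]
    rw [sub_nonneg]
    simp only [hct]
    have hsn := hsin n hn1
    have hsn1 := hsin (n+1) hn2
    have p1 : 0 < Real.sin (δ n / 2) := lt_of_lt_of_le (by positivity) hsn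
    have p2 : 0 < Real.sin (δ (n+1) / 2) := lt_of_lt_of_le (by positivity) hsn1
    have hmono : δ (n+1) ≤ δ n := h3 n hn1 hn2
    refine div_le_div_of_nonneg_right ?_ (by norm_num)
    rw [div_le_div_iff₀ p1 p2]
    have : 0 ≤ Real.sin (δ n / 2 - δ (n+1) / 2) := by
      refine Real.sin_nonneg_of_nonneg_of_le_pi (by linarith) ?_
      have := h1 n hn1
      have := h2 (n+1) hn2
      simp only [hδ] at *
      linarith
    rw [Real.sin_sub] at this
    linarith
  have hterm : ∀ n ∈ Finset.Ico a (c+1), z n = w n * (z n - z (n+1)) := by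
    intro n hn
    have e : z (n+1) = z n * Complex.exp (δ n * I) := by
      simp only [hz, hδ]; rw [← Complex.exp_add]; congr 1; push_cast; ring
    have hne : 1 - Complex.exp (δ n * I) ≠ 0 := by
      intro h0
      have h5 := hwe n hn
      simp only [hw] at h5
      rw [h0, inv_zero] at h5
      have := congrArg Complex.re h5
      simp at this
    rw [e]; simp only [hw]
    field_simp
  rw [Finset.sum_congr rfl hterm]
  refine (norm_sum_telescope_le w z a c hac ?_).trans ?_
  · intro n; simp only [hz]; rw [Complex.norm_exp_ofReal_mul_I]
  · rw [Finset.sum_congr rfl hdiff, Finset.sum_Ico_eq_sum_range]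
    have ht : ∀ k, ∑ i ∈ Finset.range k, (ct (a + i + 1) - ct (a + i)) = ct (a + k) - ct a := by
      intro k
      have := Finset.sum_range_sub (fun i => ct (a + i)) k
      simpa [add_assoc] using this
    rw [ht]
    have e1 := hwb a (by simp; omega)
    have e2 := hwb c (by simp; omega)
    have e3 := hctb a (by simp; omega)
    have e4 := hctb c (by simp; omega)
    rw [show a + (c - a) = c by omega]
    have e5 : 1 ≤ 4 / l := by rw [le_div_iff₀ hl]; linarith
    have e6 : (12:ℝ) / l = 6 * (2 / l) := by ring
    have e7 : (4:ℝ) / l = 2 * (2 / l) := by ring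
    have := abs_le.mp e3
    have := abs_le.mp e4
    linarith

end MSW

namespace MSW

theorem sum_natAbs_le (c : ℕ → ℝ) (hc : ∀ n, 0 ≤ c n) (H h : ℕ) (hh : h < H) :
    ∑ h' ∈ Finset.range H, c (max h h' - min h h') ≤ 2 * ∑ k ∈ Finset.range H, c k := by
  classical
  rw [← Finset.sum_filter_add_sum_filter_not (Finset.range H) (fun h' => h' ≤ h), two_mul]
  refine add_le_add ?_ ?_
  · rw [← Finset.sum_image (f := c) (g := fun h' => max h h' - min h h')]
    · refine Finset.sum_le_sum_of_subset_of_nonneg ?_ fun _ _ _ => hc _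
      intro x hx
      simp only [Finset.mem_image, Finset.mem_filter, Finset.mem_range] at hx ⊢
      omega
    · intro x hx y hy hxy
      simp only [Finset.coe_filter, Finset.mem_range, Set.mem_setOf_eq] at hx hy hxy
      omega
  · rw [← Finset.sum_image (f := c) (g := fun h' => max h h' - min h h')]
    · refine Finset.sum_le_sum_of_subset_of_nonneg ?_ fun _ _ _ => hc _
      intro x hx
      simp only [Finset.mem_image, Finset.mem_filter, Finset.mem_range] at hx ⊢
      omega
    · intro x hx y hy hxy
      simp only [Finset.coe_filter, Finset.mem_range, Set.mem_setOf_eq] at hx hy hxy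
      omega

/-- Weyl–van der Corput inequality for unimodular sequences. -/
theorem weyl_van_der_corput (z : ℕ → ℂ) (a b H : ℕ) (hH : 0 < H) (hab : a ≤ b) :
    ‖∑ n ∈ Finset.Ico a b, z n‖ ^ 2 ≤ 2 * ((b - a + H : ℝ) / H) *
      ∑ k ∈ Finset.range H, ‖∑ n ∈ Finset.Ico a (b - k), z (n + k) * starRingEnd ℂ (z n)‖ := by
  classical
  set v : ℕ → ℕ → ℂ := fun h m => if a + h ≤ m ∧ m < b + h then z (m - h) else 0 with hv
  set S : ℂ := ∑ n ∈ Finset.Ico a b, z n with hS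
  set J := Finset.Ico a (b + H) with hJ
  have hsum : ∀ h < H, ∑ m ∈ J, v h m = S := by
    intro h hh
    simp only [hv]
    rw [← Finset.sum_filter]
    have : J.filter (fun m => a + h ≤ m ∧ m < b + h) = Finset.Ico (a + h) (b + h) := by
      ext m; simp [hJ]; omega
    rw [this, hS, ← Finset.sum_Ico_add']
    refine Finset.sum_congr rfl fun m hm => by simp
  set c : ℕ → ℝ := fun k => ‖∑ n ∈ Finset.Ico a (b - k), z (n + k) * starRingEnd ℂ (z n)‖ with hc
  have hcorr0 : ∀ h h', h ≤ h' → h' < H → ‖∑ m ∈ J, v h m * starRingEnd ℂ (v h' m)‖ = c (h' - h) := by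
    intro h h' hhh hh'
    simp only [hc]
    congr 1
    have : ∀ m ∈ J, v h m * starRingEnd ℂ (v h' m) =
        if a + h' ≤ m ∧ m < b + h then z (m - h) * starRingEnd ℂ (z (m - h')) else 0 := by
      intro m hm
      simp only [hv]
      split_ifs <;> first | omega | simp
    rw [Finset.sum_congr rfl this, ← Finset.sum_filter]
    by_cases hbb : h' - h ≤ b
    · have : J.filter (fun m => a + h' ≤ m ∧ m < b + h) = Finset.Ico (a + h') (b - (h' - h) + h') := by
        ext m; simp [hJ]; omega
      rw [this, ← Finset.sum_Ico_add']
      refine Finset.sum_congr rfl fun m hm => ?_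
      rw [show m + h' - h = m + (h' - h) by omega, show m + h' - h' = m by omega]
    · have : J.filter (fun m => a + h' ≤ m ∧ m < b + h) = ∅ := by
        ext m; simp [hJ]; omega
      rw [this, Finset.Ico_eq_empty_of_le (by omega)]; simp
  have hcorr : ∀ h < H, ∀ h' < H, ‖∑ m ∈ J, v h m * starRingEnd ℂ (v h' m)‖
      = c (max h h' - min h h') := by
    intro h hh h' hh'
    rcases le_total h h' with hl | hl
    · rw [hcorr0 h h' hl hh', max_eq_right hl, min_eq_left hl]
    · rw [max_eq_left hl, min_eq_right hl, ← hcorr0 h' h hl hh, ← Complex.norm_conj, map_sum]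
      congr 1
      refine Finset.sum_congr rfl fun m _ => ?_
      rw [map_mul, Complex.conj_conj, mul_comm]
  have hHS : (H:ℂ) * S = ∑ m ∈ J, ∑ h ∈ Finset.range H, v h m := by
    rw [Finset.sum_comm, Finset.sum_congr rfl fun h hh => hsum h (Finset.mem_range.mp hh)]
    simp
  have hcs : ((H:ℝ) * ‖S‖) ^ 2 ≤ (b - a + H : ℝ) * ∑ m ∈ J, ‖∑ h ∈ Finset.range H, v h m‖ ^ 2 := by
    have : (H:ℝ) * ‖S‖ = ‖∑ m ∈ J, ∑ h ∈ Finset.range H, v h m‖ := by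
      rw [← hHS, norm_mul, Complex.norm_natCast]
    rw [this]
    have hcard : (b - a + H : ℝ) = (J.card : ℝ) := by
      rw [hJ, Nat.card_Ico, Nat.cast_sub (by omega)]; push_cast; ring
    rw [hcard]
    calc _ ≤ (∑ m ∈ J, ‖∑ h ∈ Finset.range H, v h m‖) ^ 2 := by
          gcongr; exact norm_sum_le _ _
      _ ≤ _ := sq_sum_le_card_mul_sum_sq
  have hexp : ∑ m ∈ J, ‖∑ h ∈ Finset.range H, v h m‖ ^ 2
      ≤ H * (2 * ∑ k ∈ Finset.range H, c k) := by
    have e : ((∑ m ∈ J, ‖∑ h ∈ Finset.range H, v h m‖ ^ 2 : ℝ) : ℂ)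
        = ∑ h ∈ Finset.range H, ∑ h' ∈ Finset.range H, ∑ m ∈ J, v h m * starRingEnd ℂ (v h' m) := by
      push_cast
      simp_rw [← Complex.mul_conj', map_sum, Finset.sum_mul_sum]
      rw [Finset.sum_comm]
      refine Finset.sum_congr rfl fun h _ => ?_
      rw [Finset.sum_comm]
    have e2 : ∑ m ∈ J, ‖∑ h ∈ Finset.range H, v h m‖ ^ 2
        ≤ ∑ h ∈ Finset.range H, ∑ h' ∈ Finset.range H, c (max h h' - min h h') := by
      have h0 : 0 ≤ ∑ m ∈ J, ‖∑ h ∈ Finset.range H, v h m‖ ^ 2 :=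
        Finset.sum_nonneg fun _ _ => by positivity
      rw [← abs_of_nonneg h0, ← Real.norm_eq_abs, ← Complex.norm_real, e]
      refine (norm_sum_le _ _).trans (Finset.sum_le_sum fun h hh => ?_)
      refine (norm_sum_le _ _).trans (Finset.sum_le_sum fun h' hh' => ?_)
      exact (hcorr h (Finset.mem_range.mp hh) h' (Finset.mem_range.mp hh')).le
    refine e2.trans ?_
    calc _ ≤ ∑ h ∈ Finset.range H, (2 * ∑ k ∈ Finset.range H, c k) :=
          Finset.sum_le_sum fun h hh => sum_natAbs_le c (fun _ => norm_nonneg _) H h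
            (Finset.mem_range.mp hh)
      _ = _ := by simp
  have hHp : (0:ℝ) < H := by exact_mod_cast hH
  have hba : (0:ℝ) ≤ b - a := by
    have : (a:ℝ) ≤ b := by exact_mod_cast hab
    linarith
  have := hcs.trans (mul_le_mul_of_nonneg_left hexp (by linarith))
  rw [mul_pow] at this
  have h3 : (H:ℝ) ^ 2 * ‖S‖ ^ 2 ≤ (H:ℝ)^2 * (2 * ((b - a + H : ℝ) / H) * ∑ k ∈ Finset.range H, c k) := by
    refine this.trans (le_of_eq ?_)
    field_simp
  exact le_of_mul_le_mul_left h3 (by positivity)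

/-- Forward difference with real step. -/
noncomputable def fdiff (c : ℝ) (g : ℝ → ℝ) (x : ℝ) : ℝ := g (x + c) - g x

theorem hasDerivAt_fdiff {g g' : ℝ → ℝ} (h : ∀ x, 0 < x → HasDerivAt g (g' x) x) {c : ℝ}
    (hc : 0 ≤ c) : ∀ x, 0 < x → HasDerivAt (fdiff c g) (fdiff c g' x) x := by
  intro x hx
  have h1 : HasDerivAt (fun y => g (y + c)) (g' (x + c)) x :=
    HasDerivAt.comp_add_const x c (h (x + c) (by linarith))
  exact h1.sub (h x hx)

theorem exists_fdiff_eq {g g' : ℝ → ℝ} (h : ∀ x, 0 < x → HasDerivAt g (g' x) x) {c : ℝ}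
    (hc : 0 ≤ c) (x : ℝ) (hx : 0 < x) : ∃ ξ, x ≤ ξ ∧ ξ ≤ x + c ∧ fdiff c g x = c * g' ξ := by
  rcases hc.eq_or_lt with rfl | hc
  · exact ⟨x, le_rfl, by linarith, by simp [fdiff]⟩
  obtain ⟨ξ, hξ, e⟩ := exists_hasDerivAt_eq_slope g g' (show x < x + c by linarith)
    (fun y hy => (h y (by linarith [hy.1])).continuousAt.continuousWithinAt)
    (fun y hy => h y (by linarith [hy.1]))
  refine ⟨ξ, hξ.1.le, hξ.2.le, ?_⟩
  rw [e, fdiff, show x + c - x = c by ring]; field_simp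

theorem hd_log : ∀ x : ℝ, 0 < x → HasDerivAt Real.log (x⁻¹) x := fun x hx => Real.hasDerivAt_log hx.ne'

theorem hd_inv : ∀ x : ℝ, 0 < x → HasDerivAt (fun x : ℝ => x⁻¹) (-(1 / x^2)) x := fun x hx => by
  exact (hasDerivAt_inv hx.ne').congr_deriv (by simp)

theorem hd_inv2 : ∀ x : ℝ, 0 < x → HasDerivAt (fun x : ℝ => -(1 / x^2)) (2 / x^3) x := fun x hx => by
  have h := ((hasDerivAt_pow 2 x).inv (by positivity)).neg
  refine (h.congr_deriv ?_).congr_of_eventuallyEq (Eventually.of_forall fun y => ?_)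
  · field_simp; norm_num; ring
  · simp

theorem hd_inv3 : ∀ x : ℝ, 0 < x → HasDerivAt (fun x : ℝ => 2 / x^3) (-(6 / x^4)) x := fun x hx => by
  have h := ((hasDerivAt_pow 3 x).inv (by positivity)).const_mul 2
  refine (h.congr_deriv ?_).congr_of_eventuallyEq (Eventually.of_forall fun y => ?_)
  · field_simp; norm_num; ring
  · simp [div_eq_mul_inv]

/-- first, second, third differences of log -/
theorem fdiff1_log (c x : ℝ) (hc : 0 ≤ c) (hx : 0 < x) :
    c / (x + c) ≤ fdiff c Real.log x ∧ fdiff c Real.log x ≤ c / x := by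
  obtain ⟨ξ, h1, h2, e⟩ := exists_fdiff_eq hd_log hc x hx
  rw [e, div_eq_mul_inv, div_eq_mul_inv]
  have : 0 < ξ := by linarith
  constructor <;> gcongr

theorem fdiff2_log (c d x : ℝ) (hc : 0 ≤ c) (hd : 0 ≤ d) (hx : 0 < x) :
    c * d / (x + c + d) ^ 2 ≤ -(fdiff c (fdiff d Real.log) x) ∧
    -(fdiff c (fdiff d Real.log) x) ≤ c * d / x ^ 2 := by
  obtain ⟨ξ, h1, h2, e⟩ := exists_fdiff_eq (hasDerivAt_fdiff hd_log hd) hc x hx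
  obtain ⟨ζ, h3, h4, e2⟩ := exists_fdiff_eq hd_inv hd ξ (by linarith)
  rw [e, e2]
  have : 0 < ζ := by linarith
  have e3 : -(c * (d * -(1 / ζ ^ 2))) = c * d / ζ ^ 2 := by ring
  rw [e3]
  constructor
  · gcongr; linarith
  · gcongr; linarith

theorem fdiff3_log (c d e x : ℝ) (hc : 0 ≤ c) (hd : 0 ≤ d) (he : 0 ≤ e) (hx : 0 < x) :
    2 * c * d * e / (x + c + d + e) ^ 3 ≤ fdiff c (fdiff d (fdiff e Real.log)) x ∧
    fdiff c (fdiff d (fdiff e Real.log)) x ≤ 2 * c * d * e / x ^ 3 := by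
  obtain ⟨ξ, h1, h2, e1⟩ := exists_fdiff_eq (hasDerivAt_fdiff (hasDerivAt_fdiff hd_log he) hd) hc x hx
  obtain ⟨ζ, h3, h4, e2⟩ := exists_fdiff_eq (hasDerivAt_fdiff hd_inv he) hd ξ (by linarith)
  obtain ⟨ρ, h5, h6, e3⟩ := exists_fdiff_eq hd_inv2 he ζ (by linarith)
  rw [e1, e2, e3]
  have : 0 < ρ := by linarith
  have e4 : c * (d * (e * (2 / ρ ^ 3))) = 2 * c * d * e / ρ ^ 3 := by ring
  rw [e4]
  constructor
  · gcongr; linarith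
  · gcongr; linarith

theorem fdiff4_log (c d e f x : ℝ) (hc : 0 ≤ c) (hd : 0 ≤ d) (he : 0 ≤ e) (hf : 0 ≤ f) (hx : 0 < x) :
    fdiff c (fdiff d (fdiff e (fdiff f Real.log))) x ≤ 0 := by
  obtain ⟨ξ, h1, h2, e1⟩ := exists_fdiff_eq (hasDerivAt_fdiff (hasDerivAt_fdiff
    (hasDerivAt_fdiff hd_log hf) he) hd) hc x hx
  obtain ⟨ζ, h3, h4, e2⟩ := exists_fdiff_eq (hasDerivAt_fdiff (hasDerivAt_fdiff hd_inv hf) he) hd ξ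
    (by linarith)
  obtain ⟨ρ, h5, h6, e3⟩ := exists_fdiff_eq (hasDerivAt_fdiff hd_inv2 hf) he ζ (by linarith)
  obtain ⟨κ, h7, h8, e4⟩ := exists_fdiff_eq hd_inv3 hf ρ (by linarith)
  rw [e1, e2, e3, e4]
  have : 0 < κ := by linarith
  have : 0 ≤ c * (d * (e * (f * (6 / κ ^ 4)))) := by positivity
  linarith [show c * (d * (e * (f * -(6 / κ ^ 4)))) = -(c * (d * (e * (f * (6 / κ ^ 4))))) by ring]

end MSW

namespace MSW

theorem norm_exp_neg_sum (φ : ℕ → ℝ) (s : Finset ℕ) :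
    ‖∑ n ∈ s, Complex.exp ((-φ n : ℝ) * I)‖ = ‖∑ n ∈ s, Complex.exp (φ n * I)‖ := by
  rw [← Complex.norm_conj, map_sum]
  congr 1
  refine Finset.sum_congr rfl fun n _ => ?_
  rw [← Complex.exp_conj]
  congr 1
  simp

theorem exp_mul_conj (x y : ℝ) : Complex.exp (x * I) * starRingEnd ℂ (Complex.exp (y * I))
    = Complex.exp ((x - y : ℝ) * I) := by
  rw [← Complex.exp_conj, ← Complex.exp_add]
  congr 1
  simp; ring

/-- Weyl differencing for unimodular exponentials on a dyadic block. -/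
theorem weyl_step (φ : ℕ → ℝ) (a b H : ℕ) (hH : 0 < H) (hHa : H ≤ a) (hb : b ≤ 2 * a)
    (B : ℕ → ℝ) (hB : ∀ k, 0 ≤ B k)
    (hk : ∀ k, 1 ≤ k → k < H → ‖∑ n ∈ Finset.Ico a (b - k),
      Complex.exp ((φ (n + k) - φ n : ℝ) * I)‖ ≤ B k) :
    ‖∑ n ∈ Finset.Ico a b, Complex.exp (φ n * I)‖ ^ 2
      ≤ 4 * a / H * (a + ∑ k ∈ Finset.Ico 1 H, B k) := by
  have hHp : (0:ℝ) < H := by exact_mod_cast hH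
  have hB0 : 0 ≤ ∑ k ∈ Finset.Ico 1 H, B k := Finset.sum_nonneg fun k _ => hB k
  rcases le_or_gt a b with hab | hab
  swap
  · rw [Finset.Ico_eq_empty_of_le hab.le]; simp; positivity
  refine (weyl_van_der_corput (fun n => Complex.exp (φ n * I)) a b H hH hab).trans ?_
  have hb' : (b:ℝ) ≤ 2 * a := by exact_mod_cast hb
  have hHa' : (H:ℝ) ≤ a := by exact_mod_cast hHa
  have hab' : (a:ℝ) ≤ b := by exact_mod_cast hab
  have h1 : 2 * ((b - a + H : ℝ) / H) ≤ 4 * a / H := by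
    rw [← mul_div_assoc]; exact div_le_div_of_nonneg_right (by linarith) hHp.le
  refine mul_le_mul h1 ?_ (Finset.sum_nonneg fun _ _ => norm_nonneg _) (by positivity)
  rw [Finset.range_eq_Ico, Finset.sum_eq_sum_Ico_succ_bot hH]
  refine add_le_add ?_ (Finset.sum_le_sum fun k hk' => ?_)
  · refine (norm_sum_le _ _).trans ?_
    simp_rw [exp_mul_conj, Complex.norm_exp_ofReal_mul_I]
    simp only [Nat.sub_zero, Finset.sum_const, Nat.card_Ico, nsmul_eq_mul, mul_one]
    rw [Nat.cast_sub hab]; linarith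
  · simp_rw [exp_mul_conj]
    simp only [Finset.mem_Ico] at hk'
    exact hk k (by omega) hk'.2

theorem sum_inv_le (H : ℕ) : ∑ k ∈ Finset.Ico 1 H, (1:ℝ) / k ≤ 1 + Real.log H := by
  rcases Nat.eq_zero_or_pos H with rfl | hH
  · simp
  have h := harmonic_le_one_add_log (H - 1)
  have h2 : ((harmonic (H - 1) : ℚ) : ℝ) = ∑ k ∈ Finset.Ico 1 H, (1:ℝ) / k := by
    rw [harmonic, Finset.sum_Ico_eq_sum_range]
    push_cast
    refine Finset.sum_congr rfl fun i _ => by rw [one_div, add_comm]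
  rw [← h2]
  refine h.trans ?_
  rcases Nat.eq_or_lt_of_le hH with h1 | h1
  · simp [← h1]
  · gcongr
    · have : 0 < H - 1 := by omega
      exact_mod_cast this
    · exact_mod_cast Nat.sub_le _ _

variable (t α : ℝ)

theorem kl_zero (ht : 0 < t) (h0 : 0 ≤ α) (h1 : α ≤ 1) (a b : ℕ) (ha : 1 ≤ a) (hta : t ≤ a) :
    ‖∑ n ∈ Finset.Ico a b, Complex.exp ((t * Real.log (n + α) : ℝ) * I)‖ ≤ 24 * b / t := by
  rcases le_or_gt b a with hba | hab
  · rw [Finset.Ico_eq_empty_of_le hba]; simp; positivity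
  have hb1 : (1:ℝ) ≤ b := by exact_mod_cast (by omega : 1 ≤ b)
  have ha1 : (1:ℝ) ≤ a := by exact_mod_cast ha
  have e : ∀ n : ℕ, t * Real.log ((n + 1 : ℕ) + α) - t * Real.log (n + α)
      = t * fdiff 1 Real.log (n + α) := by
    intro n; simp only [fdiff]; push_cast; rw [show (n:ℝ) + 1 + α = n + α + 1 by ring]; ring
  refine (kusmin_landau (fun n => t * Real.log (n + α)) a b (t / (b + 1)) (by positivity)
    ?_ ?_ ?_).trans ?_
  · intro n hn
    rw [e]
    simp only [Finset.mem_Ico] at hn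
    have hna : (a:ℝ) ≤ n := by exact_mod_cast hn.1
    have h := (fdiff1_log 1 (n + α) zero_le_one (by linarith)).2
    have : t * fdiff 1 Real.log (n + α) ≤ t * (1 / (n + α)) := by gcongr
    refine this.trans ?_
    have : t * (1 / (n + α)) ≤ 1 := by
      rw [mul_one_div, div_le_one (by linarith)]; linarith
    linarith [Real.pi_gt_three]
  · intro n hn
    rw [e]
    simp only [Finset.mem_Ico] at hn
    have hna : (a:ℝ) ≤ n := by exact_mod_cast hn.1
    have hnb : (n:ℝ) + 1 ≤ b := by exact_mod_cast hn.2
    have h := (fdiff1_log 1 (n + α) zero_le_one (by linarith)).1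
    rw [div_eq_mul_one_div]
    gcongr
    refine le_trans ?_ h
    have : (0:ℝ) < n + α + 1 := by linarith
    gcongr
    linarith
  · intro n hn _
    rw [show n + 2 = (n + 1) + 1 by ring, e, e]
    simp only [Finset.mem_Ico] at hn
    have hna : (a:ℝ) ≤ n := by exact_mod_cast hn.1
    have h := (fdiff2_log 1 1 (n + α) zero_le_one zero_le_one (by linarith)).1
    have h' : 0 ≤ -fdiff 1 (fdiff 1 Real.log) (n + α) := le_trans (by positivity) h
    have h3 : fdiff 1 (fdiff 1 Real.log) (n + α)
        = fdiff 1 Real.log ((n + 1 : ℕ) + α) - fdiff 1 Real.log (n + α) := by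
      conv_lhs => rw [fdiff]
      push_cast; rw [show (n:ℝ) + 1 + α = n + α + 1 by ring]
    gcongr
    linarith
  · rw [div_div_eq_mul_div]
    exact div_le_div_of_nonneg_right (by linarith) ht.le

theorem kl_one (ht : 0 < t) (h0 : 0 ≤ α) (h1 : α ≤ 1) (a b k : ℕ) (ha : 1 ≤ a) (hk : 1 ≤ k)
    (hta : t * k ≤ 3 * a ^ 2) (hb : b ≤ 2 * a) :
    ‖∑ n ∈ Finset.Ico a (b - k), Complex.exp
      ((t * Real.log ((n + k : ℕ) + α) - t * Real.log (n + α) : ℝ) * I)‖ ≤ 192 * a ^ 2 / t * (1 / k) := by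
  have hk1 : (1:ℝ) ≤ k := by exact_mod_cast hk
  have ha1 : (1:ℝ) ≤ a := by exact_mod_cast ha
  rcases le_or_gt (b - k) a with hba | hab
  · rw [Finset.Ico_eq_empty_of_le hba]; simp; positivity
  have hb2 : (b:ℝ) ≤ 2 * a := by exact_mod_cast hb
  have hb1 : (1:ℝ) ≤ b := by exact_mod_cast (by omega : 1 ≤ b)
  rw [← norm_exp_neg_sum]
  have e0 : ∀ n : ℕ, -(t * Real.log ((n + k : ℕ) + α) - t * Real.log (n + α))
      = -(t * fdiff k Real.log (n + α)) := by
    intro n; simp only [fdiff]; push_cast; rw [show (n:ℝ) + k + α = n + α + k by ring]; ring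
  simp_rw [e0]
  have e : ∀ n : ℕ, -(t * fdiff k Real.log ((n + 1 : ℕ) + α)) - -(t * fdiff k Real.log (n + α))
      = t * -(fdiff 1 (fdiff k Real.log) (n + α)) := by
    intro n
    conv_rhs => rw [fdiff]
    push_cast; rw [show (n:ℝ) + 1 + α = n + α + 1 by ring]; ring
  refine (kusmin_landau (fun n => -(t * fdiff k Real.log (n + α))) a (b - k) (t * k / (2 * b) ^ 2)
    (by positivity) ?_ ?_ ?_).trans ?_
  · intro n hn
    rw [e]
    simp only [Finset.mem_Ico] at hn
    have hna : (a:ℝ) ≤ n := by exact_mod_cast hn.1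
    have h := (fdiff2_log 1 k (n + α) zero_le_one (by linarith) (by linarith)).2
    have h2 : t * -(fdiff 1 (fdiff k Real.log) (n + α)) ≤ t * (1 * k / (a:ℝ) ^ 2) := by
      gcongr
      refine h.trans ?_
      gcongr; linarith
    refine h2.trans ?_
    have : t * (1 * k / (a:ℝ) ^ 2) ≤ 3 := by
      rw [one_mul, ← mul_div_assoc, div_le_iff₀ (by positivity)]; exact hta
    linarith [Real.pi_gt_three]
  · intro n hn
    rw [e]
    simp only [Finset.mem_Ico] at hn
    have hna : (a:ℝ) ≤ n := by exact_mod_cast hn.1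
    have hnb : (n:ℝ) + k + 1 ≤ b := by exact_mod_cast (by omega : n + k + 1 ≤ b)
    have h := (fdiff2_log 1 k (n + α) zero_le_one (by linarith) (by linarith)).1
    rw [mul_div_assoc]
    gcongr
    refine le_trans ?_ h
    rw [one_mul]
    have : (0:ℝ) < n + α + 1 + k := by linarith
    gcongr
    linarith
  · intro n hn _
    rw [show n + 2 = (n + 1) + 1 by ring, e, e]
    simp only [Finset.mem_Ico] at hn
    have hna : (a:ℝ) ≤ n := by exact_mod_cast hn.1
    have h := (fdiff3_log 1 1 k (n + α) zero_le_one zero_le_one (by linarith) (by linarith)).1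
    have h' : 0 ≤ fdiff 1 (fdiff 1 (fdiff k Real.log)) (n + α) :=
      le_trans (by have : (0:ℝ) ≤ n := by positivity
                   positivity) h
    have h3 : fdiff 1 (fdiff 1 (fdiff k Real.log)) (n + α)
        = fdiff 1 (fdiff k Real.log) ((n + 1 : ℕ) + α) - fdiff 1 (fdiff k Real.log) (n + α) := by
      conv_lhs => rw [fdiff]
      push_cast; rw [show (n:ℝ) + 1 + α = n + α + 1 by ring]
    gcongr
    linarith
  · have : 12 / (t * k / (2 * b) ^ 2) = 48 * (b:ℝ)^2 / t * (1 / k) := by field_simp; norm_num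
    rw [this]
    have : (48:ℝ) * (b:ℝ)^2 ≤ 192 * a ^ 2 := by nlinarith
    gcongr

theorem kl_two (ht : 0 < t) (h0 : 0 ≤ α) (h1 : α ≤ 1) (a b k j : ℕ) (ha : 1 ≤ a) (hk : 1 ≤ k)
    (hj : 1 ≤ j) (hta : 2 * t * j * k ≤ 3 * a ^ 3) (hb : b ≤ 2 * a) :
    ‖∑ n ∈ Finset.Ico a (b - k - j), Complex.exp
      (((t * Real.log ((n + j + k : ℕ) + α) - t * Real.log ((n + j : ℕ) + α)) -
        (t * Real.log ((n + k : ℕ) + α) - t * Real.log (n + α)) : ℝ) * I)‖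
      ≤ 384 * a ^ 3 / t * (1 / j) := by
  have hk1 : (1:ℝ) ≤ k := by exact_mod_cast hk
  have hj1 : (1:ℝ) ≤ j := by exact_mod_cast hj
  have ha1 : (1:ℝ) ≤ a := by exact_mod_cast ha
  rcases le_or_gt (b - k - j) a with hba | hab
  · rw [Finset.Ico_eq_empty_of_le hba]; simp; positivity
  have hb2 : (b:ℝ) ≤ 2 * a := by exact_mod_cast hb
  have hb1 : (1:ℝ) ≤ b := by exact_mod_cast (by omega : 1 ≤ b)
  have e0 : ∀ n : ℕ, (t * Real.log ((n + j + k : ℕ) + α) - t * Real.log ((n + j : ℕ) + α)) -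
        (t * Real.log ((n + k : ℕ) + α) - t * Real.log (n + α))
      = t * fdiff j (fdiff k Real.log) (n + α) := by
    intro n; simp only [fdiff]; push_cast
    rw [show (n:ℝ) + k + α = n + α + k by ring, show (n:ℝ) + j + k + α = n + α + j + k by ring,
      show (n:ℝ) + j + α = n + α + j by ring]; ring
  simp_rw [e0]
  have e : ∀ n : ℕ, t * fdiff j (fdiff k Real.log) ((n + 1 : ℕ) + α)
      - t * fdiff j (fdiff k Real.log) (n + α)
      = t * fdiff 1 (fdiff j (fdiff k Real.log)) (n + α) := by
    intro n
    conv_rhs => rw [fdiff]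
    push_cast; rw [show (n:ℝ) + 1 + α = n + α + 1 by ring]; ring
  refine (kusmin_landau (fun n => t * fdiff j (fdiff k Real.log) (n + α)) a (b - k - j)
    (t * (2 * j * k) / (2 * b) ^ 3) (by positivity) ?_ ?_ ?_).trans ?_
  · intro n hn
    rw [e]
    simp only [Finset.mem_Ico] at hn
    have hna : (a:ℝ) ≤ n := by exact_mod_cast hn.1
    have h := (fdiff3_log 1 j k (n + α) zero_le_one (by linarith) (by linarith) (by linarith)).2
    have h2 : t * (fdiff 1 (fdiff j (fdiff k Real.log)) (n + α)) ≤ t * (2 * 1 * j * k / (a:ℝ) ^ 3) := by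
      gcongr
      refine h.trans ?_
      gcongr; linarith
    refine h2.trans ?_
    have : t * (2 * 1 * j * k / (a:ℝ) ^ 3) ≤ 3 := by
      rw [mul_one, ← mul_div_assoc, div_le_iff₀ (by positivity)]; linarith
    linarith [Real.pi_gt_three]
  · intro n hn
    rw [e]
    simp only [Finset.mem_Ico] at hn
    have hna : (a:ℝ) ≤ n := by exact_mod_cast hn.1
    have hnb : (n:ℝ) + k + j + 1 ≤ b := by exact_mod_cast (by omega : n + k + j + 1 ≤ b)
    have h := (fdiff3_log 1 j k (n + α) zero_le_one (by linarith) (by linarith) (by linarith)).1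
    rw [mul_div_assoc]
    gcongr
    refine le_trans ?_ h
    rw [mul_one]
    have : (0:ℝ) < n + α + 1 + j + k := by linarith
    gcongr
    linarith
  · intro n hn _
    rw [show n + 2 = (n + 1) + 1 by ring, e, e]
    simp only [Finset.mem_Ico] at hn
    have hna : (a:ℝ) ≤ n := by exact_mod_cast hn.1
    have h' := fdiff4_log 1 1 j k (n + α) zero_le_one zero_le_one (by linarith) (by linarith) (by linarith)
    have h3 : fdiff 1 (fdiff 1 (fdiff j (fdiff k Real.log))) (n + α)
        = fdiff 1 (fdiff j (fdiff k Real.log)) ((n + 1 : ℕ) + α)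
          - fdiff 1 (fdiff j (fdiff k Real.log)) (n + α) := by
      conv_lhs => rw [fdiff]
      push_cast; rw [show (n:ℝ) + 1 + α = n + α + 1 by ring]
    gcongr
    linarith
  · have : 12 / (t * (2 * j * k) / (2 * b) ^ 3) = 48 * (b:ℝ)^3 / t * (1 / (j * k)) := by
      field_simp; norm_num
    rw [this]
    have h3 : (48:ℝ) * (b:ℝ)^3 ≤ 384 * a ^ 3 := by
      have : (b:ℝ)^3 ≤ (2 * a)^3 := by gcongr
      nlinarith
    have : (1:ℝ) / (j * k) ≤ 1 / j := by
      apply one_div_le_one_div_of_le (by positivity); nlinarith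
    gcongr

end MSW

namespace MSW

/-- the phase `t log(n+α)` -/
noncomputable def ph (t α : ℝ) (n : ℕ) : ℝ := t * Real.log (n + α)

theorem single_diff (t α : ℝ) (ht : 0 < t) (h0 : 0 ≤ α) (h1 : α ≤ 1) (a b H : ℕ) (hH : 0 < H)
    (hHa : H ≤ a) (hta : t * H ≤ 3 * a ^ 2) (hb : b ≤ 2 * a) :
    ‖∑ n ∈ Finset.Ico a b, Complex.exp (ph t α n * I)‖ ^ 2
      ≤ 4 * a / H * (a + 192 * a ^ 2 / t * (1 + Real.log H)) := by
  have hH1 : (1:ℝ) ≤ H := by exact_mod_cast hH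
  refine (weyl_step (ph t α) a b H hH hHa hb (fun k => 192 * a ^ 2 / t * (1 / k))
    (fun k => by positivity) ?_).trans ?_
  · intro k hk hkH
    refine kl_one t α ht h0 h1 a b k (by omega) hk ?_ hb
    refine le_trans ?_ hta
    gcongr
  · rw [← Finset.mul_sum]
    gcongr
    exact sum_inv_le H

theorem double_diff (t α : ℝ) (ht : 0 < t) (h0 : 0 ≤ α) (h1 : α ≤ 1) (a b H : ℕ) (hH : 0 < H)
    (hHa : H ≤ a) (hta : 2 * t * H * H ≤ 3 * a ^ 3) (hb : b ≤ 2 * a) :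
    ‖∑ n ∈ Finset.Ico a b, Complex.exp (ph t α n * I)‖ ^ 2
      ≤ 4 * a / H * (a + H * Real.sqrt (4 * a / H * (a + 384 * a ^ 3 / t * (1 + Real.log H)))) := by
  have hH1 : (1:ℝ) ≤ H := by exact_mod_cast hH
  set B := Real.sqrt (4 * a / H * (a + 384 * a ^ 3 / t * (1 + Real.log H))) with hBdef
  refine (weyl_step (ph t α) a b H hH hHa hb (fun k => B)
    (fun k => Real.sqrt_nonneg _) ?_).trans ?_
  · intro k hk hkH
    refine Real.le_sqrt_of_sq_le ?_
    refine (weyl_step (fun n => ph t α (n + k) - ph t α n) a (b - k) H hH hHa (by omega)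
      (fun j => 384 * a ^ 3 / t * (1 / j)) (fun k => by positivity) ?_).trans ?_
    · intro j hj hjH
      refine kl_two t α ht h0 h1 a b k j (by omega) hk hj ?_ hb
      refine le_trans ?_ hta
      gcongr
    · rw [← Finset.mul_sum]
      gcongr
      exact sum_inv_le H
  · gcongr
    simp only [Finset.sum_const, Nat.card_Ico, nsmul_eq_mul]
    gcongr
    omega

/-- Bound for dyadic exponential sums of `n ^ {it}`; here `t = L ^ 1000`. -/
theorem dyadic_sq (L α : ℝ) (hL : 1 ≤ L) (h0 : 0 ≤ α) (h1 : α ≤ 1) (a b : ℕ) (ha : 1 ≤ a)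
    (haL : (a:ℝ) ≤ L ^ 1000) (hb : b ≤ 2 * a) :
    ‖∑ n ∈ Finset.Ico a b, Complex.exp (ph (L ^ 1000) α n * I)‖ ^ 2
      ≤ 10 ^ 9 * a * L ^ 496 := by
  have hL0 : 0 < L := by linarith
  have ha1 : (1:ℝ) ≤ a := by exact_mod_cast ha
  have hp : ∀ m n : ℕ, m ≤ n → L ^ m ≤ L ^ n := fun m n h => pow_le_pow_right₀ hL h
  have hlog : ∀ H : ℕ, 0 < H → (H:ℝ) ≤ a → 1 + Real.log H ≤ 1001 * L := by
    intro H hH hHa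
    have h2 : Real.log H ≤ Real.log (L ^ 1000) :=
      Real.log_le_log (by exact_mod_cast hH) (hHa.trans haL)
    rw [Real.log_pow] at h2
    have := Real.log_le_sub_one_of_pos hL0
    push_cast at h2
    linarith
  rcases le_or_gt (a:ℝ) (L ^ 496) with hc1 | hc1
  · have htriv : ‖∑ n ∈ Finset.Ico a b, Complex.exp (ph (L ^ 1000) α n * I)‖ ≤ a := by
      refine (norm_sum_le _ _).trans ?_
      simp_rw [Complex.norm_exp_ofReal_mul_I]
      simp only [Finset.sum_const, Nat.card_Ico, nsmul_eq_mul, mul_one]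
      exact_mod_cast (by omega : b - a ≤ a)
    calc _ ≤ (a:ℝ) ^ 2 := by gcongr
      _ ≤ a * L ^ 496 := by rw [sq]; gcongr
      _ ≤ _ := by
        have : 0 ≤ a * L ^ 496 := by positivity
        linarith
  rcases le_or_gt (a:ℝ) (L ^ 504) with hc2 | hc2
  · set H := ⌊L ^ 100⌋₊ with hHdef
    have hHle : (H:ℝ) ≤ L ^ 100 := Nat.floor_le (by positivity)
    have h100 : 1 ≤ L ^ 100 := one_le_pow₀ hL
    have hH : 0 < H := Nat.floor_pos.mpr h100
    have hHge : L ^ 100 ≤ 2 * H := by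
      have := Nat.lt_floor_add_one (L ^ 100)
      have h2 : (1:ℝ) ≤ H := by exact_mod_cast hH
      linarith
    have hHa : (H:ℝ) ≤ a := by linarith [hp 100 496 (by norm_num)]
    have hHa' : H ≤ a := by exact_mod_cast hHa
    have hHp : (0:ℝ) < H := by exact_mod_cast hH
    refine (double_diff (L^1000) α (by positivity) h0 h1 a b H hH hHa' ?_ hb).trans ?_
    · have : (L^496)^3 ≤ (a:ℝ) ^ 3 := by gcongr
      have h3 : L^1000 * H * H ≤ L^1000 * L^100 * L^100 := by gcongr
      have h4 : L^1000 * L^100 * L^100 ≤ (L^496)^3 := by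
        rw [← pow_add, ← pow_add, ← pow_mul]; exact hp _ _ (by norm_num)
      have : (0:ℝ) ≤ (a:ℝ)^3 := by positivity
      linarith
    have hin : 4 * a / H * (a + 384 * a ^ 3 / L^1000 * (1 + Real.log H)) ≤ (2000 * L ^ 460) ^ 2 := by
      have e1 : 4 * a / H ≤ 8 * L ^ 404 := by
        rw [div_le_iff₀ hHp]
        have : L ^ 504 = L ^ 404 * L ^ 100 := by rw [← pow_add]
        nlinarith [pow_pos hL0 404]
      have e2 : 384 * (a:ℝ) ^ 3 / L^1000 * (1 + Real.log H) ≤ 384384 * L ^ 513 := by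
        have : (a:ℝ)^3 ≤ (L^504)^3 := by gcongr
        calc 384 * (a:ℝ) ^ 3 / L^1000 * (1 + Real.log H)
            ≤ 384 * (L^504) ^ 3 / L^1000 * (1001 * L) := by
              have := hlog H hH hHa
              gcongr
          _ = 384384 * L ^ 513 := by
              field_simp
              norm_num
      have e3 : (a:ℝ) ≤ L ^ 513 := hc2.trans (hp _ _ (by norm_num))
      calc _ ≤ 8 * L ^ 404 * (L ^ 513 + 384384 * L^513) := by
            have : 0 ≤ 1 + Real.log H := by
              have : 0 ≤ Real.log H := Real.log_natCast_nonneg H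
              linarith
            gcongr
        _ = 3075080 * L ^ 917 := by ring
        _ ≤ 3075080 * L ^ 920 := by gcongr; norm_num
        _ ≤ _ := by
          have : 0 < L ^ 920 := by positivity
          rw [mul_pow, ← pow_mul]; norm_num; linarith
    have hsq := Real.sqrt_le_sqrt hin
    rw [Real.sqrt_sq (by positivity)] at hsq
    calc _ ≤ 4 * a / H * (a + H * (2000 * L ^ 460)) := by gcongr
      _ = 4 * a * (a / H + 2000 * L ^ 460) := by field_simp
      _ ≤ 4 * a * (2 * L ^ 404 + 2000 * L ^ 460) := by
        have : a / H ≤ 2 * L ^ 404 := by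
          rw [div_le_iff₀ hHp]
          have : L ^ 504 = L ^ 404 * L ^ 100 := by rw [← pow_add]
          nlinarith [pow_pos hL0 404]
        gcongr
      _ ≤ 4 * a * (2 * L ^ 496 + 2000 * L ^ 496) := by
        have h5 := hp 404 496 (by norm_num)
        have h6 := hp 460 496 (by norm_num)
        gcongr
      _ ≤ _ := by
        have : 0 ≤ a * L ^ 496 := by positivity
        nlinarith
  · have hx1 : 1 ≤ (a:ℝ)^2 / L^1000 := by
      rw [le_div_iff₀ (by positivity), one_mul]
      have : (L^504)^2 ≤ (a:ℝ)^2 := by gcongr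
      rw [← pow_mul] at this
      exact (hp _ _ (by norm_num)).trans this
    set H := ⌊(a:ℝ)^2 / L^1000⌋₊ with hHdef
    have hHle : (H:ℝ) ≤ (a:ℝ)^2 / L^1000 := Nat.floor_le (by positivity)
    have hH : 0 < H := Nat.floor_pos.mpr hx1
    have hHge : (a:ℝ)^2 / L^1000 ≤ 2 * H := by
      have := Nat.lt_floor_add_one ((a:ℝ)^2 / L^1000)
      have h2 : (1:ℝ) ≤ H := by exact_mod_cast hH
      linarith
    have hHa : (H:ℝ) ≤ a := by
      refine hHle.trans ?_
      rw [div_le_iff₀ (by positivity), sq]; gcongr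
    have hHa' : H ≤ a := by exact_mod_cast hHa
    have hHp : (0:ℝ) < H := by exact_mod_cast hH
    refine (single_diff (L^1000) α (by positivity) h0 h1 a b H hH hHa' ?_ hb).trans ?_
    · rw [le_div_iff₀ (by positivity)] at hHle
      nlinarith [sq_nonneg (a:ℝ)]
    have e1 : 4 * a / H ≤ 8 * L^1000 / a := by
      rw [div_le_div_iff₀ hHp (by positivity)]
      rw [div_le_iff₀ (by positivity)] at hHge
      nlinarith
    calc _ ≤ 8 * L^1000 / a * (a + 192 * a ^ 2 / L^1000 * (1001 * L)) := by
          have := hlog H hH hHa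
          have : 0 ≤ 1 + Real.log H := by
            have : 0 ≤ Real.log H := Real.log_natCast_nonneg H
            linarith
          gcongr
      _ = 8 * L ^ 1000 + 1537536 * a * L := by
        field_simp; ring
      _ ≤ 8 * (a * L ^ 496) + 1537536 * a * L ^ 496 := by
        have h7 : L ≤ L ^ 496 := le_self_pow₀ hL (by norm_num)
        have h8 : L ^ 1000 ≤ a * L ^ 496 := by
          have : L ^ 1000 = L ^ 504 * L ^ 496 := by rw [← pow_add]
          rw [this]; gcongr
        gcongr
      _ ≤ _ := by
        have : 0 ≤ a * L ^ 496 := by positivity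
        nlinarith

end MSW

namespace MSW

theorem norm_sum_mul_le_of_antitone (w : ℕ → ℝ) (z : ℕ → ℂ) (a b : ℕ) (M : ℝ)
    (hw0 : ∀ n, a ≤ n → 0 ≤ w n) (hw : ∀ n, a ≤ n → w (n+1) ≤ w n)
    (hM : ∀ b', b' ≤ b → ‖∑ n ∈ Finset.Ico a b', z n‖ ≤ M) :
    ‖∑ n ∈ Finset.Ico a b, (w n : ℂ) * z n‖ ≤ w a * M := by
  have hM0 : 0 ≤ M := (norm_nonneg _).trans (hM b le_rfl)
  rcases le_or_gt b a with hba | hab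
  · rw [Finset.Ico_eq_empty_of_le hba]; simp; exact mul_nonneg (hw0 a le_rfl) hM0
  have key : ∀ c, a ≤ c → ∑ n ∈ Finset.Ico a (c+1), (w n : ℂ) * z n
      = (w c : ℂ) * ∑ n ∈ Finset.Ico a (c+1), z n
        + ∑ n ∈ Finset.Ico a c, ((w n - w (n+1) : ℝ) : ℂ) * ∑ k ∈ Finset.Ico a (n+1), z k := by
    intro c hc
    induction c, hc using Nat.le_induction with
    | base => simp
    | succ c hc ih =>
      rw [Finset.sum_Ico_succ_top (by omega : a ≤ c + 1) (fun n => (w n : ℂ) * z n), ih,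
        Finset.sum_Ico_succ_top hc (fun n => ((w n - w (n+1) : ℝ) : ℂ) * ∑ k ∈ Finset.Ico a (n+1), z k),
        Finset.sum_Ico_succ_top (by omega : a ≤ c + 1) (fun n => z n)]
      generalize ∑ n ∈ Finset.Ico a (c+1), z n = X
      generalize ∑ n ∈ Finset.Ico a c, ((w n - w (n+1) : ℝ) : ℂ) * ∑ k ∈ Finset.Ico a (n+1), z k = Y
      push_cast; ring
  obtain ⟨c, rfl⟩ : ∃ c, b = c + 1 := ⟨b - 1, by omega⟩
  have hac : a ≤ c := by omega
  rw [key c hac]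
  have htel : ∑ n ∈ Finset.Ico a c, (w n - w (n+1)) = w a - w c := by
    have := Finset.sum_Ico_sub (fun n => w n) hac
    rw [← neg_inj, ← Finset.sum_neg_distrib]
    simpa using this
  calc _ ≤ w c * M + ∑ n ∈ Finset.Ico a c, (w n - w (n+1)) * M := by
        refine (norm_add_le _ _).trans (add_le_add ?_ ((norm_sum_le _ _).trans
          (Finset.sum_le_sum fun n hn => ?_)))
        · rw [norm_mul, Complex.norm_real, Real.norm_eq_abs, abs_of_nonneg (hw0 c hac)]
          exact mul_le_mul_of_nonneg_left (hM _ le_rfl) (hw0 c hac)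
        · simp only [Finset.mem_Ico] at hn
          have : 0 ≤ w n - w (n+1) := sub_nonneg.mpr (hw n hn.1)
          rw [norm_mul, Complex.norm_real, Real.norm_eq_abs, abs_of_nonneg this]
          exact mul_le_mul_of_nonneg_left (hM _ (by omega)) this
    _ = w a * M := by rw [← Finset.sum_mul, htel]; ring

/-- Weighted exponential sum over one dyadic block. -/
theorem dyadic_weighted (L α : ℝ) (hL : 1 ≤ L) (h0 : 0 ≤ α) (h1 : α ≤ 1) (a b : ℕ) (ha : 1 ≤ a)
    (haL : (a:ℝ) ≤ (L ^ 1000) ^ 2) (hb : b ≤ 2 * a) :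
    ‖∑ n ∈ Finset.Ico a b, (((n + α : ℝ) ^ (-(1/2) : ℝ) : ℝ) : ℂ) *
      Complex.exp (ph (L ^ 1000) α n * I)‖ ≤ 32000 * L ^ 248 := by
  have hL0 : 0 < L := by linarith
  have ha1 : (1:ℝ) ≤ a := by exact_mod_cast ha
  have hsa : 0 < Real.sqrt a := Real.sqrt_pos.mpr (by linarith)
  have hsq : Real.sqrt a * Real.sqrt a = a := Real.mul_self_sqrt (by linarith)
  have hM : ∀ b', b' ≤ b → ‖∑ n ∈ Finset.Ico a b', Complex.exp (ph (L ^ 1000) α n * I)‖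
      ≤ Real.sqrt a * (32000 * L ^ 248) := by
    intro b' hb'
    rcases le_or_gt (a:ℝ) (L^1000) with hc | hc
    · have h := dyadic_sq L α hL h0 h1 a b' ha hc (by omega)
      refine le_of_sq_le_sq (h.trans ?_) (by positivity)
      have : (Real.sqrt a * (32000 * L ^ 248))^2 = 1024000000 * a * L ^ 496 := by
        rw [mul_pow, mul_pow, Real.sq_sqrt (by linarith), ← pow_mul]; norm_num; ring
      rw [this]
      have : 0 ≤ a * L ^ 496 := by positivity
      nlinarith
    · have h := kl_zero (L^1000) α (by positivity) h0 h1 a b' ha hc.le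
      refine h.trans ?_
      have hb2 : (b':ℝ) ≤ 2 * a := by exact_mod_cast (by omega : b' ≤ 2 * a)
      have h2 : Real.sqrt a ≤ L ^ 1000 := Real.sqrt_le_iff.mpr ⟨by positivity, haL⟩
      have h3 : 1 ≤ L ^ 248 := one_le_pow₀ hL
      rw [div_le_iff₀ (by positivity)]
      have h4 : (a:ℝ) ≤ Real.sqrt a * L ^ 1000 := by nlinarith
      have h5 : 0 ≤ Real.sqrt a * L ^ 1000 := by positivity
      nlinarith
  have hpos : ∀ n : ℕ, a ≤ n → 0 < (n:ℝ) + α := fun n hn => by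
    have : (a:ℝ) ≤ n := by exact_mod_cast hn
    linarith
  refine (norm_sum_mul_le_of_antitone (fun n => (n + α : ℝ) ^ (-(1/2) : ℝ)) _ a b _ ?_ ?_ hM).trans ?_
  · intro n hn; have := hpos n hn; positivity
  · intro n hn
    refine Real.rpow_le_rpow_of_nonpos (hpos n hn) (by push_cast; linarith) (by norm_num)
  · rw [← mul_assoc]
    refine mul_le_of_le_one_left (by positivity) ?_
    have h6 : ((a:ℝ) + α) ^ (-(1/2) : ℝ) ≤ (a:ℝ) ^ (-(1/2) : ℝ) :=
      Real.rpow_le_rpow_of_nonpos (by linarith) (by linarith) (by norm_num)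
    calc _ ≤ (a:ℝ) ^ (-(1/2) : ℝ) * Real.sqrt a := by gcongr
      _ = 1 := by
        rw [Real.sqrt_eq_rpow, ← Real.rpow_add (by linarith)]; norm_num

theorem weighted_sum_induct (L α : ℝ) (hL : 1 ≤ L) (h0 : 0 ≤ α) (h1 : α ≤ 1) (J : ℕ) :
    ∀ N : ℕ, N ≤ 2 ^ J → (N:ℝ) ≤ (L ^ 1000) ^ 2 →
    ‖∑ n ∈ Finset.Ico 1 N, (((n + α : ℝ) ^ (-(1/2) : ℝ) : ℝ) : ℂ) *
      Complex.exp (ph (L ^ 1000) α n * I)‖ ≤ J * (32000 * L ^ 248) := by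
  induction J with
  | zero => intro N hN _; rw [Finset.Ico_eq_empty_of_le (by simpa using hN)]; simp
  | succ J ih =>
    intro N hN hNL
    rcases le_or_gt N (2^J) with h | h
    · refine (ih N h hNL).trans ?_
      have : 0 < L := by linarith
      gcongr; omega
    · rw [← Finset.sum_Ico_consecutive _ (Nat.one_le_two_pow) h.le]
      have h2 : ((2^J : ℕ):ℝ) ≤ N := by exact_mod_cast h.le
      refine (norm_add_le _ _).trans ((add_le_add (ih _ le_rfl (h2.trans hNL))
        (dyadic_weighted L α hL h0 h1 (2^J) N Nat.one_le_two_pow (h2.trans hNL)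
          (by rw [pow_succ] at hN; omega))).trans (le_of_eq ?_))
      push_cast; ring

/-- Subconvex bound for partial sums of the Hurwitz zeta function on the critical line. -/
theorem critical_partial_sum (t α : ℝ) (ht : 1 ≤ t) (h0 : 0 ≤ α) (h1 : α ≤ 1) (N : ℕ)
    (hN : (N:ℝ) ≤ t ^ 2) :
    ‖∑ n ∈ Finset.Ico 1 N, ((n + α : ℝ) : ℂ) ^ (-((1/2 : ℝ) + t * I : ℂ))‖
      ≤ 10 ^ 9 * t ^ (249/1000 : ℝ) := by
  set L : ℝ := t ^ (1/1000 : ℝ) with hLdef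
  have ht0 : 0 < t := by linarith
  have hL : 1 ≤ L := Real.one_le_rpow ht (by norm_num)
  have hLt : L ^ 1000 = t := by
    rw [hLdef, ← Real.rpow_natCast, ← Real.rpow_mul ht0.le]; norm_num
  have hL249 : L ^ 249 = t ^ (249/1000 : ℝ) := by
    rw [hLdef, ← Real.rpow_natCast, ← Real.rpow_mul ht0.le]; norm_num
  have hterm : ∀ n ∈ Finset.Ico 1 N, ((n + α : ℝ) : ℂ) ^ (-((1/2 : ℝ) + t * I : ℂ))
      = starRingEnd ℂ ((((n + α : ℝ) ^ (-(1/2) : ℝ) : ℝ) : ℂ) * Complex.exp (ph (L ^ 1000) α n * I)) := by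
    intro n hn
    have hn1 : (1:ℝ) ≤ n := by exact_mod_cast (Finset.mem_Ico.mp hn).1
    have hp : 0 < (n:ℝ) + α := by linarith
    rw [hLt, map_mul, Complex.conj_ofReal, ← Complex.exp_conj, neg_add,
      Complex.cpow_add _ _ (by exact_mod_cast hp.ne'), Complex.ofReal_cpow hp.le]
    congr 1
    · push_cast; rfl
    · rw [Complex.cpow_def_of_ne_zero (by exact_mod_cast hp.ne'), ← Complex.ofReal_log hp.le]
      congr 1
      simp [ph]; ring
  rw [Finset.sum_congr rfl hterm, ← map_sum, Complex.norm_conj]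
  rcases Nat.eq_zero_or_pos N with rfl | hNpos
  · simp; positivity
  have hlt := Nat.lt_pow_succ_log_self (by norm_num : 1 < 2) N
  refine (weighted_sum_induct L α hL h0 h1 (Nat.log 2 N + 1) N hlt.le (by rwa [hLt])).trans ?_
  rw [← hL249]
  have hJ : ((Nat.log 2 N + 1 : ℕ) : ℝ) ≤ 4001 * L := by
    have h2 : ((2:ℝ)) ^ (Nat.log 2 N) ≤ N := by exact_mod_cast Nat.pow_log_le_self 2 hNpos.ne'
    have h3 : Real.log ((2:ℝ) ^ (Nat.log 2 N)) ≤ Real.log ((L ^ 1000) ^ 2) := by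
      refine Real.log_le_log (by positivity) (h2.trans (by rwa [hLt]))
    rw [← pow_mul, Real.log_pow, Real.log_pow] at h3
    have h4 := Real.log_two_gt_d9
    have h5 := Real.log_le_sub_one_of_pos (by linarith : 0 < L)
    push_cast at h3 ⊢
    have h6 : (0:ℝ) ≤ Nat.log 2 N := by positivity
    nlinarith
  calc _ ≤ 4001 * L * (32000 * L ^ 248) := by gcongr
    _ = 128032000 * L ^ 249 := by ring
    _ ≤ _ := by
      have : 0 ≤ L ^ 249 := by positivity
      nlinarith

end MSW

namespace MSW

/-- Error between a summand `(y+1)^{-s}` and the integral of `x^{-s}` over `[y, y+1]`. -/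
noncomputable def emTerm (y : ℝ) (s : ℂ) : ℂ :=
  ((y + 1 : ℝ) : ℂ) ^ (-s) - (((y + 1 : ℝ) : ℂ) ^ (1 - s) - (y : ℂ) ^ (1 - s)) / (1 - s)

lemma hasDerivAt_ofReal_cpow' {u : ℝ} (hu : 0 < u) (r : ℂ) :
    HasDerivAt (fun x : ℝ => (x : ℂ) ^ r) (r * (u : ℂ) ^ (r - 1)) u :=
  (hasStrictDerivAt_cpow_const (Or.inl (by simpa using hu))).hasDerivAt.comp_ofReal

lemma norm_rpow_neg_sub_le {y x z : ℝ} (hy : 0 < y) (hx : y ≤ x) (hz : y ≤ z) (hxz : |z - x| ≤ 1)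
    (s : ℂ) (hs : 0 ≤ s.re) :
    ‖(z : ℂ) ^ (-s) - (x : ℂ) ^ (-s)‖ ≤ ‖s‖ * y ^ (-s.re - 1) := by
  have key := (convex_Ici y).norm_image_sub_le_of_norm_hasDerivWithin_le
    (f := fun u : ℝ => (u : ℂ) ^ (-s)) (f' := fun u : ℝ => (-s) * (u : ℂ) ^ (-s - 1))
    (C := ‖s‖ * y ^ (-s.re - 1)) (x := x) (y := z) ?_ ?_ hx hz
  · refine key.trans ?_
    have h0 : 0 ≤ ‖s‖ * y ^ (-s.re - 1) := by positivity
    have : ‖z - x‖ ≤ 1 := by simpa [Real.norm_eq_abs] using hxz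
    nlinarith
  · intro u hu
    have hu0 : 0 < u := hy.trans_le hu
    exact (hasDerivAt_ofReal_cpow' hu0 _).hasDerivWithinAt
  · intro u hu
    have hu0 : 0 < u := hy.trans_le hu
    rw [norm_mul, norm_neg, norm_cpow_eq_rpow_re_of_pos hu0]
    have : (-s - 1).re = -s.re - 1 := by simp
    rw [this]
    exact mul_le_mul_of_nonneg_left
      (Real.rpow_le_rpow_of_nonpos hy hu (by linarith)) (norm_nonneg _)

lemma norm_emTerm_le {y : ℝ} (hy : 0 < y) (s : ℂ) (hs : 0 ≤ s.re) (hs1 : s ≠ 1) :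
    ‖emTerm y s‖ ≤ ‖s‖ * y ^ (-s.re - 1) := by
  have h1s : (1 - s) ≠ 0 := sub_ne_zero.mpr (Ne.symm hs1)
  have key := (convex_Icc y (y+1)).norm_image_sub_le_of_norm_hasDerivWithin_le
    (f := fun u : ℝ => ((y + 1 : ℝ) : ℂ) ^ (-s) * (u : ℂ) - (u : ℂ) ^ (1 - s) / (1 - s))
    (f' := fun u : ℝ => ((y + 1 : ℝ) : ℂ) ^ (-s) - (u : ℂ) ^ (-s))
    (C := ‖s‖ * y ^ (-s.re - 1)) (x := y) (y := y + 1) ?_ ?_ (by simp) (by simp)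
  · have e : emTerm y s = (((y + 1 : ℝ) : ℂ) ^ (-s) * ((y+1:ℝ) : ℂ) - ((y+1:ℝ) : ℂ) ^ (1 - s) / (1 - s))
        - (((y + 1 : ℝ) : ℂ) ^ (-s) * (y : ℂ) - (y : ℂ) ^ (1 - s) / (1 - s)) := by
      rw [emTerm]; push_cast; ring
    rw [e]
    refine key.trans ?_
    simp
  · intro u hu
    have hu0 : 0 < u := hy.trans_le hu.1
    have h1 : HasDerivAt (fun u : ℝ => ((y + 1 : ℝ) : ℂ) ^ (-s) * (u : ℂ)) (((y + 1 : ℝ) : ℂ) ^ (-s)) u := by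
      simpa using (Complex.ofRealCLM.hasDerivAt (x := u)).const_mul (((y + 1 : ℝ) : ℂ) ^ (-s))
    have h2 := (hasDerivAt_ofReal_cpow' hu0 (1 - s)).div_const (1 - s)
    rw [mul_div_cancel_left₀ _ h1s, show (1 - s - 1) = -s by ring] at h2
    exact (h1.sub h2).hasDerivWithinAt
  · intro u hu
    exact norm_rpow_neg_sub_le hy hu.1 (by linarith) (by rw [abs_of_nonneg] <;> linarith [hu.1, hu.2]) s hs

lemma differentiableAt_emTerm {y : ℝ} (hy : 0 < y) {s : ℂ} (hs1 : s ≠ 1) :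
    DifferentiableAt ℂ (emTerm y) s := by
  have h1s : (1 - s) ≠ 0 := sub_ne_zero.mpr (Ne.symm hs1)
  have a1 : ((y + 1 : ℝ) : ℂ) ≠ 0 := by exact_mod_cast (by linarith : y + 1 ≠ 0)
  have a2 : (y : ℂ) ≠ 0 := by exact_mod_cast hy.ne'
  unfold emTerm
  refine DifferentiableAt.sub ?_ (DifferentiableAt.div (DifferentiableAt.sub ?_ ?_) (by fun_prop) h1s)
  · exact DifferentiableAt.const_cpow (by fun_prop) (Or.inl a1)
  · exact DifferentiableAt.const_cpow (by fun_prop) (Or.inl a1)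
  · exact DifferentiableAt.const_cpow (by fun_prop) (Or.inl a2)

lemma summable_add_rpow {y : ℝ} (hy : 1 ≤ y) {p : ℝ} (hp : p < -1) :
    Summable (fun n : ℕ => (y + n) ^ p) := by
  have h : Summable (fun n : ℕ => ((n:ℝ) + 1) ^ p) := by
    have := (summable_nat_add_iff (f := fun n : ℕ => (n:ℝ) ^ p) 1).mpr (Real.summable_nat_rpow.mpr hp)
    simpa using this
  refine h.of_nonneg_of_le (fun n => by positivity) (fun n => ?_)
  exact Real.rpow_le_rpow_of_nonpos (by positivity) (by linarith) (by linarith)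

/-- Euler–Maclaurin main terms of the Hurwitz zeta function. -/
noncomputable def emSum (a : ℝ) (N : ℕ) (s : ℂ) : ℂ :=
  ∑ n ∈ Finset.range (N + 1), 1 / (n + a : ℂ) ^ s + ((N + a : ℝ) : ℂ) ^ (1 - s) / (s - 1)
    + ∑' n : ℕ, emTerm (N + a + n) s

lemma hurwitz_eq_of_one_lt {a : ℝ} (ha : a ∈ Set.Icc (0:ℝ) 1) {N : ℕ} (hN : 1 ≤ N) {s : ℂ}
    (hs : 1 < s.re) : HurwitzZeta.hurwitzZeta a s = emSum a N s := by
  have hN' : (1:ℝ) ≤ N := by exact_mod_cast hN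
  have hy : (1:ℝ) ≤ N + a := by linarith [ha.1]
  have hs1 : s ≠ 1 := by rintro rfl; simp at hs
  have h1s : (1 - s) ≠ 0 := sub_ne_zero.mpr (Ne.symm hs1)
  have hH := HurwitzZeta.hasSum_hurwitzZeta_of_one_lt_re ha hs
  have hsm : Summable (fun n : ℕ => emTerm (N + a + n) s) := by
    refine Summable.of_norm_bounded (g := fun n : ℕ => ‖s‖ * (N + a + n) ^ (-s.re - 1))
      ((summable_add_rpow hy (by linarith)).mul_left _) (fun n => ?_)
    exact norm_emTerm_le (by positivity) s (by linarith) hs1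
  have t1 := hsm.hasSum.tendsto_sum_nat
  have t2 := ((hasSum_nat_add_iff' (N+1)).mpr hH).tendsto_sum_nat
  have t3 : Tendsto (fun n : ℕ => ((N + a + n : ℝ) : ℂ) ^ (1 - s) / (1 - s)) atTop (nhds 0) := by
    rw [← zero_div (1 - s)]
    refine Tendsto.div_const ?_ _
    rw [tendsto_zero_iff_norm_tendsto_zero]
    have : ∀ n : ℕ, ‖((N + a + n : ℝ) : ℂ) ^ (1 - s)‖ = (N + a + n) ^ (-(s.re - 1)) := by
      intro n
      rw [norm_cpow_eq_rpow_re_of_pos (by positivity)]; congr 1; simp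
    simp_rw [this]
    exact (tendsto_rpow_neg_atTop (by linarith)).comp
      (tendsto_atTop_add_const_left _ _ tendsto_natCast_atTop_atTop)
  have e : ∀ n : ℕ, ∑ i ∈ Finset.range n, emTerm (N + a + i) s =
      ∑ i ∈ Finset.range n, 1 / (((i + (N + 1) : ℕ) : ℂ) + a) ^ s
        - (((N + a + n : ℝ) : ℂ) ^ (1 - s) / (1 - s) - ((N + a : ℝ) : ℂ) ^ (1 - s) / (1 - s)) := by
    intro n
    induction n with
    | zero => simp
    | succ n ih =>
      rw [Finset.sum_range_succ, ih, Finset.sum_range_succ, emTerm, cpow_neg]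
      push_cast
      have : (N + a + n + 1 : ℂ) = (n + (N + 1) + a) := by ring
      rw [this, show (N + a + (n + 1) : ℂ) = (n + (N + 1) + a) by ring]
      ring
  have t4 := t2.sub (t3.sub_const (((N + a : ℝ) : ℂ) ^ (1 - s) / (1 - s)))
  have t5 := tendsto_nhds_unique t1 (t4.congr (fun n => (e n).symm))
  rw [emSum, t5, show s - 1 = -(1 - s) by ring, div_neg]
  ring

lemma hurwitz_eq {a : ℝ} (ha : a ∈ Set.Icc (0:ℝ) 1) {N : ℕ} (hN : 1 ≤ N) {s : ℂ}
    (hs : 1 / 4 < s.re) (hs0 : s.im ≠ 0) : HurwitzZeta.hurwitzZeta a s = emSum a N s := by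
  by_cases hs2 : 1 < s.re
  · exact hurwitz_eq_of_one_lt ha hN hs2
  have hN' : (1:ℝ) ≤ N := by exact_mod_cast hN
  have hy : (1:ℝ) ≤ N + a := by linarith [ha.1]
  set R : ℝ := 10 + ‖s‖ + ‖(2 + s.im * I : ℂ)‖ with hR
  set U : Set ℂ := ({z | (1/4 : ℝ) < z.re} ∩ {z | 0 < s.im * z.im}) ∩ Metric.ball 0 R with hU
  have hUo : IsOpen U := by
    refine ((isOpen_lt continuous_const continuous_re).inter
      (isOpen_lt continuous_const (continuous_const.mul continuous_im))).inter Metric.isOpen_ball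
  have hUc : Convex ℝ U := by
    refine ((convex_halfSpace_re_gt _).inter ?_).inter (convex_ball _ _)
    have : {z : ℂ | 0 < s.im * z.im} = {z : ℂ | 0 < (s.im • Complex.imLm) z} := by
      ext z; simp
    rw [this]
    exact convex_halfSpace_gt (LinearMap.isLinear _) 0
  have hne : ∀ z ∈ U, z ≠ 1 := by
    rintro z hz rfl
    have := hz.1.2
    simp at this
  have hd1 : DifferentiableOn ℂ (HurwitzZeta.hurwitzZeta a) U := fun z hz =>
    (HurwitzZeta.differentiableAt_hurwitzZeta _ (hne z hz)).differentiableWithinAt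
  have hd2 : DifferentiableOn ℂ (emSum a N) U := by
    unfold emSum
    refine DifferentiableOn.add (DifferentiableOn.add ?_ ?_) ?_
    · refine DifferentiableOn.fun_sum fun n _ => ?_
      intro z hz
      apply DifferentiableAt.differentiableWithinAt
      have hz0 : z ≠ 0 := by
        rintro rfl
        have := hz.1.2
        simp at this
      by_cases h0 : (n + a : ℂ) = 0
      · rw [h0]
        have : (fun w : ℂ => 1 / (0:ℂ) ^ w) =ᶠ[nhds z] fun _ => 0 := by
          filter_upwards [isOpen_ne.mem_nhds hz0] with w hw
          rw [zero_cpow hw]; simp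
        exact (differentiableAt_const _).congr_of_eventuallyEq this
      · refine DifferentiableAt.div (by fun_prop) (DifferentiableAt.const_cpow (by fun_prop) (Or.inl h0)) ?_
        simp [cpow_eq_zero_iff, h0]
    · intro z hz
      apply DifferentiableAt.differentiableWithinAt
      refine DifferentiableAt.div (DifferentiableAt.const_cpow (by fun_prop) (Or.inl ?_)) (by fun_prop)
        (sub_ne_zero.mpr (hne z hz))
      exact_mod_cast (by linarith : N + a ≠ 0)
    · refine differentiableOn_tsum_of_summable_norm (u := fun n : ℕ => R * (N + a + n) ^ (-(1/4:ℝ) - 1))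
        ((summable_add_rpow hy (by norm_num)).mul_left _) ?_ hUo ?_
      · intro n z hz
        exact (differentiableAt_emTerm (by positivity) (hne z hz)).differentiableWithinAt
      · intro n z hz
        have h1 : (1/4:ℝ) < z.re := hz.1.1
        refine (norm_emTerm_le (by positivity) z (by linarith) (hne z hz)).trans ?_
        have h2 : ‖z‖ ≤ R := by simpa using (Metric.mem_ball.mp hz.2).le
        refine mul_le_mul h2 (Real.rpow_le_rpow_of_exponent_le ?_ (by linarith)) (by positivity) (by positivity)
        have : (0:ℝ) ≤ n := by positivity
        linarith
  have a1 := hd1.analyticOnNhd hUo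
  have a2 := hd2.analyticOnNhd hUo
  have hz0 : (2 + s.im * I : ℂ) ∈ U := by
    refine ⟨⟨?_, ?_⟩, ?_⟩
    · simp; norm_num
    · simp [hs0]
    · simp only [Metric.mem_ball, dist_zero_right]
      have := norm_nonneg s
      linarith
  refine a1.eqOn_of_preconnected_of_eventuallyEq a2 hUc.isPreconnected hz0 ?_ ⟨⟨hs, ?_⟩, ?_⟩
  · have : {z : ℂ | 1 < z.re} ∈ nhds (2 + s.im * I : ℂ) :=
      (isOpen_lt continuous_const continuous_re).mem_nhds (by simp)
    filter_upwards [this] with z hz using hurwitz_eq_of_one_lt ha hN hz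
  · simp [hs0]
  · simp only [Metric.mem_ball, dist_zero_right]
    have := norm_nonneg (2 + s.im * I : ℂ)
    linarith

end MSW

namespace MSW

lemma rpow_telescope_le {y σ : ℝ} (hy : 1 ≤ y) (h1 : 1 / 2 ≤ σ) (h2 : σ ≤ 2) :
    y ^ (-σ - 1) ≤ 16 * (y ^ (-σ) - (y + 1) ^ (-σ)) := by
  have hy0 : 0 < y := by linarith
  have key := (convex_Icc y (y+1)).image_sub_le_mul_sub_of_deriv_le
    (f := fun u : ℝ => u ^ (-σ)) (C := - (1/16) * y ^ (-σ - 1)) ?_ ?_ ?_ y (by simp) (y+1) (by simp) (by simp)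
  · linarith
  · exact fun u hu => (Real.continuousAt_rpow_const _ _ (Or.inl (by linarith [hu.1]))).continuousWithinAt
  · rw [interior_Icc]
    exact fun u hu => (Real.differentiableAt_rpow_const_of_ne _ (by linarith [hu.1])).differentiableWithinAt
  · rw [interior_Icc]
    intro u hu
    have hu0 : 0 < u := hy0.trans hu.1
    rw [(Real.hasDerivAt_rpow_const (Or.inl hu0.ne')).deriv]
    have e1 : (2 * y) ^ (-σ - 1) ≤ u ^ (-σ - 1) :=
      Real.rpow_le_rpow_of_nonpos hu0 (by linarith [hu.2]) (by linarith)
    rw [Real.mul_rpow (by norm_num) hy0.le] at e1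
    have e2 : (1/8 : ℝ) ≤ (2:ℝ) ^ (-σ - 1) := by
      calc (1/8 : ℝ) = (2:ℝ) ^ (-3 : ℝ) := by
            rw [Real.rpow_neg (by norm_num)]; norm_num
        _ ≤ _ := Real.rpow_le_rpow_of_exponent_le (by norm_num) (by linarith)
    have e3 : 0 < y ^ (-σ - 1) := by positivity
    nlinarith [mul_le_mul_of_nonneg_right e2 e3.le]

lemma norm_tsum_emTerm_le {y : ℝ} (hy : 1 ≤ y) (s : ℂ) (h1 : 1 / 2 ≤ s.re) (h2 : s.re ≤ 2)
    (hs1 : s ≠ 1) : ‖∑' n : ℕ, emTerm (y + n) s‖ ≤ 16 * ‖s‖ * y ^ (-s.re) := by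
  have hsm := (summable_add_rpow hy (p := -s.re - 1) (by linarith)).mul_left ‖s‖
  have hb : ∀ n : ℕ, ‖emTerm (y + n) s‖ ≤ ‖s‖ * (y + n) ^ (-s.re - 1) := fun n =>
    norm_emTerm_le (by positivity) s (by linarith) hs1
  refine (tsum_of_norm_bounded hsm.hasSum hb).trans ?_
  rw [tsum_mul_left, mul_comm 16, mul_assoc]
  refine mul_le_mul_of_nonneg_left ?_ (norm_nonneg _)
  refine Real.tsum_le_of_sum_range_le (fun n => by positivity) (fun n => ?_)
  calc ∑ i ∈ Finset.range n, (y + i) ^ (-s.re - 1)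
      ≤ ∑ i ∈ Finset.range n, 16 * ((y + i) ^ (-s.re) - (y + (i + 1 : ℕ)) ^ (-s.re)) := by
        refine Finset.sum_le_sum fun i _ => ?_
        have := rpow_telescope_le (y := y + i) (by linarith [(Nat.cast_nonneg i : (0:ℝ) ≤ i)]) h1 h2
        rw [add_assoc] at this
        simpa using this
    _ = 16 * (y ^ (-s.re) - (y + n) ^ (-s.re)) := by
        rw [← Finset.mul_sum, Finset.sum_range_sub' (fun i : ℕ => (y + i) ^ (-s.re))]
        simp
    _ ≤ _ := by
        have : 0 ≤ (y + n) ^ (-s.re) := by positivity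
        linarith

lemma norm_hurwitz_le {a : ℝ} (ha : a ∈ Set.Icc (0:ℝ) 1) {N : ℕ} (hN : 1 ≤ N) {s : ℂ}
    (h1 : 1 / 2 ≤ s.re) (h2 : s.re ≤ 2) (hs0 : s.im ≠ 0) :
    ‖HurwitzZeta.hurwitzZeta a s‖ ≤ (a ^ 2)⁻¹
      + ‖∑ n ∈ Finset.Ico 1 (N + 1), ((n + a : ℝ) : ℂ) ^ (-s)‖
      + (N + a) ^ (1 - s.re) / |s.im| + 16 * ‖s‖ * (N + a) ^ (-s.re) := by
  have hN' : (1:ℝ) ≤ N := by exact_mod_cast hN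
  have hy : (1:ℝ) ≤ N + a := by linarith [ha.1]
  have hs1 : s ≠ 1 := by rintro rfl; simp at hs0
  rw [hurwitz_eq ha hN (by linarith) hs0, emSum, Finset.range_eq_Ico,
    Finset.sum_eq_sum_Ico_succ_bot (by omega)]
  have e1 : ‖1 / (((0:ℕ) : ℂ) + a) ^ s‖ ≤ (a ^ 2)⁻¹ := by
    rcases eq_or_lt_of_le ha.1 with h | h
    · have hs00 : s ≠ 0 := by rintro rfl; simp at hs0
      simp [← h, zero_cpow hs00]
    · rw [Nat.cast_zero, zero_add, norm_div, norm_one, norm_cpow_eq_rpow_re_of_pos h, one_div]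
      refine inv_anti₀ (by positivity) ?_
      rw [← Real.rpow_natCast]
      exact Real.rpow_le_rpow_of_exponent_ge h ha.2 (by simpa using h2)
  have e2 : ∑ k ∈ Finset.Ico (0 + 1) (N + 1), 1 / ((k:ℂ) + a) ^ s =
      ∑ n ∈ Finset.Ico 1 (N + 1), ((n + a : ℝ) : ℂ) ^ (-s) := by
    refine Finset.sum_congr (by simp) fun n _ => ?_
    rw [cpow_neg, one_div]; push_cast; rfl
  have e3 : ‖((N + a : ℝ) : ℂ) ^ (1 - s) / (s - 1)‖ ≤ (N + a) ^ (1 - s.re) / |s.im| := by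
    rw [norm_div, norm_cpow_eq_rpow_re_of_pos (by linarith)]
    simp only [sub_re, one_re]
    refine div_le_div_of_nonneg_left (by positivity) (abs_pos.mpr hs0) ?_
    simpa using abs_im_le_norm (s - 1)
  have e4 := norm_tsum_emTerm_le hy s h1 h2 hs1
  rw [e2]
  refine (norm_add_le _ _).trans (add_le_add ((norm_add_le _ _).trans (add_le_add
    ((norm_add_le _ _).trans (add_le_add e1 le_rfl)) e3)) e4)

lemma norm_hurwitz_le_im {a : ℝ} (ha : a ∈ Set.Icc (0:ℝ) 1) {s : ℂ}
    (h1 : 1 / 2 ≤ s.re) (h2 : s.re ≤ 2) (hs0 : 1 ≤ |s.im|) :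
    ‖HurwitzZeta.hurwitzZeta a s‖ ≤ (a ^ 2)⁻¹ + 100 * |s.im| := by
  have h := norm_hurwitz_le ha le_rfl h1 h2 (abs_pos.mp (by linarith))
  have hy : (1:ℝ) ≤ 1 + a := by linarith [ha.1]
  have e1 : ‖∑ n ∈ Finset.Ico (1:ℕ) (1 + 1), ((n + a : ℝ) : ℂ) ^ (-s)‖ ≤ 1 := by
    simp only [Nat.Ico_succ_singleton, Finset.sum_singleton, Nat.cast_one]
    rw [norm_cpow_eq_rpow_re_of_pos (by linarith)]
    exact Real.rpow_le_one_of_one_le_of_nonpos hy (by simp; linarith)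
  have e2 : ((1:ℕ) + a : ℝ) ^ (1 - s.re) / |s.im| ≤ 2 := by
    rw [div_le_iff₀ (by linarith)]
    calc ((1:ℕ) + a : ℝ) ^ (1 - s.re) ≤ ((1:ℕ) + a : ℝ) ^ (1:ℝ) :=
          Real.rpow_le_rpow_of_exponent_le (by simpa using hy) (by linarith)
      _ ≤ 2 := by simp; linarith [ha.2]
      _ ≤ _ := by linarith
  have e3 : ((1:ℕ) + a : ℝ) ^ (-s.re) ≤ 1 :=
    Real.rpow_le_one_of_one_le_of_nonpos (by simpa using hy) (by linarith)
  have e4 : ‖s‖ ≤ 3 * |s.im| := by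
    have := norm_le_abs_re_add_abs_im s
    rw [abs_of_nonneg (by linarith : 0 ≤ s.re)] at this
    linarith
  have e5 : 16 * ‖s‖ * ((1:ℕ) + a : ℝ) ^ (-s.re) ≤ 16 * ‖s‖ * 1 :=
    mul_le_mul_of_nonneg_left e3 (by positivity)
  have e6 := h.trans (add_le_add (add_le_add (add_le_add le_rfl e1) e2) e5)
  linarith

lemma rpow_inv_log {t : ℝ} (ht : 1 < t) : t ^ (1 / Real.log t) = Real.exp 1 := by
  rw [Real.rpow_def_of_pos (by linarith), mul_one_div_cancel (Real.log_pos ht).ne']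

lemma norm_hurwitz_le_log {a : ℝ} (ha : a ∈ Set.Icc (0:ℝ) 1) {s : ℂ} (hs0 : 10 ≤ s.im)
    (h1 : 1 - 1 / Real.log s.im ≤ s.re) (h2 : s.re ≤ 2) :
    ‖HurwitzZeta.hurwitzZeta a s‖ ≤ (a ^ 2)⁻¹ + 1000 * Real.log s.im := by
  set t := s.im with ht
  have hl2 : 2 ≤ Real.log t := by
    rw [Real.le_log_iff_exp_le (by linarith)]
    have : Real.exp 2 = Real.exp 1 ^ 2 := by rw [← Real.exp_nat_mul]; norm_num
    rw [this]
    have := Real.exp_one_lt_d9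
    have := Real.exp_pos 1
    nlinarith
  have hl0 : 0 < Real.log t := by linarith
  have hinv : 1 / Real.log t ≤ 1 / 2 := one_div_le_one_div_of_le (by norm_num) hl2
  have hinv0 : 0 ≤ 1 / Real.log t := by positivity
  have hexp := Real.exp_one_lt_d9
  set N := ⌊t⌋₊ with hN
  have hNt : (N:ℝ) ≤ t := Nat.floor_le (by linarith)
  have htN : t < N + 1 := Nat.lt_floor_add_one t
  have hN1 : 1 ≤ N := Nat.le_floor (by simp; linarith)
  have h := norm_hurwitz_le ha hN1 (by linarith) h2 (by rw [← ht]; linarith)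
  rw [← ht, abs_of_nonneg (by linarith : 0 ≤ t)] at h
  have e1 : ‖∑ n ∈ Finset.Ico 1 (N + 1), ((n + a : ℝ) : ℂ) ^ (-s)‖ ≤ 3 * (1 + Real.log (N + 1 : ℕ)) := by
    refine (norm_sum_le _ _).trans ?_
    refine le_trans ?_ (mul_le_mul_of_nonneg_left (sum_inv_le (N+1)) (by norm_num))
    rw [Finset.mul_sum]
    refine Finset.sum_le_sum fun n hn => ?_
    rw [Finset.mem_Ico] at hn
    have hn1 : (1:ℝ) ≤ n := by exact_mod_cast hn.1
    have hnt : (n:ℝ) ≤ t := le_trans (by exact_mod_cast (by omega : n ≤ N)) hNt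
    rw [norm_cpow_eq_rpow_re_of_pos (by linarith [ha.1])]
    calc (n + a : ℝ) ^ ((-s).re) ≤ (n : ℝ) ^ ((-s).re) :=
          Real.rpow_le_rpow_of_nonpos (by linarith) (by linarith [ha.1]) (by simp; linarith)
      _ ≤ (n : ℝ) ^ (1 / Real.log t + (-1)) :=
          Real.rpow_le_rpow_of_exponent_le hn1 (by simp only [neg_re]; linarith)
      _ = (n:ℝ) ^ (1 / Real.log t) * (1 / n) := by
          rw [Real.rpow_add (by linarith), Real.rpow_neg_one, one_div (n:ℝ)]
      _ ≤ t ^ (1 / Real.log t) * (1 / n) :=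
          mul_le_mul_of_nonneg_right (Real.rpow_le_rpow (by linarith) hnt hinv0) (by positivity)
      _ ≤ 3 * (1 / n) := by
          rw [rpow_inv_log (by linarith)]
          exact mul_le_mul_of_nonneg_right (by linarith) (by positivity)
  have e2 : Real.log (N + 1 : ℕ) ≤ 2 * Real.log t := by
    rw [← Real.log_rpow (by linarith)]
    refine Real.log_le_log (by positivity) ?_
    push_cast
    norm_num
    nlinarith
  have hNa : (N + a : ℝ) ≤ t ^ 2 := by nlinarith [ha.2]
  have hNa1 : (1:ℝ) ≤ N + a := by
    have : (1:ℝ) ≤ N := by exact_mod_cast hN1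
    linarith [ha.1]
  have hpow : (N + a : ℝ) ^ (1 / Real.log t) ≤ 9 := by
    calc (N + a : ℝ) ^ (1 / Real.log t) ≤ (t ^ 2) ^ (1 / Real.log t) :=
          Real.rpow_le_rpow (by linarith) hNa hinv0
      _ = (t ^ (1 / Real.log t)) ^ 2 := by
          rw [← Real.rpow_natCast, ← Real.rpow_mul (by linarith), ← Real.rpow_natCast,
            ← Real.rpow_mul (by linarith), mul_comm]
      _ ≤ 9 := by
          rw [rpow_inv_log (by linarith)]
          nlinarith [Real.exp_pos 1]
  have e3 : (N + a : ℝ) ^ (1 - s.re) / t ≤ 9 := by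
    rw [div_le_iff₀ (by linarith)]
    calc (N + a : ℝ) ^ (1 - s.re) ≤ (N + a : ℝ) ^ (1 / Real.log t) :=
          Real.rpow_le_rpow_of_exponent_le hNa1 (by linarith)
      _ ≤ 9 * t := by linarith
  have e4 : ‖s‖ ≤ 2 * t := by
    have := norm_le_abs_re_add_abs_im s
    rw [abs_of_nonneg (by linarith : 0 ≤ s.re), ← ht, abs_of_nonneg (by linarith : 0 ≤ t)] at this
    linarith
  have e5 : (N + a : ℝ) ^ (-s.re) ≤ 9 * (2 / t) := by
    calc (N + a : ℝ) ^ (-s.re) ≤ (N + a : ℝ) ^ (1 / Real.log t + (-1)) :=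
          Real.rpow_le_rpow_of_exponent_le hNa1 (by linarith)
      _ = (N + a : ℝ) ^ (1 / Real.log t) * (1 / (N + a)) := by
          rw [Real.rpow_add (by linarith), Real.rpow_neg_one, one_div (N + a : ℝ)]
      _ ≤ 9 * (2 / t) := by
          refine mul_le_mul hpow ?_ (by positivity) (by norm_num)
          rw [div_le_div_iff₀ (by linarith) (by linarith)]
          linarith [ha.1]
  have e6 : 16 * ‖s‖ * (N + a : ℝ) ^ (-s.re) ≤ 16 * (2 * t) * (9 * (2 / t)) :=
    mul_le_mul (by linarith) e5 (by positivity) (by linarith)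
  have e7 : 16 * (2 * t) * (9 * (2 / t)) = 576 := by field_simp; norm_num
  linarith

lemma norm_hurwitz_critical_le {a : ℝ} (ha : a ∈ Set.Icc (0:ℝ) 1) {t : ℝ} (ht : 10 ≤ t) :
    ‖HurwitzZeta.hurwitzZeta a ((1/2:ℝ) + t * I)‖ ≤ (a ^ 2)⁻¹ + 10 ^ 10 * t ^ (249/1000 : ℝ) := by
  set N := ⌊t^2⌋₊ - 1 with hN
  have hf1 : (⌊t^2⌋₊ : ℝ) ≤ t^2 := Nat.floor_le (by positivity)
  have hf2 : t^2 < ⌊t^2⌋₊ + 1 := Nat.lt_floor_add_one _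
  have hf3 : 2 ≤ ⌊t^2⌋₊ := Nat.le_floor (by norm_num; nlinarith)
  have hN1 : N + 1 = ⌊t^2⌋₊ := by omega
  have hN1' : (N:ℝ) + 1 = ⌊t^2⌋₊ := by exact_mod_cast hN1
  have h := norm_hurwitz_le ha (N := N) (by omega) (s := (1/2:ℝ) + t * I) (by simp) (by simp; norm_num)
    (by simp; linarith)
  have hre : ((1/2:ℝ) + t * I : ℂ).re = 1/2 := by simp
  have him : ((1/2:ℝ) + t * I : ℂ).im = t := by simp
  rw [hre, him, abs_of_nonneg (by linarith : 0 ≤ t)] at h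
  have e1 := critical_partial_sum t a (by linarith) ha.1 ha.2 (N+1) (by push_cast; linarith)
  have hNa : (N + a : ℝ) ≤ t ^ 2 := by linarith [ha.2]
  have hNa2 : (t/2)^2 ≤ (N + a : ℝ) := by nlinarith [ha.1]
  have e2 : (N + a : ℝ) ^ (1 - 1/2 : ℝ) / t ≤ 1 := by
    rw [div_le_one (by linarith), show (1 - 1/2 : ℝ) = 1/2 by norm_num, ← Real.sqrt_eq_rpow]
    exact Real.sqrt_le_iff.mpr ⟨by linarith, hNa⟩
  have e3 : (N + a : ℝ) ^ (-(1/2) : ℝ) ≤ 2 / t := by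
    rw [Real.rpow_neg (by nlinarith), ← Real.sqrt_eq_rpow, ← one_div, div_le_div_iff₀ (Real.sqrt_pos.mpr (by nlinarith)) (by linarith)]
    have := Real.le_sqrt_of_sq_le hNa2
    linarith
  have e4 : ‖((1/2:ℝ) + t * I : ℂ)‖ ≤ 2 * t := by
    have := norm_le_abs_re_add_abs_im ((1/2:ℝ) + t * I : ℂ)
    rw [hre, him, abs_of_nonneg (by linarith : 0 ≤ t), abs_of_nonneg (by norm_num)] at this
    linarith
  have e6 : 16 * ‖((1/2:ℝ) + t * I : ℂ)‖ * (N + a : ℝ) ^ (-(1/2) : ℝ) ≤ 16 * (2 * t) * (2 / t) :=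
    mul_le_mul (by linarith) e3 (Real.rpow_nonneg (by nlinarith) _) (by linarith)
  have e7 : 16 * (2 * t) * (2 / t) = 64 := by field_simp; norm_num
  have e8 : 1 ≤ t ^ (249/1000 : ℝ) := Real.one_le_rpow (by linarith) (by norm_num)
  linarith

lemma norm_LFunction_le_of_hurwitz {q : ℕ} [NeZero q] (χ : DirichletCharacter ℂ q) :
    ∃ C : ℝ, 0 < C ∧ ∀ (s : ℂ) (B : ℝ), 0 ≤ s.re → 1 ≤ B →
      (∀ a ∈ Set.Icc (0:ℝ) 1, ‖HurwitzZeta.hurwitzZeta a s‖ ≤ (a ^ 2)⁻¹ + B) →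
      ‖DirichletCharacter.LFunction χ s‖ ≤ C * B := by
  have hq : (1:ℝ) ≤ q := by exact_mod_cast Nat.one_le_iff_ne_zero.mpr (NeZero.ne q)
  refine ⟨∑ j : ZMod q, (((j.val / q : ℝ) ^ 2)⁻¹ + 1), ?_, ?_⟩
  · refine Finset.sum_pos (fun j _ => by positivity) ⟨0, Finset.mem_univ _⟩
  · intro s B hs hB h
    rw [DirichletCharacter.LFunction, ZMod.LFunction, norm_mul]
    have h1 : ‖(q:ℂ) ^ (-s)‖ ≤ 1 := by
      rw [norm_natCast_cpow_of_pos (by exact_mod_cast (by linarith : (0:ℝ) < q))]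
      exact Real.rpow_le_one_of_one_le_of_nonpos hq (by simpa using hs)
    refine (mul_le_of_le_one_left (norm_nonneg _) h1).trans ?_
    rw [Finset.sum_mul]
    refine (norm_sum_le _ _).trans (Finset.sum_le_sum fun j _ => ?_)
    rw [norm_mul]
    refine (mul_le_of_le_one_left (norm_nonneg _) (χ.norm_le_one j)).trans ?_
    rw [ZMod.toAddCircle_apply]
    have hj : ((j.val : ℝ) / q) ∈ Set.Icc (0:ℝ) 1 :=
      ⟨by positivity, (div_le_one (by linarith)).mpr (by exact_mod_cast (ZMod.val_lt j).le)⟩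
    refine (h _ hj).trans ?_
    have : 0 ≤ ((j.val / q : ℝ) ^ 2)⁻¹ := by positivity
    nlinarith

variable {q : ℕ} [NeZero q] (χ : DirichletCharacter ℂ q)

lemma norm_LFunction_le_im : ∃ C : ℝ, 0 < C ∧ ∀ s : ℂ, 1 / 2 ≤ s.re → s.re ≤ 2 → 1 ≤ |s.im| →
    ‖DirichletCharacter.LFunction χ s‖ ≤ C * |s.im| := by
  obtain ⟨C, hC, h⟩ := norm_LFunction_le_of_hurwitz χ
  refine ⟨C * 100, by positivity, fun s h1 h2 h3 => ?_⟩
  rw [mul_assoc]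
  exact h s _ (by linarith) (by linarith) fun a ha => norm_hurwitz_le_im ha h1 h2 h3

lemma norm_LFunction_le_log : ∃ C : ℝ, 0 < C ∧ ∀ s : ℂ, 10 ≤ s.im → 1 - 1 / Real.log s.im ≤ s.re →
    s.re ≤ 2 → ‖DirichletCharacter.LFunction χ s‖ ≤ C * Real.log s.im := by
  obtain ⟨C, hC, h⟩ := norm_LFunction_le_of_hurwitz χ
  refine ⟨C * 1000, by positivity, fun s h1 h2 h3 => ?_⟩
  rw [mul_assoc]
  have hl : 1 ≤ Real.log s.im := by
    rw [Real.le_log_iff_exp_le (by linarith)]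
    linarith [Real.exp_one_lt_d9]
  have : 1 / Real.log s.im ≤ 1 := by
    rw [div_le_one (by linarith)]; exact hl
  exact h s _ (by linarith) (by linarith) fun a ha => norm_hurwitz_le_log ha h1 h2 h3

lemma norm_LFunction_critical_le : ∃ C : ℝ, 0 < C ∧ ∀ t : ℝ, 10 ≤ t →
    ‖DirichletCharacter.LFunction χ ((1/2:ℝ) + t * I)‖ ≤ C * t ^ (249/1000 : ℝ) := by
  obtain ⟨C, hC, h⟩ := norm_LFunction_le_of_hurwitz χ
  refine ⟨C * 10 ^ 10, by positivity, fun t ht => ?_⟩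
  rw [mul_assoc]
  have e8 : 1 ≤ t ^ (249/1000 : ℝ) := Real.one_le_rpow (by linarith) (by norm_num)
  exact h _ _ (by simp) (by linarith) fun a ha => norm_hurwitz_critical_le ha ht

end MSW

namespace MSW

lemma norm_Gamma_le_re {z : ℂ} (hz : 0 < z.re) : ‖Gamma z‖ ≤ Real.Gamma z.re := by
  rw [Gamma_eq_integral hz, Real.Gamma_eq_integral hz, GammaIntegral]
  refine (MeasureTheory.norm_integral_le_integral_norm _).trans (le_of_eq ?_)
  refine MeasureTheory.setIntegral_congr_fun measurableSet_Ioi fun x hx => ?_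
  simp only [norm_mul, norm_real, Real.norm_eq_abs, Real.abs_exp]
  rw [norm_cpow_eq_rpow_re_of_pos hx]
  simp

lemma Gamma_ne_zero_of_im {w : ℂ} (hw : w.im ≠ 0) : Gamma w ≠ 0 := by
  refine Gamma_ne_zero fun m h => hw ?_
  rw [h]; simp

lemma differentiableAt_Gamma_of_im {w : ℂ} (hw : w.im ≠ 0) : DifferentiableAt ℂ Gamma w := by
  refine differentiableAt_Gamma _ fun m h => hw ?_
  rw [h]; simp

lemma exists_norm_Gamma_le : ∃ C : ℝ, 0 < C ∧ ∀ w : ℂ, -1/4 ≤ w.re → w.re ≤ 5/4 → 1/2 ≤ |w.im| →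
    ‖Gamma w‖ ≤ C := by
  have hc : ContinuousOn Real.Gamma (Set.Icc (3/4) (9/4)) := fun x hx =>
    (Real.differentiableAt_Gamma (fun m => by
      have := hx.1
      have : (0:ℝ) ≤ m := by positivity
      intro h; linarith)).continuousAt.continuousWithinAt
  obtain ⟨M, hM⟩ := isCompact_Icc.exists_bound_of_continuousOn hc
  have hM0 : 0 ≤ M := (norm_nonneg _).trans (hM 1 ⟨by norm_num, by norm_num⟩)
  refine ⟨2 * M + 1, by positivity, fun w h1 h2 h3 => ?_⟩
  have him : w.im ≠ 0 := abs_pos.mp (by linarith)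
  have hw0 : w ≠ 0 := by rintro rfl; simp at him
  have e := Gamma_add_one w hw0
  have e1 : ‖Gamma (w + 1)‖ ≤ M := by
    refine (norm_Gamma_le_re (by simp; linarith)).trans ((le_abs_self _).trans (hM _ ⟨?_, ?_⟩)) <;>
    simp <;> linarith
  rw [e, norm_mul] at e1
  have : 1/2 ≤ ‖w‖ := h3.trans (abs_im_le_norm w)
  nlinarith [norm_nonneg (Gamma w)]

lemma norm_sin_le_exp (z : ℂ) : ‖Complex.sin z‖ ≤ Real.exp |z.im| := by
  rw [Complex.sin, norm_div, norm_mul, norm_I, mul_one]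
  have h2 : ‖(2:ℂ)‖ = 2 := by simp
  rw [h2, div_le_iff₀ (by norm_num)]
  refine (norm_sub_le _ _).trans ?_
  rw [norm_exp, norm_exp]
  have e1 : Real.exp (-z * I).re ≤ Real.exp |z.im| := by
    apply Real.exp_le_exp.mpr; simpa using le_abs_self z.im
  have e2 : Real.exp (z * I).re ≤ Real.exp |z.im| := by
    apply Real.exp_le_exp.mpr; simpa using neg_abs_le z.im |> neg_le_neg |> fun h => by simpa using neg_le_abs z.im
  linarith

lemma exists_norm_inv_Gamma_le : ∃ C : ℝ, 0 < C ∧ ∀ w : ℂ, -1/4 ≤ w.re → w.re ≤ 5/4 → 1/2 ≤ |w.im| →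
    ‖Gamma w‖⁻¹ ≤ C * Real.exp (4 * |w.im|) := by
  obtain ⟨C, hC, h⟩ := exists_norm_Gamma_le
  refine ⟨C, hC, fun w h1 h2 h3 => ?_⟩
  have him : w.im ≠ 0 := abs_pos.mp (by linarith)
  have hG : Gamma w ≠ 0 := Gamma_ne_zero_of_im him
  have hG' : Gamma (1 - w) ≠ 0 := Gamma_ne_zero_of_im (by simpa using him)
  have e := Gamma_mul_Gamma_one_sub w
  have hsin : Complex.sin (Real.pi * w) ≠ 0 := by
    intro h0; rw [h0, div_zero] at e
    exact (mul_ne_zero hG hG') e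
  have e' : (Gamma w)⁻¹ = Gamma (1 - w) * Complex.sin (Real.pi * w) / Real.pi := by
    have hpi : (Real.pi : ℂ) ≠ 0 := by exact_mod_cast Real.pi_ne_zero
    generalize Complex.sin (Real.pi * w) = S at e hsin ⊢
    field_simp at e ⊢
    rw [← e]
  rw [← norm_inv, e', norm_div, norm_mul, norm_real, Real.norm_of_nonneg Real.pi_pos.le]
  have b1 : ‖Gamma (1 - w)‖ ≤ C := h _ (by simp; linarith) (by simp; linarith) (by simpa using h3)
  have b2 : ‖Complex.sin (Real.pi * w)‖ ≤ Real.exp (4 * |w.im|) := by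
    refine (norm_sin_le_exp _).trans (Real.exp_le_exp.mpr ?_)
    rw [im_ofReal_mul, abs_mul, abs_of_pos Real.pi_pos]
    nlinarith [Real.pi_lt_four, abs_nonneg w.im]
  rw [div_le_iff₀ Real.pi_pos]
  have : C * Real.exp (4 * |w.im|) * 1 ≤ C * Real.exp (4 * |w.im|) * Real.pi :=
    mul_le_mul_of_nonneg_left (by linarith [Real.pi_gt_three]) (by positivity)
  have := mul_le_mul b1 b2 (norm_nonneg _) hC.le
  linarith

/-- Quotient of archimedean factors, with shift `δ ∈ {0, 1}` for the parity. -/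
noncomputable def gamRatio (δ : ℕ) (s : ℂ) : ℂ := Gammaℝ (1 - s + δ) / Gammaℝ (s + δ)

lemma gamRatio_eq (δ : ℕ) (s : ℂ) : gamRatio δ s =
    (Real.pi : ℂ) ^ (s - 1/2) * (Gamma ((1 - s + δ) / 2) / Gamma ((s + δ) / 2)) := by
  have hpi : (Real.pi : ℂ) ≠ 0 := by exact_mod_cast Real.pi_ne_zero
  rw [gamRatio, Gammaℝ_def, Gammaℝ_def, mul_div_mul_comm, ← cpow_sub _ _ hpi]
  congr 2; ring

lemma norm_gamRatio (δ : ℕ) (s : ℂ) : ‖gamRatio δ s‖ =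
    Real.pi ^ (s.re - 1/2) * (‖Gamma ((1 - s + δ) / 2)‖ / ‖Gamma ((s + δ) / 2)‖) := by
  rw [gamRatio_eq, norm_mul, norm_div, norm_cpow_eq_rpow_re_of_pos Real.pi_pos]
  simp

lemma norm_Gamma_eq_of_conj {z w : ℂ} (h : w.re = z.re) (h' : w.im = -z.im) :
    ‖Gamma w‖ = ‖Gamma z‖ := by
  rw [show w = starRingEnd ℂ z from Complex.ext (by simpa using h) (by simpa using h'),
    Gamma_conj, norm_conj]

lemma norm_gamRatio_half (δ : ℕ) {t : ℝ} (ht : t ≠ 0) : ‖gamRatio δ ((1/2:ℝ) + t * I)‖ = 1 := by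
  rw [norm_gamRatio, norm_Gamma_eq_of_conj (z := (((1/2:ℝ) + t * I : ℂ) + δ) / 2), div_self]
  · simp
  · rw [norm_ne_zero_iff]
    exact Gamma_ne_zero_of_im (by simp [ht])
  · simp; ring
  · simp; ring

lemma norm_gamRatio_three_half (δ : ℕ) {t : ℝ} (ht : 0 < t) :
    ‖gamRatio δ ((3/2:ℝ) + t * I)‖ ≤ 4 * (2 / t) := by
  set w : ℂ := (1 - ((3/2:ℝ) + t * I) + δ) / 2 with hw
  have hwim : w.im = -t/2 := by simp [hw]
  have hw0 : w ≠ 0 := by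
    intro h; rw [h] at hwim; simp at hwim; linarith
  have e := Gamma_add_one w hw0
  have hG : ‖Gamma w‖ = ‖Gamma (w + 1)‖ / ‖w‖ := by
    rw [e, norm_mul, mul_div_cancel_left₀ _ (norm_ne_zero_iff.mpr hw0)]
  have hc : ‖Gamma (w + 1)‖ = ‖Gamma ((((3/2:ℝ) + t * I : ℂ) + δ) / 2)‖ := by
    apply norm_Gamma_eq_of_conj
    · simp [hw]; ring
    · simp [hw]; ring
  have hne : ‖Gamma (w + 1)‖ ≠ 0 := by
    rw [norm_ne_zero_iff]; exact Gamma_ne_zero_of_im (by simp [hwim]; exact ht.ne')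
  rw [norm_gamRatio, ← hw, ← hc, hG, div_div, mul_comm ‖w‖, ← div_div, div_self hne]
  have h1 : t / 2 ≤ ‖w‖ := by
    have := abs_im_le_norm w
    rw [hwim, abs_of_neg (by linarith)] at this
    linarith
  refine mul_le_mul ?_ ?_ (by positivity) (by norm_num)
  · simp; norm_num; exact Real.pi_le_four
  · rw [div_le_div_iff₀ (by linarith) ht]; linarith

lemma norm_gamRatio_neg_half (δ : ℕ) (hδ : δ ≤ 1) {t : ℝ} (ht : 1 ≤ t) :
    ‖gamRatio δ ((-1/2:ℝ) + t * I)‖ ≤ t := by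
  set w : ℂ := (((-1/2:ℝ) + t * I : ℂ) + δ) / 2 with hw
  have hwim : w.im = t/2 := by simp [hw]
  have hw0 : w ≠ 0 := by
    intro h; rw [h] at hwim; simp at hwim; linarith
  have e := Gamma_add_one w hw0
  have hc : ‖Gamma ((1 - ((-1/2:ℝ) + t * I) + δ) / 2)‖ = ‖Gamma (w + 1)‖ := by
    apply norm_Gamma_eq_of_conj
    · simp [hw]; ring
    · simp [hw]; ring
  have hne : ‖Gamma w‖ ≠ 0 := by
    rw [norm_ne_zero_iff]; exact Gamma_ne_zero_of_im (by simp [hwim]; linarith)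
  rw [norm_gamRatio, ← hw, hc, e, norm_mul, mul_div_cancel_right₀ _ hne]
  have h1 : ‖w‖ ≤ t := by
    have := norm_le_abs_re_add_abs_im w
    rw [hwim, abs_of_pos (by linarith : 0 < t / 2)] at this
    have h2 : |w.re| ≤ 1/4 := by
      interval_cases δ <;> simp [hw] <;> norm_num
    linarith
  have h2 : Real.pi ^ ((((-1/2:ℝ) + t * I : ℂ)).re - 1/2) ≤ 1 := by
    refine Real.rpow_le_one_of_one_le_of_nonpos (by linarith [Real.pi_gt_three]) ?_
    simp; norm_num
  calc _ ≤ 1 * ‖w‖ := mul_le_mul_of_nonneg_right h2 (norm_nonneg _)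
    _ ≤ t := by linarith

lemma exists_norm_gamRatio_le : ∃ C : ℝ, 0 < C ∧ ∀ δ : ℕ, δ ≤ 1 → ∀ s : ℂ, -1/2 ≤ s.re → s.re ≤ 3/2 →
    1 ≤ |s.im| → ‖gamRatio δ s‖ ≤ C * Real.exp (4 * |s.im|) := by
  obtain ⟨C, hC, h⟩ := exists_norm_Gamma_le
  obtain ⟨C', hC', h'⟩ := exists_norm_inv_Gamma_le
  refine ⟨4 * (C * C'), by positivity, fun δ hδ s h1 h2 h3 => ?_⟩
  have hδ0 : (0:ℝ) ≤ δ := by positivity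
  have hδ1 : (δ:ℝ) ≤ 1 := by exact_mod_cast hδ
  have r1 : ((1 - s + δ) / 2).re = (1 - s.re + δ) / 2 := by simp
  have r2 : ((1 - s + δ) / 2).im = -s.im / 2 := by simp
  have r3 : ((s + δ) / 2).re = (s.re + δ) / 2 := by simp
  have r4 : ((s + δ) / 2).im = s.im / 2 := by simp
  have b1 := h ((1 - s + δ) / 2) (by rw [r1]; linarith) (by rw [r1]; linarith)
    (by rw [r2, abs_div, abs_neg, abs_two]; linarith)
  have b2 := h' ((s + δ) / 2) (by rw [r3]; linarith) (by rw [r3]; linarith)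
    (by rw [r4, abs_div, abs_two]; linarith)
  rw [r4, abs_div, abs_two] at b2
  have b3 : Real.exp (4 * (|s.im| / 2)) ≤ Real.exp (4 * |s.im|) :=
    Real.exp_le_exp.mpr (by linarith [abs_nonneg s.im])
  have b4 : Real.pi ^ (s.re - 1/2) ≤ 4 := by
    calc Real.pi ^ (s.re - 1/2) ≤ Real.pi ^ (1:ℝ) :=
          Real.rpow_le_rpow_of_exponent_le (by linarith [Real.pi_gt_three]) (by linarith)
      _ ≤ 4 := by simpa using Real.pi_le_four
  rw [norm_gamRatio, div_eq_mul_inv]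
  calc _ ≤ 4 * (C * (C' * Real.exp (4 * |s.im|))) := by
        refine mul_le_mul b4 (mul_le_mul b1 (b2.trans ?_) (by positivity) hC.le) (by positivity) (by norm_num)
        exact mul_le_mul_of_nonneg_left b3 hC'.le
    _ = _ := by ring

lemma differentiableAt_gamRatio (δ : ℕ) {s : ℂ} (hs : s.im ≠ 0) : DifferentiableAt ℂ (gamRatio δ) s := by
  have : gamRatio δ = fun s => (Real.pi : ℂ) ^ (s - 1/2) *
      (Gamma ((1 - s + δ) / 2) / Gamma ((s + δ) / 2)) := funext (gamRatio_eq δ)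
  rw [this]
  have hpi : (Real.pi : ℂ) ≠ 0 := by exact_mod_cast Real.pi_ne_zero
  refine DifferentiableAt.mul (DifferentiableAt.const_cpow (by fun_prop) (Or.inl hpi)) (DifferentiableAt.div ?_ ?_ ?_)
  · exact DifferentiableAt.comp (g := Gamma) (f := fun s : ℂ => (1 - s + δ) / 2) s
      (differentiableAt_Gamma_of_im (by simpa using hs)) (by fun_prop)
  · exact DifferentiableAt.comp (g := Gamma) (f := fun s : ℂ => (s + δ) / 2) s
      (differentiableAt_Gamma_of_im (by simpa using hs)) (by fun_prop)
  · exact Gamma_ne_zero_of_im (by simpa using hs)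

/-- The factor of a self-dual functional equation, with its size on three vertical lines
and in the strip between them. -/
structure FEFactor (L X : ℂ → ℂ) (k : ℕ) (C c : ℝ) : Prop where
  pos : 0 < C
  eq : ∀ s : ℂ, s.im ≠ 0 → L s = X s * L (1 - s)
  diff : ∀ s : ℂ, s.im ≠ 0 → DifferentiableAt ℂ X s
  half : ∀ t : ℝ, 1 ≤ t → ‖X ((1/2:ℝ) + t * I)‖ ≤ C
  right : ∀ t : ℝ, 1 ≤ t → ‖X ((3/2:ℝ) + t * I)‖ ≤ C * (t ^ k)⁻¹
  left : ∀ t : ℝ, 1 ≤ t → ‖X ((-1/2:ℝ) + t * I)‖ ≤ C * t ^ k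
  strip : ∀ s : ℂ, -1/2 ≤ s.re → s.re ≤ 3/2 → 1 ≤ |s.im| → ‖X s‖ ≤ C * Real.exp (c * |s.im|)

lemma FEFactor.mul {L X L' X' : ℂ → ℂ} {k k' : ℕ} {C C' c c' : ℝ} (h : FEFactor L X k C c)
    (h' : FEFactor L' X' k' C' c') :
    FEFactor (fun s => L s * L' s) (fun s => X s * X' s) (k + k') (C * C') (c + c') where
  pos := mul_pos h.pos h'.pos
  eq s hs := by rw [h.eq s hs, h'.eq s hs]; ring
  diff s hs := (h.diff s hs).mul (h'.diff s hs)
  half t ht := by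
    rw [norm_mul]; exact mul_le_mul (h.half t ht) (h'.half t ht) (norm_nonneg _) h.pos.le
  right t ht := by
    rw [norm_mul, pow_add, mul_inv]
    refine (mul_le_mul (h.right t ht) (h'.right t ht) (norm_nonneg _) ?_).trans (le_of_eq (by ring))
    have := h.pos; positivity
  left t ht := by
    rw [norm_mul, pow_add]
    refine (mul_le_mul (h.left t ht) (h'.left t ht) (norm_nonneg _) ?_).trans (le_of_eq (by ring))
    have := h.pos; positivity
  strip s h1 h2 h3 := by
    rw [norm_mul, add_mul, Real.exp_add]
    refine (mul_le_mul (h.strip s h1 h2 h3) (h'.strip s h1 h2 h3) (norm_nonneg _) ?_).trans (le_of_eq (by ring))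
    have := h.pos; positivity

lemma exists_feFactor {q : ℕ} [NeZero q] {χ : DirichletCharacter ℂ q} (hχ : χ.IsPrimitive)
    (hχ2 : χ⁻¹ = χ) : ∃ X C, FEFactor (DirichletCharacter.LFunction χ) X 1 C 4 := by
  obtain ⟨C, hC, hstrip⟩ := exists_norm_gamRatio_le
  obtain ⟨δ, hδ, hγ⟩ : ∃ δ : ℕ, δ ≤ 1 ∧ ∀ s, DirichletCharacter.gammaFactor χ s = Gammaℝ (s + δ) := by
    rcases χ.even_or_odd with h | h
    · exact ⟨0, by norm_num, fun s => by rw [h.gammaFactor_def]; simp⟩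
    · exact ⟨1, le_rfl, fun s => by rw [h.gammaFactor_def]; simp⟩
  have hq : (1:ℝ) ≤ q := by exact_mod_cast Nat.one_le_iff_ne_zero.mpr (NeZero.ne q)
  have hq0 : (q:ℂ) ≠ 0 := by exact_mod_cast NeZero.ne q
  set ε := DirichletCharacter.rootNumber χ
  set X : ℂ → ℂ := fun s => ε * (q:ℂ) ^ (1/2 - s) * gamRatio δ s with hX
  set A : ℝ := (‖ε‖ + 1) * q * (8 + C) with hA
  have hεq : ∀ s : ℂ, -1/2 ≤ s.re → ‖ε * (q:ℂ) ^ (1/2 - s)‖ ≤ (‖ε‖ + 1) * q := by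
    intro s hs
    rw [norm_mul, norm_natCast_cpow_of_pos (by exact_mod_cast (by linarith : (0:ℝ) < q))]
    refine mul_le_mul (by linarith) ?_ (by positivity) (by positivity)
    calc (q:ℝ) ^ (1/2 - s).re ≤ (q:ℝ) ^ (1:ℝ) :=
          Real.rpow_le_rpow_of_exponent_le hq (by simp; linarith)
      _ = q := Real.rpow_one _
  have hXle : ∀ (s : ℂ) (B : ℝ), -1/2 ≤ s.re → 0 ≤ B → ‖gamRatio δ s‖ ≤ (8 + C) * B → ‖X s‖ ≤ A * B := by
    intro s B hs hB h
    rw [hX, hA, mul_assoc _ (8 + C)]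
    simp only [norm_mul _ (gamRatio δ s)]
    exact mul_le_mul (hεq s hs) h (norm_nonneg _) (by positivity)
  have him : ∀ (σ t : ℝ), ((σ + t * I : ℂ)).im = t := by intros; simp
  have hre : ∀ (σ t : ℝ), ((σ + t * I : ℂ)).re = σ := by intros; simp
  refine ⟨X, A, ⟨by positivity, ?_, ?_, ?_, ?_, ?_, ?_⟩⟩
  · intro s hs
    have h0 : s ≠ 0 := by rintro rfl; simp at hs
    have h1 : (1 - s) ≠ 0 := by
      intro h; have := congrArg Complex.im h; simp at this; exact hs this
    rw [DirichletCharacter.LFunction_eq_completed_div_gammaFactor χ s (Or.inl h0),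
      DirichletCharacter.LFunction_eq_completed_div_gammaFactor χ (1 - s) (Or.inl h1)]
    have fe := hχ.completedLFunction_one_sub (1 - s)
    rw [hχ2, sub_sub_cancel] at fe
    rw [fe, hγ, hγ, hX]
    simp only [gamRatio]
    have hg : Gammaℝ (1 - s + δ) ≠ 0 := by
      intro h
      obtain ⟨n, hn⟩ := Gammaℝ_eq_zero_iff.mp h
      have := congrArg Complex.im hn
      simp at this; exact hs this
    rw [show (1 - s - 1/2 : ℂ) = 1/2 - s by ring]
    field_simp
    ring
  · intro s hs
    refine DifferentiableAt.mul (DifferentiableAt.mul (by fun_prop) (DifferentiableAt.const_cpow (by fun_prop) (Or.inl hq0)))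
      (differentiableAt_gamRatio δ hs)
  · intro t ht
    have := hXle ((1/2:ℝ) + t * I) 1 (by rw [hre]; norm_num) (by norm_num)
      (by rw [norm_gamRatio_half δ (by linarith)]; linarith)
    linarith
  · intro t ht
    refine hXle _ _ (by rw [hre]; norm_num) (by positivity) ((norm_gamRatio_three_half δ (by linarith)).trans ?_)
    rw [pow_one]
    have : 0 < t⁻¹ := by positivity
    have e : 4 * (2 / t) = 8 * t⁻¹ := by ring
    rw [e]; nlinarith
  · intro t ht
    refine hXle _ _ (by rw [hre]) (by positivity) ((norm_gamRatio_neg_half δ hδ ht).trans ?_)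
    rw [pow_one]; nlinarith
  · intro s h1 h2 h3
    refine hXle _ _ h1 (by positivity) ((hstrip δ hδ s h1 h2 h3).trans ?_)
    have : 0 < Real.exp (4 * |s.im|) := by positivity
    nlinarith

end MSW

namespace MSW

section coef
variable {q : ℕ} {χ : DirichletCharacter ℂ q}

/-- Real-valued version of the coefficients of `ζ(s) L(s, χ)`. -/
noncomputable def zmul (χ : DirichletCharacter ℂ q) : ArithmeticFunction ℝ :=
  ⟨fun n => (χ.zetaMul n).re, by simp⟩

lemma zmul_apply (n : ℕ) : zmul χ n = (χ.zetaMul n).re := rfl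

lemma ofReal_zmul (hχ : χ ^ 2 = 1) (n : ℕ) : ((zmul χ n : ℝ) : ℂ) = χ.zetaMul n := by
  have h := DirichletCharacter.zetaMul_nonneg hχ n
  rw [Complex.le_def] at h
  exact Complex.ext (by simp [zmul_apply]) (by simpa using h.2)

lemma zmul_nonneg (hχ : χ ^ 2 = 1) (n : ℕ) : 0 ≤ zmul χ n := by
  have h := DirichletCharacter.zetaMul_nonneg hχ n
  rw [Complex.le_def] at h
  simpa [zmul_apply] using h.1

lemma norm_zetaMul (hχ : χ ^ 2 = 1) (n : ℕ) : ‖χ.zetaMul n‖ = zmul χ n := by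
  rw [← ofReal_zmul hχ, norm_real, Real.norm_of_nonneg (zmul_nonneg hχ n)]

lemma isMultiplicative_zmul (hχ : χ ^ 2 = 1) : (zmul χ).IsMultiplicative := by
  have h := DirichletCharacter.isMultiplicative_zetaMul χ
  refine ⟨by simp [zmul_apply, h.1], fun {m n} hmn => ?_⟩
  have := h.2 hmn
  rw [← ofReal_zmul hχ, ← ofReal_zmul hχ, ← ofReal_zmul hχ] at this
  exact_mod_cast this

lemma zetaMul_apply (n : ℕ) (hn : n ≠ 0) : χ.zetaMul n = ∑ d ∈ n.divisors, χ d := by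
  rw [DirichletCharacter.zetaMul, ArithmeticFunction.coe_zeta_mul_apply]
  refine Finset.sum_congr rfl fun d hd => ?_
  have : d ≠ 0 := (Nat.pos_of_mem_divisors hd).ne'
  simp [toArithmeticFunction, this]

lemma norm_zetaMul_le (n : ℕ) : ‖χ.zetaMul n‖ ≤ n := by
  rcases eq_or_ne n 0 with rfl | hn
  · simp
  rw [zetaMul_apply n hn]
  refine (norm_sum_le _ _).trans ?_
  calc ∑ d ∈ n.divisors, ‖χ d‖ ≤ ∑ d ∈ n.divisors, (1:ℝ) :=
        Finset.sum_le_sum fun d _ => χ.norm_le_one _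
    _ = (n.divisors.card : ℝ) := by simp
    _ ≤ n := by exact_mod_cast Nat.card_divisors_le_self n

lemma zmul_le (hχ : χ ^ 2 = 1) (n : ℕ) : zmul χ n ≤ n := by
  rw [← norm_zetaMul hχ]; exact norm_zetaMul_le n

lemma zmul_prime_pow (hχ : χ ^ 2 = 1) {p : ℕ} (hp : p.Prime) :
    ∃ x : ℝ, (x = 0 ∨ x = 1 ∨ x = -1) ∧ (χ p = x) ∧
      ∀ k, zmul χ (p ^ k) = ∑ i ∈ Finset.range (k + 1), x ^ i := by
  have key : ∀ x : ℝ, χ p = x → ∀ k, zmul χ (p ^ k) = ∑ i ∈ Finset.range (k + 1), x ^ i := by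
    intro x hx k
    rw [zmul_apply, zetaMul_apply _ (pow_ne_zero _ hp.ne_zero), Nat.sum_divisors_prime_pow hp]
    have : ∀ i, χ ((p ^ i : ℕ) : ZMod q) = ((x ^ i : ℝ) : ℂ) := by
      intro i; push_cast; rw [map_pow, hx]
    simp_rw [this]
    rw [← ofReal_sum, ofReal_re]
  rcases MulChar.isQuadratic_iff_sq_eq_one.mpr hχ p with h | h | h
  · exact ⟨0, by simp, by simp [h], key 0 (by simp [h])⟩
  · exact ⟨1, by simp, by simp [h], key 1 (by simp [h])⟩
  · exact ⟨-1, by simp, by simp [h], key (-1) (by simp [h])⟩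

lemma zmul_sq_le_prime_pow (hχ : χ ^ 2 = 1) {p : ℕ} (hp : p.Prime) (k : ℕ) :
    zmul χ (p ^ k) ^ 2 ≤ (zmul χ * zmul χ) (p ^ k) := by
  obtain ⟨x, hx, -, h⟩ := zmul_prime_pow hχ hp
  have e : (zmul χ * zmul χ) (p ^ k) =
      ∑ i ∈ Finset.range (k + 1), zmul χ (p ^ i) * zmul χ (p ^ (k - i)) := by
    rw [ArithmeticFunction.mul_apply,
      Nat.sum_divisorsAntidiagonal (fun i j => zmul χ i * zmul χ j), Nat.sum_divisors_prime_pow hp]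
    refine Finset.sum_congr rfl fun i hi => ?_
    rw [Nat.pow_div (by simpa [Nat.lt_succ_iff] using hi) hp.pos]
  have hterm : ∀ i ∈ Finset.range (k + 1), 0 ≤ zmul χ (p ^ i) * zmul χ (p ^ (k - i)) := fun i _ =>
    mul_nonneg (zmul_nonneg hχ _) (zmul_nonneg hχ _)
  rw [e]
  have hsmall : zmul χ (p ^ k) ^ 2 ≤ zmul χ (p ^ k) →
      zmul χ (p ^ k) ^ 2 ≤ ∑ i ∈ Finset.range (k + 1), zmul χ (p ^ i) * zmul χ (p ^ (k - i)) := by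
    intro h1
    refine h1.trans ((le_of_eq ?_).trans (Finset.single_le_sum hterm (Finset.mem_range.mpr k.succ_pos)))
    simp [(isMultiplicative_zmul hχ).1]
  rcases hx with rfl | rfl | rfl
  · apply hsmall
    rw [h, zero_geom_sum]; simp
  · have h' : ∀ k : ℕ, zmul χ (p ^ k) = (k:ℝ) + 1 := by intro k; rw [h]; simp
    simp_rw [h']
    calc ((k:ℝ) + 1) ^ 2 = ∑ i ∈ Finset.range (k + 1), ((k:ℝ) + 1) := by simp; ring
      _ ≤ _ := by
        refine Finset.sum_le_sum fun i hi => ?_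
        have hi' : i ≤ k := by simpa [Nat.lt_succ_iff] using hi
        obtain ⟨j, rfl⟩ := Nat.exists_eq_add_of_le hi'
        have : i + j - i = j := by omega
        rw [this]; push_cast
        nlinarith [(by positivity : (0:ℝ) ≤ i * j)]
  · apply hsmall
    rw [h, neg_one_geom_sum]
    split_ifs <;> simp

lemma zmul_sq_le (hχ : χ ^ 2 = 1) (n : ℕ) : zmul χ n ^ 2 ≤ (zmul χ * zmul χ) n := by
  rcases eq_or_ne n 0 with rfl | hn
  · simp
  have hm := isMultiplicative_zmul hχ
  rw [hm.multiplicative_factorization _ hn, (hm.mul hm).multiplicative_factorization _ hn,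
    Finsupp.prod, Finsupp.prod, ← Finset.prod_pow]
  refine Finset.prod_le_prod (fun p _ => sq_nonneg _) fun p hp => ?_
  exact zmul_sq_le_prime_pow hχ (Nat.prime_of_mem_primeFactors hp) _

lemma term_zetaMul_norm (hχ : χ ^ 2 = 1) (σ : ℝ) (n : ℕ) :
    ‖LSeries.term χ.zetaMul σ n‖ = zmul χ n * (n:ℝ) ^ (-σ) := by
  rcases eq_or_ne n 0 with rfl | hn
  · simp
  rw [LSeries.norm_term_eq, if_neg hn, norm_zetaMul hχ, ofReal_re, Real.rpow_neg (by positivity), div_eq_mul_inv]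

lemma summable_zmul (hχ : χ ^ 2 = 1) {σ : ℝ} (hσ : 1 < σ) :
    Summable fun n : ℕ => zmul χ n * (n:ℝ) ^ (-σ) := by
  have := (χ.LSeriesSummable_zetaMul (s := σ) (by simpa using hσ)).norm
  exact this.congr (term_zetaMul_norm hχ σ)

variable [NeZero q]

lemma LSeries_zetaMul {s : ℂ} (hs : 1 < s.re) :
    LSeries χ.zetaMul s = riemannZeta s * DirichletCharacter.LFunction χ s := by
  have h2 : LSeriesSummable (toArithmeticFunction (χ ·) : ArithmeticFunction ℂ) s := by
    refine LSeriesSummable_of_bounded_of_one_lt_re (m := 1) (fun n hn ↦ ?_) hs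
    simpa only [toArithmeticFunction, ArithmeticFunction.coe_mk, hn, ↓reduceIte]
      using χ.norm_le_one _
  have h3 : LSeries (toArithmeticFunction (χ ·) : ArithmeticFunction ℂ) s = LSeries (χ ·) s :=
    LSeries_congr (fun {n} hn => by simp [toArithmeticFunction, hn]) s
  have h4 := ArithmeticFunction.LSeries_mul' (f := (ArithmeticFunction.zeta : ArithmeticFunction ℂ))
    (ArithmeticFunction.LSeriesSummable_zeta_iff.mpr hs) h2
  have h5 : LSeries (fun n => (ArithmeticFunction.zeta : ArithmeticFunction ℂ) n) s = riemannZeta s := by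
    rw [← ArithmeticFunction.LSeries_zeta_eq_riemannZeta hs]
    exact LSeries_congr (fun {n} _ => by simp) s
  rw [h3, h5, ← DirichletCharacter.LFunction_eq_LSeries χ hs] at h4
  exact h4

lemma tsum_zmul (hχ : χ ^ 2 = 1) {σ : ℝ} (hσ : 1 < σ) :
    ((∑' n : ℕ, zmul χ n * (n:ℝ) ^ (-σ) : ℝ) : ℂ) =
      riemannZeta σ * DirichletCharacter.LFunction χ σ := by
  rw [← LSeries_zetaMul (by simpa using hσ), LSeries, ofReal_tsum]
  refine tsum_congr fun n => ?_
  rcases eq_or_ne n 0 with rfl | hn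
  · simp
  rw [LSeries.term_of_ne_zero hn, ← ofReal_zmul hχ]
  push_cast
  rw [ofReal_cpow (by positivity)]
  push_cast
  rw [cpow_neg, div_eq_mul_inv]

lemma norm_riemannZeta_le {σ : ℝ} (h1 : 1 < σ) (h2 : σ ≤ 2) : ‖riemannZeta σ‖ ≤ 34 / (σ - 1) := by
  have hs1 : (σ : ℂ) ≠ 1 := by exact_mod_cast h1.ne'
  have h := hurwitz_eq_of_one_lt (a := 0) (by simp) (le_refl 1) (s := σ) (by simpa using h1)
  have ht := norm_tsum_emTerm_le (y := (1:ℕ) + 0) (by simp) σ (by simp; linarith) (by simpa using h2) hs1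
  have h0 : (σ : ℂ) ≠ 0 := by exact_mod_cast (by linarith : σ ≠ 0)
  rw [show (((0:ℝ)) : UnitAddCircle) = 0 from rfl, HurwitzZeta.hurwitzZeta_zero, emSum] at h
  have e1 : ∑ n ∈ Finset.range (1 + 1), 1 / ((n:ℂ) + (0:ℝ)) ^ (σ:ℂ) = 1 := by
    simp [Finset.sum_range_succ, zero_cpow h0]
  have e2 : (((1:ℕ) + (0:ℝ) : ℝ) : ℂ) ^ (1 - σ : ℂ) / (σ - 1) = ((1 / (σ - 1) : ℝ) : ℂ) := by
    simp
  rw [e1, e2] at h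
  have e3 : ‖((1 / (σ - 1) : ℝ) : ℂ)‖ = 1 / (σ - 1) := by
    rw [norm_real, Real.norm_of_nonneg (one_div_nonneg.mpr (by linarith))]
  have e4 : 16 * ‖(σ:ℂ)‖ * ((1:ℕ) + (0:ℝ) : ℝ) ^ (-(σ:ℂ).re) ≤ 32 := by
    rw [norm_real, Real.norm_of_nonneg (by linarith)]
    simp; linarith
  rw [h]
  have h5 : 1 ≤ 1 / (σ - 1) := by rw [le_div_iff₀ (by linarith)]; linarith
  calc _ ≤ 1 + 1 / (σ - 1) + 32 := by
        refine (norm_add_le _ _).trans (add_le_add ((norm_add_le _ _).trans ?_) (ht.trans e4))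
        rw [e3, norm_one]
    _ ≤ 34 * (1 / (σ - 1)) := by linarith
    _ = _ := by ring

lemma exists_tsum_zmul_le (hχ : χ ^ 2 = 1) (hχ1 : χ ≠ 1) : ∃ C : ℝ, 0 < C ∧ ∀ σ : ℝ, 1 < σ → σ ≤ 2 →
    ∑' n : ℕ, zmul χ n * (n:ℝ) ^ (-σ) ≤ C / (σ - 1) := by
  have hc : ContinuousOn (fun σ : ℝ => DirichletCharacter.LFunction χ σ) (Set.Icc 1 2) :=
    ((DirichletCharacter.differentiable_LFunction hχ1).continuous.comp continuous_ofReal).continuousOn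
  obtain ⟨M, hM⟩ := isCompact_Icc.exists_bound_of_continuousOn hc
  have hM0 : 0 ≤ M := (norm_nonneg _).trans (hM 1 ⟨by norm_num, by norm_num⟩)
  refine ⟨34 * (M + 1), by positivity, fun σ h1 h2 => ?_⟩
  have e := tsum_zmul hχ h1
  have e' := congrArg norm e
  rw [norm_real, norm_mul] at e'
  refine (le_abs_self _).trans ?_
  rw [← Real.norm_eq_abs, e', mul_div_right_comm]
  exact mul_le_mul (norm_riemannZeta_le h1 h2) ((hM σ ⟨h1.le, h2⟩).trans (by linarith))
    (norm_nonneg _) (div_nonneg (by norm_num) (by linarith))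

lemma exists_sum_zmul_sq_le (hχ : χ ^ 2 = 1) (hχ1 : χ ≠ 1) : ∃ C : ℝ, 0 < C ∧ ∀ σ : ℝ, 1 < σ → σ ≤ 2 →
    ∀ S : Finset ℕ, ∑ n ∈ S, zmul χ n ^ 2 * (n:ℝ) ^ (-σ) ≤ C / (σ - 1) ^ 2 := by
  obtain ⟨C, hC, h⟩ := exists_tsum_zmul_le hχ hχ1
  refine ⟨C ^ 2, by positivity, fun σ h1 h2 S => ?_⟩
  set b : ℕ → ℝ := fun n => zmul χ n * (n:ℝ) ^ (-σ) with hb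
  have hb0 : ∀ n, 0 ≤ b n := fun n => mul_nonneg (zmul_nonneg hχ n) (by positivity)
  have hbs := summable_zmul hχ h1
  have e1 : ∑ n ∈ S, zmul χ n ^ 2 * (n:ℝ) ^ (-σ) ≤
      ∑ n ∈ S, ∑ i ∈ n.divisorsAntidiagonal, b i.1 * b i.2 := by
    refine Finset.sum_le_sum fun n _ => ?_
    refine (mul_le_mul_of_nonneg_right (zmul_sq_le hχ n) (by positivity)).trans (le_of_eq ?_)
    rw [ArithmeticFunction.mul_apply, Finset.sum_mul]
    refine Finset.sum_congr rfl fun i hi => ?_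
    rw [← (Nat.mem_divisorsAntidiagonal.mp hi).1]
    push_cast
    rw [Real.mul_rpow (by positivity) (by positivity)]
    simp only [hb]; ring
  refine e1.trans ?_
  rw [Finset.sum_sigma']
  set P := S.sigma fun n => n.divisorsAntidiagonal
  have hinj : Set.InjOn (fun x : (_ : ℕ) × ℕ × ℕ => x.2) P := by
    rintro ⟨n, i⟩ hn ⟨m, j⟩ hm hij
    simp only at hij
    subst hij
    have h1 := (Nat.mem_divisorsAntidiagonal.mp (Finset.mem_sigma.mp hn).2).1
    have h2 := (Nat.mem_divisorsAntidiagonal.mp (Finset.mem_sigma.mp hm).2).1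
    simp only at h1 h2
    rw [← h1, ← h2]
  have e2 : ∑ x ∈ P, b x.2.1 * b x.2.2 = ∑ y ∈ P.image (fun x => x.2), b y.1 * b y.2 := by
    rw [Finset.sum_image hinj]
  rw [e2]
  set Q := P.image (fun x => x.2)
  have e3 : ∑ y ∈ Q, b y.1 * b y.2 ≤ ∑ y ∈ (Q.image Prod.fst) ×ˢ (Q.image Prod.snd), b y.1 * b y.2 :=
    Finset.sum_le_sum_of_subset_of_nonneg Finset.subset_product
      fun _ _ _ => mul_nonneg (hb0 _) (hb0 _)
  refine e3.trans ?_
  rw [Finset.sum_product]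
  simp_rw [← Finset.mul_sum]
  rw [← Finset.sum_mul]
  have e4 : ∀ S : Finset ℕ, ∑ i ∈ S, b i ≤ C / (σ - 1) := fun S =>
    (hbs.sum_le_tsum S fun i _ => hb0 i).trans (h σ h1 h2)
  calc _ ≤ C / (σ - 1) * (C / (σ - 1)) := mul_le_mul (e4 _) (e4 _) (Finset.sum_nonneg fun i _ => hb0 i)
        (div_nonneg hC.le (by linarith))
    _ = _ := by rw [div_mul_div_comm, sq, sq]

end coef
end MSW

namespace MSW

lemma sum_Ioc_dyadic {M : Type*} [AddCommMonoid M] (f : ℕ → M) (N J : ℕ) :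
    ∑ n ∈ Finset.Ioc N (N * 2 ^ J), f n =
      ∑ j ∈ Finset.range J, ∑ n ∈ Finset.Ioc (N * 2 ^ j) (N * 2 ^ (j + 1)), f n := by
  induction J with
  | zero => simp
  | succ J ih =>
    rw [Finset.sum_range_succ, ← ih, Finset.sum_Ioc_consecutive]
    · exact Nat.le_mul_of_pos_right _ (by positivity)
    · exact Nat.mul_le_mul_left _ (Nat.pow_le_pow_right (by norm_num) (by omega))

lemma sqrt_two_pow (j : ℕ) : Real.sqrt 2 ^ j = ((2:ℝ) ^ j) ^ (1/2:ℝ) := by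
  rw [Real.sqrt_eq_rpow, ← Real.rpow_natCast, ← Real.rpow_mul (by norm_num), ← Real.rpow_natCast,
    ← Real.rpow_mul (by norm_num), mul_comm]

lemma sum_inv_sqrt_two_pow_le (J : ℕ) : ∑ j ∈ Finset.range J, (Real.sqrt 2 ^ j)⁻¹ ≤ 4 := by
  have h1 : (4/3:ℝ) ≤ Real.sqrt 2 := Real.le_sqrt_of_sq_le (by norm_num)
  have h2 : (Real.sqrt 2)⁻¹ ≤ 3/4 := by
    rw [inv_le_comm₀ (by positivity) (by norm_num)]; linarith
  calc ∑ j ∈ Finset.range J, (Real.sqrt 2 ^ j)⁻¹ ≤ ∑ j ∈ Finset.range J, (3/4:ℝ) ^ j := by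
        refine Finset.sum_le_sum fun j _ => ?_
        rw [← inv_pow]
        exact pow_le_pow_left₀ (by positivity) h2 j
    _ ≤ ∑' j : ℕ, (3/4:ℝ) ^ j :=
        (summable_geometric_of_lt_one (by norm_num) (by norm_num)).sum_le_tsum _ fun _ _ => by positivity
    _ = 4 := by rw [tsum_geometric_of_lt_one (by norm_num) (by norm_num)]; norm_num

lemma continuous_dirichlet_sum (S : Finset ℕ) (hS : ∀ n ∈ S, 1 ≤ n) (y : ℕ → ℂ) :
    Continuous fun t : ℝ => ∑ n ∈ S, y n * (n:ℂ) ^ (-(t * I)) := by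
  refine continuous_finset_sum _ fun n hn => continuous_const.mul ?_
  have : (n:ℂ) ≠ 0 := by exact_mod_cast (by have := hS n hn; omega : n ≠ 0)
  exact Continuous.const_cpow (by fun_prop) (Or.inl this)

/-- Mean value of a long Dirichlet polynomial supported beyond the length of integration. -/
lemma mean_value_tail (y : ℕ → ℂ) (N J : ℕ) (hN : 1 ≤ N) (T t0 : ℝ) (hT : 0 < T) (hTN : T ≤ 2 * N) :
    ∫ t in (t0 - T)..(t0 + T), ‖∑ n ∈ Finset.Ioc N (N * 2 ^ J), y n * (n:ℂ) ^ (-(t * I))‖ ^ 2 ≤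
      3200 * N * ∑ n ∈ Finset.Ioc N (N * 2 ^ J), (n / N : ℝ) ^ (3/2:ℝ) * ‖y n‖ ^ 2 := by
  set r := Real.sqrt 2
  have hr : 0 < r := by positivity
  have hN0 : (0:ℝ) < N := by exact_mod_cast hN
  set B : ℕ → ℝ → ℂ := fun j t => ∑ n ∈ Finset.Ioc (N * 2 ^ j) (N * 2 ^ (j + 1)), y n * (n:ℂ) ^ (-(t * I))
  have hB : ∀ j, Continuous (B j) := fun j =>
    continuous_dirichlet_sum _ (fun n hn => by have := (Finset.mem_Ioc.mp hn).1; omega) y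
  have h1 : ∀ t : ℝ, ‖∑ n ∈ Finset.Ioc N (N * 2 ^ J), y n * (n:ℂ) ^ (-(t * I))‖ ^ 2 ≤
      4 * ∑ j ∈ Finset.range J, r ^ j * ‖B j t‖ ^ 2 := by
    intro t
    rw [sum_Ioc_dyadic]
    calc _ ≤ (∑ j ∈ Finset.range J, ‖B j t‖) ^ 2 := by
          gcongr; exact norm_sum_le _ _
      _ ≤ (∑ j ∈ Finset.range J, (r ^ j)⁻¹) * ∑ j ∈ Finset.range J, r ^ j * ‖B j t‖ ^ 2 := by
          refine Finset.sum_sq_le_sum_mul_sum_of_sq_le_mul _ (fun _ _ => by positivity)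
            (fun _ _ => by positivity) fun j _ => ?_
          rw [← mul_assoc, inv_mul_cancel₀ (by positivity), one_mul]
      _ ≤ _ := by
          gcongr
          exact sum_inv_sqrt_two_pow_le J
  have h2 : ∀ j, ∫ t in (t0 - T)..(t0 + T), ‖B j t‖ ^ 2 ≤
      200 * (T + N * 2 ^ (j + 1)) * ∑ n ∈ Finset.Ioc (N * 2 ^ j) (N * 2 ^ (j + 1)), ‖y n‖ ^ 2 := fun j =>
    mean_value_nat _ y _ T t0 hT fun n hn => by
      rw [Finset.mem_Ioc] at hn
      exact ⟨by omega, by exact_mod_cast hn.2⟩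
  have hle : t0 - T ≤ t0 + T := by linarith
  calc _ ≤ ∫ t in (t0 - T)..(t0 + T), 4 * ∑ j ∈ Finset.range J, r ^ j * ‖B j t‖ ^ 2 := by
        refine intervalIntegral.integral_mono_on hle ?_ ?_ fun t _ => h1 t
        · refine Continuous.intervalIntegrable ?_ _ _
          exact (continuous_dirichlet_sum _ (fun n hn => by
            have := (Finset.mem_Ioc.mp hn).1; omega) y).norm.pow 2
        · refine Continuous.intervalIntegrable ?_ _ _
          fun_prop
    _ = 4 * ∑ j ∈ Finset.range J, r ^ j * ∫ t in (t0 - T)..(t0 + T), ‖B j t‖ ^ 2 := by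
        rw [intervalIntegral.integral_const_mul, intervalIntegral.integral_finset_sum]
        · simp_rw [intervalIntegral.integral_const_mul]
        · intro j _
          refine Continuous.intervalIntegrable ?_ _ _
          fun_prop
    _ ≤ 4 * ∑ j ∈ Finset.range J, ∑ n ∈ Finset.Ioc (N * 2 ^ j) (N * 2 ^ (j + 1)),
          (800 * N) * ((n / N : ℝ) ^ (3/2:ℝ) * ‖y n‖ ^ 2) := by
        gcongr with j _
        refine (mul_le_mul_of_nonneg_left (h2 j) (by positivity)).trans ?_
        rw [← mul_assoc, Finset.mul_sum]
        refine Finset.sum_le_sum fun n hn => ?_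
        suffices h : r ^ j * (200 * (T + N * 2 ^ (j + 1))) ≤ 800 * N * (n / N : ℝ) ^ (3/2:ℝ) by
          have := mul_le_mul_of_nonneg_right h (sq_nonneg ‖y n‖)
          linarith
        have hn1 : (N * 2 ^ j : ℝ) ≤ n := by exact_mod_cast (Finset.mem_Ioc.mp hn).1.le
        have hn2 : (2:ℝ) ^ j ≤ n / N := by rw [le_div_iff₀ hN0]; linarith
        have e : ((2:ℝ) ^ j) ^ (3/2:ℝ) = r ^ j * (2:ℝ) ^ j := by
          rw [sqrt_two_pow, show (3/2:ℝ) = 1/2 + 1 by norm_num, Real.rpow_add (pow_pos two_pos j), Real.rpow_one]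
        have h3 : r ^ j * (2:ℝ) ^ j ≤ (n / N : ℝ) ^ (3/2:ℝ) := by
          rw [← e]; gcongr
        have h4 : (T + N * 2 ^ (j + 1)) ≤ 4 * N * 2 ^ j := by
          have : (1:ℝ) ≤ 2 ^ j := one_le_pow₀ (by norm_num)
          rw [pow_succ]; nlinarith
        calc r ^ j * (200 * (T + N * 2 ^ (j + 1))) ≤ r ^ j * (200 * (4 * N * 2 ^ j)) := by gcongr
          _ = 800 * N * (r ^ j * 2 ^ j) := by ring
          _ ≤ _ := by gcongr
    _ = _ := by
        rw [← sum_Ioc_dyadic, ← Finset.mul_sum]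
        ring
end MSW

namespace MSW
section mom
open DirichletCharacter
variable {q : ℕ} {χ : DirichletCharacter ℂ q}

/-- The partial sum of the Dirichlet series of `ζ(s) L(s, χ)`. -/
noncomputable def dpoly (χ : DirichletCharacter ℂ q) (N : ℕ) (s : ℂ) : ℂ :=
  ∑ n ∈ Finset.Icc 1 N, (zmul χ n : ℂ) * (n:ℂ) ^ (-s)

lemma dpoly_term (σ t : ℝ) {n : ℕ} (hn : 1 ≤ n) : (zmul χ n : ℂ) * (n:ℂ) ^ (-(σ + t * I)) =
    ((zmul χ n * (n:ℝ) ^ (-σ) : ℝ) : ℂ) * (n:ℂ) ^ (-(t * I)) := by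
  have : (n:ℂ) ≠ 0 := by exact_mod_cast (by omega : n ≠ 0)
  rw [neg_add, cpow_add _ _ this]
  push_cast
  rw [ofReal_cpow (by positivity)]
  push_cast
  ring

lemma dpoly_eq_range (N : ℕ) (s : ℂ) :
    dpoly χ N s = ∑ n ∈ Finset.range (N + 1), (zmul χ n : ℂ) * (n:ℂ) ^ (-s) := by
  rw [dpoly, Finset.range_eq_Ico, Finset.sum_eq_sum_Ico_succ_bot (by omega)]
  simp only [ArithmeticFunction.map_zero, ofReal_zero, zero_mul, zero_add]
  rfl

lemma differentiable_dpoly (N : ℕ) : Differentiable ℂ (dpoly χ N) := by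
  unfold dpoly
  refine Differentiable.fun_sum fun n hn => (differentiable_const _).mul ?_
  have : (n:ℂ) ≠ 0 := by exact_mod_cast (by have := (Finset.mem_Icc.mp hn).1; omega : n ≠ 0)
  exact (differentiable_id.neg).const_cpow (Or.inl this)

lemma rpow_inv_log_le {N n : ℕ} (hn : 1 ≤ n) (hN : 3 ≤ N) (h : n ≤ N) :
    (n:ℝ) ^ (1 / Real.log N) ≤ Real.exp 1 := by
  have hN' : (3:ℝ) ≤ N := by exact_mod_cast hN
  have hl : 0 < Real.log N := Real.log_pos (by linarith)
  rw [← rpow_inv_log (t := N) (by linarith)]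
  exact Real.rpow_le_rpow (by positivity) (by exact_mod_cast h) (by positivity)

lemma one_le_log {N : ℕ} (hN : 3 ≤ N) : 1 ≤ Real.log N := by
  have hN' : (3:ℝ) ≤ N := by exact_mod_cast hN
  rw [Real.le_log_iff_exp_le (by linarith)]
  linarith [Real.exp_one_lt_three]

variable [NeZero q]

lemma exists_sum_zmul_sq_div_le (hχ : χ ^ 2 = 1) (hχ1 : χ ≠ 1) : ∃ C : ℝ, 0 < C ∧ ∀ N : ℕ, 3 ≤ N →
    ∑ n ∈ Finset.Icc 1 N, zmul χ n ^ 2 * (n:ℝ) ^ (-1:ℝ) ≤ C * Real.log N ^ 2 := by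
  obtain ⟨C, hC, h⟩ := exists_sum_zmul_sq_le hχ hχ1
  refine ⟨Real.exp 1 * C, by positivity, fun N hN => ?_⟩
  have hl := one_le_log hN
  have hl' : 1 / Real.log N ≤ 1 := by rw [div_le_one (by linarith)]; exact hl
  have := h (1 + 1 / Real.log N) (by linarith [one_div_pos.mpr (by linarith : 0 < Real.log N)])
    (by linarith) (Finset.Icc 1 N)
  rw [add_sub_cancel_left, one_div, inv_pow, div_inv_eq_mul] at this
  rw [mul_assoc]
  refine le_trans ?_ (mul_le_mul_of_nonneg_left this (by positivity))
  rw [Finset.mul_sum]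
  refine Finset.sum_le_sum fun n hn => ?_
  rw [Finset.mem_Icc] at hn
  have hn0 : (0:ℝ) < n := by exact_mod_cast hn.1
  have e : (n:ℝ) ^ (-1:ℝ) = (n:ℝ) ^ (1 / Real.log N) * (n:ℝ) ^ (-(1 + (Real.log N)⁻¹)) := by
    rw [← Real.rpow_add hn0]; congr 1; ring
  rw [e, ← mul_assoc, ← mul_assoc, mul_comm (Real.exp 1)]
  gcongr
  exact rpow_inv_log_le hn.1 hN hn.2

lemma two_le_log {N : ℕ} (hN : 8 ≤ N) : 2 ≤ Real.log N := by
  have hN' : (8:ℝ) ≤ N := by exact_mod_cast hN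
  rw [Real.le_log_iff_exp_le (by linarith), show (2:ℝ) = 1 + 1 by norm_num, Real.exp_add]
  nlinarith [Real.exp_one_lt_d9, Real.exp_pos 1]

lemma exists_sum_zmul_sq_tail_le (hχ : χ ^ 2 = 1) (hχ1 : χ ≠ 1) : ∃ C : ℝ, 0 < C ∧ ∀ N J : ℕ, 8 ≤ N →
    ∑ n ∈ Finset.Ioc N (N * 2 ^ J), (n / N : ℝ) ^ (3/2:ℝ) * (zmul χ n * (n:ℝ) ^ (-(3/2):ℝ)) ^ 2 ≤
      C * Real.log N ^ 2 / N ^ 2 := by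
  obtain ⟨C, hC, h⟩ := exists_sum_zmul_sq_le hχ hχ1
  refine ⟨Real.exp 1 * C, by positivity, fun N J hN => ?_⟩
  have hl := one_le_log (by omega : 3 ≤ N)
  have hN0 : (0:ℝ) < N := by exact_mod_cast (by omega)
  have hl' : 1 / Real.log N ≤ 1 := by rw [div_le_one (by linarith)]; exact hl
  have := h (1 + 1 / Real.log N) (by linarith [one_div_pos.mpr (by linarith : 0 < Real.log N)])
    (by linarith) (Finset.Ioc N (N * 2 ^ J))
  rw [add_sub_cancel_left, one_div, inv_pow, div_inv_eq_mul] at this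
  rw [mul_assoc, mul_div_right_comm]
  refine le_trans ?_ (mul_le_mul_of_nonneg_left this (by positivity))
  rw [Finset.mul_sum]
  refine Finset.sum_le_sum fun n hn => ?_
  rw [Finset.mem_Ioc] at hn
  have hn0 : (0:ℝ) < n := by exact_mod_cast (by omega)
  have hNn : (N:ℝ) ≤ n := by exact_mod_cast hn.1.le
  set ε := 1 / Real.log N with hε
  have hε0 : 0 < ε := by positivity
  have e0 : (N:ℝ) ^ ε = Real.exp 1 := rpow_inv_log (by exact_mod_cast (by omega))
  rw [mul_pow, ← Real.rpow_natCast ((n:ℝ) ^ _), ← Real.rpow_mul hn0.le, Real.div_rpow hn0.le hN0.le]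
  have key : (n:ℝ) ^ (3/2:ℝ) / (N:ℝ) ^ (3/2:ℝ) * (n:ℝ) ^ (-(3/2) * (2:ℕ) : ℝ) ≤
      Real.exp 1 / N ^ 2 * (n:ℝ) ^ (-(1 + (Real.log N)⁻¹)) := by
    rw [div_mul_eq_mul_div, ← Real.rpow_add hn0, ← e0, ← Real.rpow_natCast (N:ℝ) 2, ← Real.rpow_sub hN0,
      div_eq_mul_inv, ← Real.rpow_neg hN0.le]
    rw [one_div] at hε
    rw [← hε]
    have h12 : ε ≤ 1/2 := by
      rw [hε, inv_le_comm₀ (by linarith) (by norm_num)]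
      have := two_le_log hN
      linarith
    have : (n:ℝ) ^ (ε - 1/2) ≤ (N:ℝ) ^ (ε - 1/2) :=
        Real.rpow_le_rpow_of_nonpos hN0 hNn (by linarith)
    calc _ = (n:ℝ) ^ (-(1 + ε)) * (N:ℝ) ^ (-(3/2):ℝ) * (n:ℝ) ^ (ε - 1/2) := by
            rw [mul_right_comm, ← Real.rpow_add hn0]; congr 2; push_cast; ring
        _ ≤ (n:ℝ) ^ (-(1 + ε)) * (N:ℝ) ^ (-(3/2):ℝ) * (N:ℝ) ^ (ε - 1/2) := by gcongr
        _ = _ := by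
            rw [mul_assoc, ← Real.rpow_add hN0, mul_comm]; congr 2; push_cast; ring
  calc _ = zmul χ n ^ 2 * ((n:ℝ) ^ (3/2:ℝ) / (N:ℝ) ^ (3/2:ℝ) * (n:ℝ) ^ (-(3/2) * (2:ℕ) : ℝ)) := by ring
    _ ≤ zmul χ n ^ 2 * (Real.exp 1 / N ^ 2 * (n:ℝ) ^ (-(1 + (Real.log N)⁻¹))) := by gcongr
    _ = _ := by ring

/-- The function `ζ(s) L(s, χ)`. -/
noncomputable def zl (χ : DirichletCharacter ℂ q) (s : ℂ) : ℂ :=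
  riemannZeta s * LFunction χ s

lemma exists_norm_zl_sub_dpoly_le (hχ : χ ^ 2 = 1) {σ : ℝ} (hσ : 1 < σ) {ε : ℝ} (hε : 0 < ε) :
    ∃ K : ℕ, ∀ k ≥ K, ∀ t : ℝ, ‖zl χ (σ + t * I) - dpoly χ k (σ + t * I)‖ ≤ ε := by
  have hs := summable_zmul hχ hσ
  have ht := tendsto_sum_nat_add fun n : ℕ => zmul χ n * (n:ℝ) ^ (-σ)
  obtain ⟨K, hK⟩ := eventually_atTop.mp (ht.eventually (eventually_le_nhds hε))
  refine ⟨K, fun k hk t => ?_⟩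
  have hn : ∀ n : ℕ, ‖LSeries.term χ.zetaMul (σ + t * I) n‖ = zmul χ n * (n:ℝ) ^ (-σ) := by
    intro n
    rw [← term_zetaMul_norm hχ σ]
    rcases eq_or_ne n 0 with rfl | hn
    · simp
    rw [LSeries.norm_term_eq, LSeries.norm_term_eq]
    simp
  have hsum : Summable (LSeries.term χ.zetaMul (σ + t * I)) :=
    (hs.congr fun n => (hn n).symm).of_norm
  have e : zl χ (σ + t * I) = ∑' n, LSeries.term χ.zetaMul (σ + t * I) n := by
    rw [zl, ← LSeries_zetaMul (by simpa using hσ), LSeries]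
  have e2 : dpoly χ k (σ + t * I) = ∑ n ∈ Finset.range (k + 1), LSeries.term χ.zetaMul (σ + t * I) n := by
    rw [dpoly_eq_range]
    refine Finset.sum_congr rfl fun n _ => ?_
    rcases eq_or_ne n 0 with rfl | hn
    · simp
    rw [LSeries.term_of_ne_zero hn, ofReal_zmul hχ, cpow_neg, div_eq_mul_inv]
  rw [e, e2, ← hsum.sum_add_tsum_nat_add (k + 1), add_sub_cancel_left]
  have hs2 : Summable fun n => zmul χ (n + (k + 1)) * ((n + (k + 1) : ℕ):ℝ) ^ (-σ) :=
    (summable_nat_add_iff (f := fun n : ℕ => zmul χ n * (n:ℝ) ^ (-σ)) (k + 1)).mpr hs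
  exact (tsum_of_norm_bounded hs2.hasSum fun n => (hn _).le).trans (hK (k + 1) (by omega))

lemma differentiableAt_zl (hχ1 : χ ≠ 1) {s : ℂ} (hs : s ≠ 1) : DifferentiableAt ℂ (zl χ) s :=
  (differentiableAt_riemannZeta hs).mul (differentiable_LFunction hχ1 s)

lemma continuous_zl_line (hχ1 : χ ≠ 1) {σ : ℝ} (hσ : σ ≠ 1) : Continuous fun t : ℝ => zl χ (σ + t * I) := by
  refine continuous_iff_continuousAt.mpr fun t => ?_
  have : (σ + t * I : ℂ) ≠ 1 := fun h => hσ (by simpa using congrArg re h)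
  exact ContinuousAt.comp (f := fun t : ℝ => (σ + t * I : ℂ)) (differentiableAt_zl hχ1 this).continuousAt
    (by fun_prop)

lemma exists_mean_value_zl_tail (hχ : χ ^ 2 = 1) (hχ1 : χ ≠ 1) : ∃ C : ℝ, 0 < C ∧ ∀ (N : ℕ) (T t0 : ℝ),
    8 ≤ N → 0 < T → T ≤ 2 * N → ∫ t in (t0 - T)..(t0 + T),
      ‖zl χ ((3/2:ℝ) + t * I) - dpoly χ N ((3/2:ℝ) + t * I)‖ ^ 2 ≤ C * Real.log N ^ 2 / N := by
  obtain ⟨C, hC, h⟩ := exists_sum_zmul_sq_tail_le hχ hχ1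
  refine ⟨6400 * C + 8, by positivity, fun N T t0 hN hT hTN => ?_⟩
  have hN0 : (0:ℝ) < N := by exact_mod_cast (by omega)
  obtain ⟨K, hK⟩ := exists_norm_zl_sub_dpoly_le hχ (σ := 3/2) (by norm_num) (ε := 1 / N) (by positivity)
  set y : ℕ → ℂ := fun n => ((zmul χ n * (n:ℝ) ^ (-(3/2):ℝ) : ℝ) : ℂ)
  have hKN : K ≤ N * 2 ^ K := Nat.lt_two_pow_self.le.trans (Nat.le_mul_of_pos_left _ (by omega))
  have e1 : ∀ t : ℝ, dpoly χ (N * 2 ^ K) ((3/2:ℝ) + t * I) - dpoly χ N ((3/2:ℝ) + t * I) =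
      ∑ n ∈ Finset.Ioc N (N * 2 ^ K), y n * (n:ℂ) ^ (-(t * I)) := by
    intro t
    have : ∀ M : ℕ, Finset.Icc 1 M = Finset.Ioc 0 M := fun M => rfl
    rw [dpoly, dpoly, this, this, ← Finset.sum_Ioc_consecutive _ (Nat.zero_le N)
      (Nat.le_mul_of_pos_right _ (by positivity)), add_sub_cancel_left]
    refine Finset.sum_congr rfl fun n hn => ?_
    exact dpoly_term _ _ (by have := (Finset.mem_Ioc.mp hn).1; omega)
  have hy : ∀ n, ‖y n‖ ^ 2 = (zmul χ n * (n:ℝ) ^ (-(3/2):ℝ)) ^ 2 := fun n => by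
    simp only [y]; rw [norm_real, Real.norm_eq_abs, sq_abs]
  have hmv := mean_value_tail y N K (by omega) T t0 hT hTN
  simp_rw [hy] at hmv
  have hcS := (continuous_dirichlet_sum (Finset.Ioc N (N * 2 ^ K)) (fun n hn => by
            have := (Finset.mem_Ioc.mp hn).1; omega) y)
  have hle : t0 - T ≤ t0 + T := by linarith
  have hb : ∀ t : ℝ, ‖zl χ ((3/2:ℝ) + t * I) - dpoly χ N ((3/2:ℝ) + t * I)‖ ^ 2 ≤
      2 * ‖∑ n ∈ Finset.Ioc N (N * 2 ^ K), y n * (n:ℂ) ^ (-(t * I))‖ ^ 2 + 2 * (1 / N) ^ 2 := by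
    intro t
    rw [← e1]
    have h1 := hK _ hKN t
    set u := dpoly χ (N * 2 ^ K) ((3/2:ℝ) + t * I)
    set v := dpoly χ N ((3/2:ℝ) + t * I)
    set w := zl χ ((3/2:ℝ) + t * I)
    have h2 : ‖w - v‖ ≤ ‖u - v‖ + ‖w - u‖ := by
      rw [show w - v = (u - v) + (w - u) by ring]
      exact norm_add_le _ _
    have h3 : ‖w - v‖ ^ 2 ≤ (‖u - v‖ + 1 / N) ^ 2 := by gcongr; linarith
    linarith [sq_nonneg (‖u - v‖ - 1 / N)]
  calc _ ≤ ∫ t in (t0 - T)..(t0 + T), (2 * ‖∑ n ∈ Finset.Ioc N (N * 2 ^ K), y n * (n:ℂ) ^ (-(t * I))‖ ^ 2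
          + 2 * (1 / N : ℝ) ^ 2) := by
        refine intervalIntegral.integral_mono_on hle ?_ ?_ fun t _ => hb t
        · refine Continuous.intervalIntegrable ?_ _ _
          exact (continuous_zl_line hχ1 (by norm_num)).sub
            ((differentiable_dpoly N).continuous.comp (by fun_prop)) |>.norm.pow 2
        · exact Continuous.intervalIntegrable (by fun_prop) _ _
    _ = 2 * (∫ t in (t0 - T)..(t0 + T), ‖∑ n ∈ Finset.Ioc N (N * 2 ^ K), y n * (n:ℂ) ^ (-(t * I))‖ ^ 2)
          + 4 * T * (1 / N) ^ 2 := by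
        rw [intervalIntegral.integral_add, intervalIntegral.integral_const_mul,
          intervalIntegral.integral_const, smul_eq_mul]
        · ring
        · exact Continuous.intervalIntegrable (by fun_prop) _ _
        · exact Continuous.intervalIntegrable (by fun_prop) _ _
    _ ≤ 2 * (3200 * N * (C * Real.log N ^ 2 / N ^ 2)) + 4 * (2 * N) * (1 / N) ^ 2 := by
        gcongr
        exact hmv.trans (mul_le_mul_of_nonneg_left (h N K hN) (by positivity))
    _ = (6400 * C * Real.log N ^ 2 + 8 * 1) / N := by field_simp; ring
    _ ≤ _ := by
        have := one_le_log (by omega : 3 ≤ N)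
        rw [add_mul]
        gcongr
        nlinarith

lemma exists_mean_value_dpoly (hχ : χ ^ 2 = 1) (hχ1 : χ ≠ 1) : ∃ C : ℝ, 0 < C ∧ ∀ (N : ℕ) (T t0 : ℝ),
    8 ≤ N → 0 < T → T ≤ 2 * N →
      ∫ t in (t0 - T)..(t0 + T), ‖dpoly χ N ((1/2:ℝ) + t * I)‖ ^ 2 ≤ C * N * Real.log N ^ 2 ∧
      ∫ t in (t0 - T)..(t0 + T), ‖dpoly χ N ((-1/2:ℝ) + t * I)‖ ^ 2 ≤ C * N ^ 3 * Real.log N ^ 2 := by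
  obtain ⟨C, hC, h⟩ := exists_sum_zmul_sq_div_le hχ hχ1
  refine ⟨600 * C, by positivity, fun N T t0 hN hT hTN => ?_⟩
  have hN0 : (0:ℝ) < N := by exact_mod_cast (by omega)
  have key : ∀ σ : ℝ, ∫ t in (t0 - T)..(t0 + T), ‖dpoly χ N (σ + t * I)‖ ^ 2 ≤
      600 * N * ∑ n ∈ Finset.Icc 1 N, zmul χ n ^ 2 * (n:ℝ) ^ (-2 * σ) := by
    intro σ
    have hmv := mean_value_nat (Finset.Icc 1 N) (fun n => ((zmul χ n * (n:ℝ) ^ (-σ) : ℝ) : ℂ)) N T t0 hT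
      fun n hn => ⟨(Finset.mem_Icc.mp hn).1, by exact_mod_cast (Finset.mem_Icc.mp hn).2⟩
    have e : ∀ t : ℝ, dpoly χ N (σ + t * I) =
        ∑ n ∈ Finset.Icc 1 N, ((zmul χ n * (n:ℝ) ^ (-σ) : ℝ) : ℂ) * (n:ℂ) ^ (-(t * I)) := fun t =>
      Finset.sum_congr rfl fun n hn => dpoly_term _ _ (Finset.mem_Icc.mp hn).1
    have e2 : ∑ n ∈ Finset.Icc 1 N, ‖((zmul χ n * (n:ℝ) ^ (-σ) : ℝ) : ℂ)‖ ^ 2 =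
        ∑ n ∈ Finset.Icc 1 N, zmul χ n ^ 2 * (n:ℝ) ^ (-2 * σ) := by
      refine Finset.sum_congr rfl fun n hn => ?_
      rw [norm_real, Real.norm_eq_abs, sq_abs, mul_pow, ← Real.rpow_natCast ((n:ℝ) ^ _),
        ← Real.rpow_mul (by positivity)]
      congr 2
      push_cast; ring
    simp_rw [e]
    refine hmv.trans ?_
    rw [e2]
    refine mul_le_mul_of_nonneg_right (by linarith) (Finset.sum_nonneg fun n _ => by positivity)
  constructor
  · refine (key _).trans ?_
    rw [show (-2 * (1/2) : ℝ) = -1 by norm_num]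
    calc _ ≤ 600 * N * (C * Real.log N ^ 2) := by gcongr; exact h N (by omega)
      _ = _ := by ring
  · refine (key _).trans ?_
    rw [show (-2 * (-1/2) : ℝ) = 1 by norm_num]
    calc _ ≤ 600 * N * (N ^ 2 * (C * Real.log N ^ 2)) := by
          gcongr
          refine le_trans ?_ (mul_le_mul_of_nonneg_left (h N (by omega)) (by positivity))
          rw [Finset.mul_sum]
          refine Finset.sum_le_sum fun n hn => ?_
          have hn0 : (0:ℝ) < n := by exact_mod_cast (Finset.mem_Icc.mp hn).1
          have hnN : (n:ℝ) ≤ N := by exact_mod_cast (Finset.mem_Icc.mp hn).2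
          have : (n:ℝ) ^ (1:ℝ) = n ^ 2 * (n:ℝ) ^ (-1:ℝ) := by
            rw [Real.rpow_one, Real.rpow_neg_one]; field_simp
          rw [this]
          calc _ = (n:ℝ) ^ 2 * (zmul χ n ^ 2 * (n:ℝ) ^ (-1:ℝ)) := by ring
            _ ≤ _ := by gcongr
      _ = _ := by ring
end mom
end MSW

namespace MSW

open MeasureTheory in
lemma integral_integral_gaussian_le (A : ℝ → ℝ) (a b c d : ℝ) (hab : a ≤ b) (hcd : c ≤ d)
    (hA : ContinuousOn A (Set.Icc c d)) (hA0 : ∀ t ∈ Set.Icc c d, 0 ≤ A t) :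
    ∫ τ in a..b, ∫ t in c..d, A t * Real.exp (-(t - τ) ^ 2) ≤ 2 * ∫ t in c..d, A t := by
  have hcont : ContinuousOn (Function.uncurry fun τ t => A t * Real.exp (-(t - τ) ^ 2))
      (Set.Icc a b ×ˢ Set.Icc c d) := by
    refine ContinuousOn.mul (hA.comp continuousOn_snd fun x hx => hx.2) ?_
    exact Continuous.continuousOn (by fun_prop)
  have hint : IntegrableOn (Function.uncurry fun τ t => A t * Real.exp (-(t - τ) ^ 2))
      (Set.uIoc a b ×ˢ Set.uIoc c d) := by
    rw [Set.uIoc_of_le hab, Set.uIoc_of_le hcd]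
    exact (hcont.integrableOn_compact (isCompact_Icc.prod isCompact_Icc)).mono_set
      (Set.prod_mono Set.Ioc_subset_Icc_self Set.Ioc_subset_Icc_self)
  rw [intervalIntegral_intervalIntegral_swap hint]
  simp_rw [intervalIntegral.integral_const_mul]
  rw [← intervalIntegral.integral_const_mul]
  have hg : ∀ t : ℝ, ∫ τ in a..b, Real.exp (-(t - τ) ^ 2) ≤ 2 := by
    intro t
    have hi : Integrable fun τ : ℝ => Real.exp (-(t - τ) ^ 2) := by
      have := (integrable_exp_neg_mul_sq (b := 1) one_pos).comp_sub_left t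
      simpa using this
    rw [intervalIntegral.integral_of_le hab]
    calc _ ≤ ∫ τ, Real.exp (-(t - τ) ^ 2) :=
          setIntegral_le_integral hi (Eventually.of_forall fun _ => (Real.exp_pos _).le)
      _ = ∫ τ, Real.exp (-1 * τ ^ 2) := by
          rw [← integral_sub_left_eq_self (fun τ => Real.exp (-1 * τ ^ 2)) volume t]
          simp
      _ = Real.sqrt Real.pi := by rw [integral_gaussian, div_one]
      _ ≤ 2 := by
          rw [Real.sqrt_le_left (by norm_num)]
          linarith [Real.pi_le_four]
  refine intervalIntegral.integral_mono_on hcd ?_ ?_ fun t ht => ?_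
  · refine ContinuousOn.intervalIntegrable ?_
    rw [Set.uIcc_of_le hcd]
    refine hA.mul (Continuous.continuousOn ?_)
    exact intervalIntegral.continuous_parametric_intervalIntegral_of_continuous' (by fun_prop) _ _
  · refine ContinuousOn.intervalIntegrable ?_
    rw [Set.uIcc_of_le hcd]
    fun_prop
  · rw [mul_comm]
    exact mul_le_mul_of_nonneg_right (hg t) (hA0 t ht)

lemma integral_sq_critical_le (G : ℂ → ℂ) (T M : ℝ) (hT : 2 ≤ T)
    (hG : ∀ s : ℂ, T / 2 ≤ s.im → DifferentiableAt ℂ G s)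
    (hM : ∀ s : ℂ, -1/2 ≤ s.re → s.re ≤ 3/2 → T / 2 ≤ s.im → s.im ≤ 5 * T / 2 → ‖G s‖ ≤ M) :
    ∫ τ in T..(2 * T), ‖G ((1/2:ℝ) + τ * I)‖ ^ 2 ≤
      6 * ((∫ t in (T/2)..(5*T/2), ‖G ((3/2:ℝ) + t * I)‖ ^ 2) +
        (∫ t in (T/2)..(5*T/2), ‖G ((-1/2:ℝ) + t * I)‖ ^ 2)) + T * (12 * M ^ 2 * Real.exp (-(T/2)^2)) := by
  have hline : ∀ σ : ℝ, ContinuousOn (fun t : ℝ => ‖G (σ + t * I)‖ ^ 2) (Set.Icc (T/2) (5*T/2)) := by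
    intro σ t ht
    have : ContinuousAt G (σ + t * I) := (hG _ (by simpa using ht.1)).continuousAt
    exact ((ContinuousAt.comp (f := fun t : ℝ => (σ + t * I : ℂ)) this
      (by fun_prop)).norm.pow 2).continuousWithinAt
  set A : ℝ → ℝ := fun t => ‖G ((3/2:ℝ) + t * I)‖ ^ 2 + ‖G ((-1/2:ℝ) + t * I)‖ ^ 2 with hAdef
  have hA : ContinuousOn A (Set.Icc (T/2) (5*T/2)) := (hline _).add (hline _)
  have hA0 : ∀ t, 0 ≤ A t := fun t => by positivity
  have hTT : T / 2 ≤ 5 * T / 2 := by linarith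
  have hpt : ∀ τ ∈ Set.Icc T (2 * T), ‖G ((1/2:ℝ) + τ * I)‖ ^ 2 ≤
      3 * (∫ t in (T/2)..(5*T/2), A t * Real.exp (-(t - τ) ^ 2)) + 12 * M ^ 2 * Real.exp (-(T/2)^2) := by
    intro τ hτ
    have h := sq_norm_le_edges G τ (T/2) M (by linarith)
      (fun s _ _ h3 => hG s (by linarith [(abs_le.mp h3).1, hτ.1]))
      (fun s h1 h2 h3 => hM s h1 h2 (by linarith [(abs_le.mp h3.le).1, hτ.1])
        (by linarith [(abs_le.mp h3.le).2, hτ.2]))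
    refine h.trans ?_
    have hsub : Set.uIcc (τ - T/2) (τ + T/2) ⊆ Set.Icc (T/2) (5*T/2) := by
      rw [Set.uIcc_of_le (by linarith)]
      exact Set.Icc_subset_Icc (by linarith [hτ.1]) (by linarith [hτ.2])
    have hcE : Continuous fun t : ℝ => Real.exp (-(t - τ) ^ 2) := by fun_prop
    rw [← intervalIntegral.integral_add]
    · gcongr
      calc _ = ∫ t in (τ - T/2)..(τ + T/2), A t * Real.exp (-(t - τ) ^ 2) := by
            simp only [hAdef, add_mul]
        _ ≤ _ := by
            refine intervalIntegral.integral_mono_interval (by linarith [hτ.1]) (by linarith)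
              (by linarith [hτ.2]) (Eventually.of_forall fun t => mul_nonneg (hA0 t) (Real.exp_pos _).le) ?_
            refine ContinuousOn.intervalIntegrable ?_
            rw [Set.uIcc_of_le hTT]
            exact hA.mul hcE.continuousOn
    · exact ContinuousOn.intervalIntegrable (((hline _).mono hsub).mul hcE.continuousOn)
    · exact ContinuousOn.intervalIntegrable (((hline _).mono hsub).mul hcE.continuousOn)
  have hcI : Continuous fun τ : ℝ => ∫ t in (T/2)..(5*T/2),
      (Set.IccExtend hTT (Set.restrict (Set.Icc (T/2) (5*T/2)) A) t) * Real.exp (-(t - τ) ^ 2) := by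
    have : Continuous (Set.IccExtend hTT (Set.restrict (Set.Icc (T/2) (5*T/2)) A)) :=
      (continuousOn_iff_continuous_restrict.mp hA).Icc_extend'
    exact intervalIntegral.continuous_parametric_intervalIntegral_of_continuous' (by fun_prop) _ _
  have hcI' : Continuous fun τ : ℝ => ∫ t in (T/2)..(5*T/2), A t * Real.exp (-(t - τ) ^ 2) := by
    refine hcI.congr fun τ => intervalIntegral.integral_congr fun t ht => ?_
    rw [Set.uIcc_of_le hTT] at ht
    simp only [Set.IccExtend_of_mem hTT _ ht]
    rfl
  calc _ ≤ ∫ τ in T..(2 * T), (3 * (∫ t in (T/2)..(5*T/2), A t * Real.exp (-(t - τ) ^ 2)) +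
          12 * M ^ 2 * Real.exp (-(T/2)^2)) := by
        refine intervalIntegral.integral_mono_on (by linarith) ?_ ?_ hpt
        · refine ContinuousOn.intervalIntegrable ((hline _).mono ?_)
          rw [Set.uIcc_of_le (by linarith)]
          exact Set.Icc_subset_Icc (by linarith) (by linarith)
        · exact Continuous.intervalIntegrable (by fun_prop) _ _
    _ = 3 * (∫ τ in T..(2 * T), ∫ t in (T/2)..(5*T/2), A t * Real.exp (-(t - τ) ^ 2)) +
          T * (12 * M ^ 2 * Real.exp (-(T/2)^2)) := by
        rw [intervalIntegral.integral_add (Continuous.intervalIntegrable (by fun_prop) _ _)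
          (Continuous.intervalIntegrable (by fun_prop) _ _), intervalIntegral.integral_const_mul,
          intervalIntegral.integral_const, smul_eq_mul]
        ring
    _ ≤ 3 * (2 * ∫ t in (T/2)..(5*T/2), A t) + T * (12 * M ^ 2 * Real.exp (-(T/2)^2)) := by
        gcongr
        exact integral_integral_gaussian_le A _ _ _ _ (by linarith) hTT hA fun t _ => hA0 t
    _ = _ := by
        rw [intervalIntegral.integral_add]
        · ring
        all_goals
          refine ContinuousOn.intervalIntegrable ?_
          rw [Set.uIcc_of_le hTT]
          exact hline _
end MSW

namespace MSW
section mom4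
open DirichletCharacter
variable {q : ℕ} [NeZero q] {χ : DirichletCharacter ℂ q}

lemma exists_zl_feFactor (hχp : χ.IsPrimitive) (hχ : χ ^ 2 = 1) :
    ∃ X C, FEFactor (zl χ) X 2 C 8 := by
  have h1 : (1 : DirichletCharacter ℂ 1).IsPrimitive := by
    rw [isPrimitive_def, conductor_one]
  obtain ⟨X, C, h⟩ := exists_feFactor h1 (by simp)
  obtain ⟨X', C', h'⟩ := exists_feFactor hχp (by rw [inv_eq_iff_mul_eq_one, ← sq, hχ])
  have := h.mul h'
  simp only [LFunction_modOne_eq] at this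
  exact ⟨fun s => X s * X' s, C * C', by
    rw [show (8:ℝ) = 4 + 4 by norm_num]; exact this⟩

lemma exists_norm_zl_strip_le (hχp : χ.IsPrimitive) (hχ : χ ^ 2 = 1) : ∃ C : ℝ, 0 < C ∧ ∀ s : ℂ,
    -1/2 ≤ s.re → s.re ≤ 3/2 → 1 ≤ |s.im| → ‖zl χ s‖ ≤ C * (Real.exp (8 * |s.im|) * |s.im| ^ 2) := by
  obtain ⟨C1, hC1, h1⟩ := norm_LFunction_le_im (1 : DirichletCharacter ℂ 1)
  obtain ⟨C2, hC2, h2⟩ := norm_LFunction_le_im χ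
  obtain ⟨X, C, hX⟩ := exists_zl_feFactor hχp hχ
  have hr : ∀ s : ℂ, 1/2 ≤ s.re → s.re ≤ 2 → 1 ≤ |s.im| → ‖zl χ s‖ ≤ C1 * C2 * |s.im| ^ 2 := by
    intro s a b c
    have := h1 s a b c
    rw [LFunction_modOne_eq] at this
    rw [zl, norm_mul]
    calc _ ≤ (C1 * |s.im|) * (C2 * |s.im|) := mul_le_mul this (h2 s a b c) (norm_nonneg _) (by positivity)
      _ = _ := by ring
  have hC := hX.pos
  refine ⟨C1 * C2 * (C + 1), by positivity, fun s a b c => ?_⟩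
  have he : 1 ≤ Real.exp (8 * |s.im|) := Real.one_le_exp (by positivity)
  rcases le_total (1/2) s.re with h | h
  · calc _ ≤ C1 * C2 * 1 * (1 * |s.im| ^ 2) := by simpa using hr s h (by linarith) c
      _ ≤ _ := by gcongr; linarith
  · have hs : s.im ≠ 0 := by intro h; rw [h] at c; norm_num at c
    have := hr (1 - s) (by simp; linarith) (by simp; linarith) (by simpa using c)
    simp only [sub_im, one_im, zero_sub, abs_neg] at this
    rw [hX.eq s hs, norm_mul]
    calc _ ≤ (C * Real.exp (8 * |s.im|)) * (C1 * C2 * |s.im| ^ 2) :=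
          mul_le_mul (hX.strip s a b c) this (norm_nonneg _) (by positivity)
      _ = C1 * C2 * C * (Real.exp (8 * |s.im|) * |s.im| ^ 2) := by ring
      _ ≤ _ := by gcongr; linarith

lemma norm_dpoly_le (hχ : χ ^ 2 = 1) (N : ℕ) {s : ℂ} (hs : -1/2 ≤ s.re) : ‖dpoly χ N s‖ ≤ (N:ℝ) ^ 3 := by
  calc _ ≤ ∑ n ∈ Finset.Icc 1 N, ‖(zmul χ n : ℂ) * (n:ℂ) ^ (-s)‖ := norm_sum_le _ _
    _ ≤ ∑ n ∈ Finset.Icc 1 N, (N:ℝ) ^ 2 := by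
        refine Finset.sum_le_sum fun n hn => ?_
        rw [Finset.mem_Icc] at hn
        have hn1 : (1:ℝ) ≤ n := by exact_mod_cast hn.1
        have hnN : (n:ℝ) ≤ N := by exact_mod_cast hn.2
        rw [norm_mul, norm_natCast_cpow_of_pos (by omega), norm_real,
          Real.norm_of_nonneg (zmul_nonneg hχ n)]
        have : (n:ℝ) ^ (-s).re ≤ n := by
          nth_rewrite 2 [← Real.rpow_one (n:ℝ)]
          exact Real.rpow_le_rpow_of_exponent_le hn1 (by rw [neg_re]; linarith)
        calc _ ≤ (n:ℝ) * n := mul_le_mul (zmul_le hχ n) this (by positivity) (by positivity)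
          _ ≤ (N:ℝ) ^ 2 := by rw [sq]; gcongr
    _ = _ := by simp; ring

lemma norm_sub_sq_le (a b : ℂ) : ‖a - b‖ ^ 2 ≤ 2 * ‖a‖ ^ 2 + 2 * ‖b‖ ^ 2 := by
  have := norm_sub_le a b
  have : ‖a - b‖ ^ 2 ≤ (‖a‖ + ‖b‖) ^ 2 := by gcongr
  linarith [sq_nonneg (‖a‖ - ‖b‖)]

/-- The error of the approximate functional equation of length `N`, balanced by `T ^ (s - 1/2)`. -/
noncomputable def afe (χ : DirichletCharacter ℂ q) (X : ℂ → ℂ) (N : ℕ) (T : ℝ) (s : ℂ) : ℂ :=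
  (zl χ s - dpoly χ N s - X s * dpoly χ N (1 - s)) * (T:ℂ) ^ (s - 1/2)

lemma norm_afe {X : ℂ → ℂ} {N : ℕ} {T : ℝ} (hT : 0 < T) (σ t : ℝ) : ‖afe χ X N T (σ + t * I)‖ ^ 2 =
    ‖zl χ (σ + t * I) - dpoly χ N (σ + t * I) - X (σ + t * I) * dpoly χ N (1 - (σ + t * I))‖ ^ 2 *
      (T ^ (σ - 1/2)) ^ 2 := by
  rw [afe, norm_mul, mul_pow, norm_cpow_eq_rpow_re_of_pos hT]
  simp

lemma exists_afe_le (hχp : χ.IsPrimitive) (hχ : χ ^ 2 = 1) {X : ℂ → ℂ} {C : ℝ}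
    (hX : FEFactor (zl χ) X 2 C 8) : ∃ K : ℝ, 0 < K ∧ ∀ (N : ℕ) (T : ℝ), 2 ≤ T → (N:ℝ) ≤ T →
    ∀ s : ℂ, -1/2 ≤ s.re → s.re ≤ 3/2 → T / 2 ≤ s.im → s.im ≤ 5 * T / 2 →
      ‖afe χ X N T s‖ ≤ K * Real.exp (21 * T) := by
  obtain ⟨C2, hC2, h2⟩ := exists_norm_zl_strip_le hχp hχ
  have hC := hX.pos
  refine ⟨24 * (7 * C2 + 1 + C), by positivity, fun N T hT hNT s ha hb hc hd => ?_⟩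
  have him : |s.im| = s.im := abs_of_nonneg (by linarith)
  have h1 : 1 ≤ |s.im| := by rw [him]; linarith
  have e1 : Real.exp (8 * |s.im|) ≤ Real.exp (20 * T) := Real.exp_le_exp.mpr (by rw [him]; linarith)
  have e2 : 1 ≤ Real.exp (20 * T) := Real.one_le_exp (by linarith)
  have hz : ‖zl χ s‖ ≤ 7 * C2 * (Real.exp (20 * T) * T ^ 3) := by
    refine (h2 s ha hb h1).trans ?_
    have : |s.im| ^ 2 ≤ 7 * T ^ 3 := by
      rw [him]
      have : s.im ^ 2 ≤ (5 * T / 2) ^ 2 := by gcongr; linarith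
      nlinarith [mul_nonneg (sq_nonneg T) (by linarith : 0 ≤ T - 1)]
    calc _ ≤ C2 * (Real.exp (20 * T) * (7 * T ^ 3)) := by gcongr
      _ = _ := by ring
  have hNN : (N:ℝ) ^ 3 ≤ T ^ 3 := by gcongr
  have hd1 : ‖dpoly χ N s‖ ≤ 1 * (Real.exp (20 * T) * T ^ 3) := by
    refine (norm_dpoly_le hχ N ha).trans (hNN.trans ?_)
    rw [one_mul]
    exact le_mul_of_one_le_left (by positivity) e2
  have hd2 : ‖X s * dpoly χ N (1 - s)‖ ≤ C * (Real.exp (20 * T) * T ^ 3) := by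
    rw [norm_mul, ← mul_assoc]
    exact mul_le_mul ((hX.strip s ha hb h1).trans (by gcongr))
      ((norm_dpoly_le hχ N (by simp; linarith)).trans hNN) (norm_nonneg _) (by positivity)
  have hT1 : ‖(T:ℂ) ^ (s - 1/2)‖ ≤ T := by
    rw [norm_cpow_eq_rpow_re_of_pos (by linarith)]
    nth_rewrite 2 [← Real.rpow_one T]
    exact Real.rpow_le_rpow_of_exponent_le (by linarith) (by simp; linarith)
  have hexp : T ^ 4 ≤ 24 * Real.exp T := by
    have := Real.pow_div_factorial_le_exp T (by linarith) 4
    rw [div_le_iff₀ (by positivity)] at this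
    norm_num [Nat.factorial] at this
    linarith
  rw [afe, norm_mul]
  calc _ ≤ ((7 * C2 + 1 + C) * (Real.exp (20 * T) * T ^ 3)) * T := by
        refine mul_le_mul ?_ hT1 (norm_nonneg _) (by positivity)
        refine (norm_sub_le _ _).trans ((add_le_add (norm_sub_le _ _) le_rfl).trans ?_)
        rw [add_mul, add_mul]
        gcongr
    _ = (7 * C2 + 1 + C) * Real.exp (20 * T) * T ^ 4 := by ring
    _ ≤ (7 * C2 + 1 + C) * Real.exp (20 * T) * (24 * Real.exp T) := by gcongr
    _ = _ := by
        rw [show 21 * T = 20 * T + T by ring, Real.exp_add]; ring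

lemma differentiableAt_afe (hχ1 : χ ≠ 1) {X : ℂ → ℂ} {C : ℝ} (hX : FEFactor (zl χ) X 2 C 8) (N : ℕ) {T : ℝ}
    (hT : 0 < T) {s : ℂ} (hs : s.im ≠ 0) : DifferentiableAt ℂ (afe χ X N T) s := by
  have hs1 : s ≠ 1 := by rintro rfl; simp at hs
  have hT' : (T:ℂ) ≠ 0 := by exact_mod_cast hT.ne'
  unfold afe
  refine DifferentiableAt.mul (((differentiableAt_zl hχ1 hs1).sub (differentiable_dpoly N s)).sub
    ((hX.diff s hs).mul ?_)) ?_
  · exact (differentiable_dpoly N).differentiableAt.comp s (by fun_prop)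
  · exact DifferentiableAt.const_cpow (by fun_prop) (Or.inl hT')

lemma continuousOn_line {G : ℂ → ℂ} {a b : ℝ} (σ : ℝ)
    (h : ∀ t ∈ Set.Icc a b, DifferentiableAt ℂ G (σ + t * I)) :
    ContinuousOn (fun t : ℝ => ‖G (σ + t * I)‖ ^ 2) (Set.Icc a b) := fun t ht =>
  ((ContinuousAt.comp (f := fun t : ℝ => (σ + t * I : ℂ)) (h t ht).continuousAt
      (by fun_prop)).norm.pow 2).continuousWithinAt

lemma intervalIntegrable_line {G : ℂ → ℂ} {a b : ℝ} (hab : a ≤ b) (σ : ℝ)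
    (h : ∀ t ∈ Set.Icc a b, DifferentiableAt ℂ G (σ + t * I)) :
    IntervalIntegrable (fun t : ℝ => ‖G (σ + t * I)‖ ^ 2) MeasureTheory.volume a b := by
  refine ContinuousOn.intervalIntegrable ?_
  rw [Set.uIcc_of_le hab]
  exact continuousOn_line σ h

lemma integral_edge_le {G U V : ℂ → ℂ} {a b A B u v : ℝ} (hab : a ≤ b) {σ σ1 σ2 : ℝ}
    (hG : ∀ t ∈ Set.Icc a b, DifferentiableAt ℂ G (σ + t * I))
    (hU : Continuous fun t : ℝ => U (σ1 + t * I)) (hV : Continuous fun t : ℝ => V (σ2 + t * I))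
    (hu : 0 ≤ u) (hv : 0 ≤ v)
    (h : ∀ t ∈ Set.Icc a b, ‖G (σ + t * I)‖ ^ 2 ≤ u * ‖U (σ1 + t * I)‖ ^ 2 + v * ‖V (σ2 + (-t : ℝ) * I)‖ ^ 2)
    (hA : ∫ t in a..b, ‖U (σ1 + t * I)‖ ^ 2 ≤ A) (hB : ∫ t in (-b)..(-a), ‖V (σ2 + t * I)‖ ^ 2 ≤ B) :
    ∫ t in a..b, ‖G (σ + t * I)‖ ^ 2 ≤ u * A + v * B := by
  have hV' : Continuous fun t : ℝ => V (σ2 + (-t : ℝ) * I) := hV.comp continuous_neg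
  have hcU : Continuous fun t : ℝ => u * ‖U (σ1 + t * I)‖ ^ 2 := continuous_const.mul (hU.norm.pow 2)
  have hcV : Continuous fun t : ℝ => v * ‖V (σ2 + (-t : ℝ) * I)‖ ^ 2 := continuous_const.mul (hV'.norm.pow 2)
  calc _ ≤ ∫ t in a..b, (u * ‖U (σ1 + t * I)‖ ^ 2 + v * ‖V (σ2 + (-t : ℝ) * I)‖ ^ 2) :=
        intervalIntegral.integral_mono_on hab (intervalIntegrable_line hab σ hG)
          ((hcU.add hcV).intervalIntegrable _ _) h
    _ = u * (∫ t in a..b, ‖U (σ1 + t * I)‖ ^ 2) + v * ∫ t in (-b)..(-a), ‖V (σ2 + t * I)‖ ^ 2 := by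
        rw [intervalIntegral.integral_add (hcU.intervalIntegrable _ _) (hcV.intervalIntegrable _ _),
          intervalIntegral.integral_const_mul, intervalIntegral.integral_const_mul,
          intervalIntegral.integral_comp_neg fun t : ℝ => ‖V (σ2 + t * I)‖ ^ 2]
    _ ≤ _ := by gcongr

end mom4
end MSW

namespace MSW
section mom5
open DirichletCharacter
variable {q : ℕ} [NeZero q] {χ : DirichletCharacter ℂ q}

lemma exists_edges_le (hχ1 : χ ≠ 1) (hχ : χ ^ 2 = 1) {X : ℂ → ℂ} {C : ℝ}
    (hX : FEFactor (zl χ) X 2 C 8) : ∃ K : ℝ, 0 < K ∧ ∀ (N : ℕ) (T : ℝ), 8 ≤ N → (N:ℝ) ≤ T → T ≤ 2 * N →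
      ∫ t in (T/2)..(5*T/2), ‖afe χ X N T ((3/2:ℝ) + t * I)‖ ^ 2 ≤ K * (T * Real.log T ^ 2) ∧
      ∫ t in (T/2)..(5*T/2), ‖afe χ X N T ((-1/2:ℝ) + t * I)‖ ^ 2 ≤ K * (T * Real.log T ^ 2) := by
  obtain ⟨C1, hC1, h1⟩ := exists_mean_value_zl_tail hχ hχ1
  obtain ⟨C2, hC2, h2⟩ := exists_mean_value_dpoly hχ hχ1
  have hC := hX.pos
  refine ⟨4 * C1 + 32 * C ^ 2 * C2 + (2 * C2 + 196 * C ^ 2 * C1), by positivity, fun N T hN hNT hTN => ?_⟩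
  have hN0 : (8:ℝ) ≤ N := by exact_mod_cast hN
  have hT : 0 < T := by linarith
  have hl : Real.log N ^ 2 ≤ Real.log T ^ 2 := by
    have : 0 ≤ Real.log N := Real.log_nonneg (by linarith)
    gcongr
  have hTT : T / 2 ≤ 5 * T / 2 := by linarith
  have hdiff : ∀ σ : ℝ, ∀ t ∈ Set.Icc (T/2) (5*T/2), DifferentiableAt ℂ (afe χ X N T) (σ + t * I) :=
    fun σ t ht => differentiableAt_afe hχ1 hX N hT (by simp; linarith [ht.1])
  have hcd : ∀ σ : ℝ, Continuous fun t : ℝ => dpoly χ N (σ + t * I) := fun σ =>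
    (differentiable_dpoly N).continuous.comp (by fun_prop)
  have hct : Continuous fun t : ℝ => zl χ ((3/2:ℝ) + t * I) - dpoly χ N ((3/2:ℝ) + t * I) :=
    (continuous_zl_line hχ1 (by norm_num)).sub (hcd _)
  have a1 := h1 N T (3*T/2) hN hT hTN
  have a2 := h1 N T (-(3*T/2)) hN hT hTN
  have b1 := (h2 N T (3*T/2) hN hT hTN).2
  have b2 := (h2 N T (-(3*T/2)) hN hT hTN).2
  have e1 : 3*T/2 - T = T/2 := by ring
  have e2 : 3*T/2 + T = 5*T/2 := by ring
  have e3 : -(3*T/2) - T = -(5*T/2) := by ring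
  have e4 : -(3*T/2) + T = -(T/2) := by ring
  rw [e1, e2] at a1 b1
  rw [e3, e4] at a2 b2
  have i1 : C1 * Real.log N ^ 2 / N ≤ 2 * C1 * Real.log T ^ 2 / T := by
    rw [div_le_div_iff₀ (by linarith) hT]
    calc _ ≤ C1 * Real.log T ^ 2 * (2 * N) := by gcongr
      _ = _ := by ring
  have i2 : C2 * N ^ 3 * Real.log N ^ 2 ≤ C2 * T ^ 3 * Real.log T ^ 2 := by gcongr
  have hTl : 0 ≤ T * Real.log T ^ 2 := by positivity
  constructor
  · refine (integral_edge_le (U := fun s => zl χ s - dpoly χ N s) (V := dpoly χ N) (u := 2 * T ^ 2)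
      (v := 32 * C ^ 2 / T ^ 2) (σ1 := 3/2) (σ2 := -1/2) hTT (hdiff _) hct (hcd _) (by positivity) (by positivity) ?_
        (a1.trans i1) (b2.trans i2)).trans ?_
    · intro t ht
      rw [norm_afe hT]
      have hx := hX.right t (by linarith [ht.1])
      have hx2 : ‖X ((3/2:ℝ) + t * I)‖ ≤ 4 * C / T ^ 2 := by
        refine hx.trans ?_
        rw [← div_eq_mul_inv, div_le_div_iff₀ (pow_pos (by linarith [ht.1]) 2) (by positivity)]
        have : (T/2) ^ 2 ≤ t ^ 2 := by gcongr; exact ht.1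
        nlinarith
      have ec : (1 - ((3/2:ℝ) + t * I) : ℂ) = (-1/2:ℝ) + (-t:ℝ) * I := by push_cast; ring
      have et : (T ^ (3/2 - 1/2 : ℝ)) ^ 2 = T ^ 2 := by norm_num
      rw [ec, et]
      refine (mul_le_mul_of_nonneg_right (norm_sub_sq_le _ _) (sq_nonneg T)).trans ?_
      rw [norm_mul, mul_pow]
      set d := ‖dpoly χ N ((-1/2:ℝ) + (-t:ℝ) * I)‖ ^ 2
      calc _ = 2 * T ^ 2 * ‖zl χ ((3/2:ℝ) + t * I) - dpoly χ N ((3/2:ℝ) + t * I)‖ ^ 2 +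
            2 * T ^ 2 * d * ‖X ((3/2:ℝ) + t * I)‖ ^ 2 := by ring
        _ ≤ 2 * T ^ 2 * ‖zl χ ((3/2:ℝ) + t * I) - dpoly χ N ((3/2:ℝ) + t * I)‖ ^ 2 +
            2 * T ^ 2 * d * (4 * C / T ^ 2) ^ 2 := by gcongr
        _ = _ := by congr 1; field_simp; ring
    · calc _ = (4 * C1 + 32 * C ^ 2 * C2) * (T * Real.log T ^ 2) := by field_simp; ring
        _ ≤ _ := mul_le_mul_of_nonneg_right (by linarith [show 0 ≤ 2 * C2 + 196 * C ^ 2 * C1 by positivity]) hTl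
  · refine (integral_edge_le (V := fun s => zl χ s - dpoly χ N s) (U := dpoly χ N) (u := 2 / T ^ 2)
      (v := 98 * C ^ 2 * T ^ 2) (σ1 := -1/2) (σ2 := 3/2) hTT (hdiff _) (hcd _) hct (by positivity) (by positivity) ?_
        (b1.trans i2) (a2.trans i1)).trans ?_
    · intro t ht
      rw [norm_afe hT]
      have hx := hX.left t (by linarith [ht.1])
      have hx2 : ‖X ((-1/2:ℝ) + t * I)‖ ≤ 7 * C * T ^ 2 := by
        refine hx.trans ?_
        have : t ^ 2 ≤ (5*T/2) ^ 2 := by gcongr; exacts [by linarith [ht.1], ht.2]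
        nlinarith [mul_pos hC (by positivity : 0 < T ^ 2)]
      have ec : (1 - ((-1/2:ℝ) + t * I) : ℂ) = (3/2:ℝ) + (-t:ℝ) * I := by push_cast; ring
      have et : (T ^ (-1/2 - 1/2 : ℝ)) ^ 2 = 1 / T ^ 2 := by
        rw [show (-1/2 - 1/2 : ℝ) = -1 by norm_num, Real.rpow_neg_one]; field_simp
      have hfe : zl χ ((-1/2:ℝ) + t * I) = X ((-1/2:ℝ) + t * I) * zl χ (1 - ((-1/2:ℝ) + t * I)) :=
        hX.eq _ (by simp; linarith [ht.1])
      rw [hfe, ec, et]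
      set x := X ((-1/2:ℝ) + t * I)
      set z := zl χ ((3/2:ℝ) + (-t:ℝ) * I)
      set d := dpoly χ N ((3/2:ℝ) + (-t:ℝ) * I)
      set w := dpoly χ N ((-1/2:ℝ) + t * I)
      rw [show x * z - w - x * d = x * (z - d) - w by ring]
      refine (mul_le_mul_of_nonneg_right (norm_sub_sq_le _ _) (by positivity)).trans ?_
      rw [norm_mul, mul_pow]
      calc _ = 2 / T ^ 2 * ‖w‖ ^ 2 + 2 / T ^ 2 * ‖z - d‖ ^ 2 * ‖x‖ ^ 2 := by field_simp; ring
        _ ≤ 2 / T ^ 2 * ‖w‖ ^ 2 + 2 / T ^ 2 * ‖z - d‖ ^ 2 * (7 * C * T ^ 2) ^ 2 := by gcongr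
        _ = _ := by congr 1; field_simp; ring
    · calc _ = (2 * C2 + 196 * C ^ 2 * C1) * (T * Real.log T ^ 2) := by field_simp; ring
        _ ≤ _ := mul_le_mul_of_nonneg_right (by linarith [show 0 ≤ 4 * C1 + 32 * C ^ 2 * C2 by positivity]) hTl

/-- The mean square of `ζ(s) L(s, χ)` on the critical line. -/
theorem exists_integral_zl_sq_le (hχp : χ.IsPrimitive) (hχ1 : χ ≠ 1) (hχ : χ ^ 2 = 1) :
    ∃ C T0 : ℝ, 0 < C ∧ ∀ T ≥ T0,
      ∫ t in T..(2 * T), ‖zl χ ((1/2:ℝ) + t * I)‖ ^ 2 ≤ C * (T * Real.log T ^ 2) := by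
  obtain ⟨X, C, hX⟩ := exists_zl_feFactor hχp hχ
  obtain ⟨K, hK, hedge⟩ := exists_edges_le hχ1 hχ hX
  obtain ⟨M, hM, hmax⟩ := exists_afe_le hχp hχ hX
  obtain ⟨C2, hC2, h2⟩ := exists_mean_value_dpoly hχ hχ1
  have hC := hX.pos
  refine ⟨3 * (12 * K + 12 * M ^ 2) + 3 * C2 + 3 * C ^ 2 * C2, 200, by positivity, fun T hT => ?_⟩
  set N := ⌊T⌋₊
  have hNT : (N:ℝ) ≤ T := Nat.floor_le (by linarith)
  have hTN' : T < N + 1 := Nat.lt_floor_add_one T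
  have hN : 8 ≤ N := Nat.le_floor (by push_cast; linarith)
  have hTN : T ≤ 2 * N := by linarith
  have hT0 : 0 < T := by linarith
  have hl1 : 1 ≤ Real.log T := by
    rw [Real.le_log_iff_exp_le hT0]; linarith [Real.exp_one_lt_three]
  have hl : Real.log N ^ 2 ≤ Real.log T ^ 2 := by
    have : 0 ≤ Real.log N := Real.log_nonneg (by linarith)
    gcongr
  obtain ⟨g1, g2⟩ := hedge N T hN hNT hTN
  have g3 := integral_sq_critical_le (afe χ X N T) T (M * Real.exp (21 * T)) (by linarith)
    (fun s hs => differentiableAt_afe hχ1 hX N hT0 (by linarith))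
    (hmax N T (by linarith) hNT)
  have g4 : 12 * (M * Real.exp (21 * T)) ^ 2 * Real.exp (-(T/2) ^ 2) ≤ 12 * M ^ 2 * 1 := by
    rw [mul_pow, ← Real.exp_nat_mul, mul_assoc, mul_assoc, mul_assoc, ← Real.exp_add]
    gcongr
    rw [Real.exp_le_one_iff]
    push_cast; nlinarith
  have g5 : ∫ τ in T..(2 * T), ‖afe χ X N T ((1/2:ℝ) + τ * I)‖ ^ 2 ≤
      (12 * K + 12 * M ^ 2) * (T * Real.log T ^ 2) := by
    have : T * (12 * (M * Real.exp (21 * T)) ^ 2 * Real.exp (-(T/2) ^ 2)) ≤ 12 * M ^ 2 * (T * Real.log T ^ 2) := by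
      calc _ ≤ T * (12 * M ^ 2 * 1) := by gcongr
        _ = 12 * M ^ 2 * (T * 1) := by ring
        _ ≤ _ := by gcongr; exact one_le_pow₀ hl1
    linarith
  have hcd : ∀ σ : ℝ, Continuous fun t : ℝ => dpoly χ N (σ + t * I) := fun σ =>
    (differentiable_dpoly N).continuous.comp (by fun_prop)
  have b1 := (h2 N T (3*T/2) hN hT0 hTN).1
  have b2 := (h2 N T (-(3*T/2)) hN hT0 hTN).1
  have i2 : C2 * N * Real.log N ^ 2 ≤ C2 * (T * Real.log T ^ 2) := by rw [← mul_assoc]; gcongr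
  have c1 : ∫ t in T..(2 * T), ‖dpoly χ N ((1/2:ℝ) + t * I)‖ ^ 2 ≤ C2 * (T * Real.log T ^ 2) :=
    (intervalIntegral.integral_mono_interval (by linarith) (by linarith) (by linarith)
      (Eventually.of_forall fun t => sq_nonneg _) (((hcd _).norm.pow 2).intervalIntegrable _ _)).trans
      (b1.trans i2)
  have c2 : ∫ t in (-(2 * T))..(-T), ‖dpoly χ N ((1/2:ℝ) + t * I)‖ ^ 2 ≤ C2 * (T * Real.log T ^ 2) :=
    (intervalIntegral.integral_mono_interval (by linarith) (by linarith) (by linarith)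
      (Eventually.of_forall fun t => sq_nonneg _) (((hcd _).norm.pow 2).intervalIntegrable _ _)).trans
      (b2.trans i2)
  have hzd : ∀ t ∈ Set.Icc T (2 * T), DifferentiableAt ℂ (zl χ) ((1/2:ℝ) + t * I) := fun t ht =>
    differentiableAt_zl hχ1 fun h => by
      have := congrArg im h
      simp at this
      linarith [ht.1]
  have hgd : ∀ t ∈ Set.Icc T (2 * T), DifferentiableAt ℂ (afe χ X N T) ((1/2:ℝ) + t * I) := fun t ht =>
    differentiableAt_afe hχ1 hX N hT0 (by simp; linarith [ht.1])
  have hTT : T ≤ 2 * T := by linarith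
  have hcV' : Continuous fun t : ℝ => dpoly χ N ((1/2:ℝ) + (-t : ℝ) * I) := (hcd _).comp continuous_neg
  have igA := (intervalIntegrable_line hTT _ hgd).const_mul 3
  have igB : IntervalIntegrable (fun t : ℝ => 3 * ‖dpoly χ N ((1/2:ℝ) + t * I)‖ ^ 2) MeasureTheory.volume T (2*T) :=
    (continuous_const.mul ((hcd _).norm.pow 2)).intervalIntegrable _ _
  have igC : IntervalIntegrable (fun t : ℝ => 3 * C ^ 2 * ‖dpoly χ N ((1/2:ℝ) + (-t:ℝ) * I)‖ ^ 2)
      MeasureTheory.volume T (2*T) :=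
    (continuous_const.mul (hcV'.norm.pow 2)).intervalIntegrable _ _
  calc _ ≤ ∫ t in T..(2 * T), (3 * ‖afe χ X N T ((1/2:ℝ) + t * I)‖ ^ 2 + 3 * ‖dpoly χ N ((1/2:ℝ) + t * I)‖ ^ 2 +
        3 * C ^ 2 * ‖dpoly χ N ((1/2:ℝ) + (-t:ℝ) * I)‖ ^ 2) := by
        refine intervalIntegral.integral_mono_on hTT (intervalIntegrable_line hTT _ hzd)
          ((igA.add igB).add igC) fun t ht => ?_
        have hx := hX.half t (by linarith [ht.1])
        have ec : (1 - ((1/2:ℝ) + t * I) : ℂ) = (1/2:ℝ) + (-t:ℝ) * I := by push_cast; ring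
        rw [norm_afe hT0, ec, sub_self, Real.rpow_zero, one_pow, mul_one]
        set x := X ((1/2:ℝ) + t * I)
        set z := zl χ ((1/2:ℝ) + t * I)
        set d := dpoly χ N ((1/2:ℝ) + (-t:ℝ) * I)
        set w := dpoly χ N ((1/2:ℝ) + t * I)
        have hxd : ‖x * d‖ ≤ C * ‖d‖ := by rw [norm_mul]; gcongr
        have h3 : ‖z‖ ≤ ‖z - w - x * d‖ + ‖w‖ + C * ‖d‖ := by
          calc ‖z‖ = ‖(z - w - x * d) + w + x * d‖ := by congr 1; ring
            _ ≤ _ := (norm_add_le _ _).trans (add_le_add (norm_add_le _ _) hxd)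
        have h4 : ‖z‖ ^ 2 ≤ (‖z - w - x * d‖ + ‖w‖ + C * ‖d‖) ^ 2 := by gcongr
        nlinarith [sq_nonneg (‖z - w - x * d‖ - ‖w‖), sq_nonneg (‖z - w - x * d‖ - C * ‖d‖),
          sq_nonneg (‖w‖ - C * ‖d‖)]
    _ = 3 * (∫ t in T..(2 * T), ‖afe χ X N T ((1/2:ℝ) + t * I)‖ ^ 2) +
        3 * (∫ t in T..(2 * T), ‖dpoly χ N ((1/2:ℝ) + t * I)‖ ^ 2) +
        3 * C ^ 2 * ∫ t in (-(2 * T))..(-T), ‖dpoly χ N ((1/2:ℝ) + t * I)‖ ^ 2 := by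
        rw [intervalIntegral.integral_add (igA.add igB) igC, intervalIntegral.integral_add igA igB,
          intervalIntegral.integral_const_mul, intervalIntegral.integral_const_mul,
          intervalIntegral.integral_const_mul,
          intervalIntegral.integral_comp_neg fun t : ℝ => ‖dpoly χ N ((1/2:ℝ) + t * I)‖ ^ 2]
    _ ≤ 3 * ((12 * K + 12 * M ^ 2) * (T * Real.log T ^ 2)) + 3 * (C2 * (T * Real.log T ^ 2)) +
        3 * C ^ 2 * (C2 * (T * Real.log T ^ 2)) := by gcongr
    _ = _ := by ring

end mom5
end MSW

namespace MSW

/-- A function of size `log^k` in the region `Re s ≥ 1 - 1/log t` varies slowly to the right of the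
line `Re s = 1`. -/
lemma exists_norm_sub_line_one_le {G : ℂ → ℂ} {C : ℝ} {k : ℕ} (hC : 0 < C)
    (hd : ∀ s : ℂ, s.im ≠ 0 → DifferentiableAt ℂ G s)
    (hb : ∀ s : ℂ, 10 ≤ s.im → 1 - 1 / Real.log s.im ≤ s.re → s.re ≤ 2 →
      ‖G s‖ ≤ C * Real.log s.im ^ k) :
    ∃ C' : ℝ, 0 < C' ∧ ∀ t σ : ℝ, 20 ≤ t → 1 ≤ σ → σ ≤ 3 / 2 →
      ‖G (σ + t * I) - G (1 + t * I)‖ ≤ C' * (σ - 1) * Real.log t ^ (k + 1) := by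
  refine ⟨C * 2 ^ (k + 1), by positivity, fun t σ ht h1 h2 => ?_⟩
  have hlog : 2 ≤ Real.log t := by
    rw [Real.le_log_iff_exp_le (by linarith)]
    have : Real.exp 2 = Real.exp 1 * Real.exp 1 := by rw [← Real.exp_add]; norm_num
    nlinarith [Real.exp_one_lt_d9, Real.exp_pos 1]
  set R : ℝ := 1 / (2 * Real.log t) with hR
  have hR0 : 0 < R := by positivity
  have hR1 : R ≤ 1 / 4 := by
    rw [hR]; apply one_div_le_one_div_of_le <;> linarith
  let S : Set ℂ := {s | 1 ≤ s.re ∧ s.re ≤ 3 / 2 ∧ s.im = t}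
  have hS : Convex ℝ S := by
    intro x hx y hy a b ha hb hab
    simp only [S, Set.mem_setOf_eq, add_re, real_smul, mul_re, ofReal_re, ofReal_im, zero_mul,
      sub_zero, add_im, mul_im, add_zero] at *
    obtain ⟨hx1, hx2, hx3⟩ := hx
    obtain ⟨hy1, hy2, hy3⟩ := hy
    refine ⟨by nlinarith, by nlinarith, ?_⟩
    rw [hx3, hy3, ← add_mul, hab, one_mul]
  have hderiv : ∀ s ∈ S, ‖deriv G s‖ ≤ C * 2 ^ (k + 1) * Real.log t ^ (k + 1) := by
    rintro s ⟨hs1, hs2, hs3⟩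
    have key : ∀ z : ℂ, ‖z - s‖ ≤ R → |z.re - s.re| ≤ R ∧ |z.im - t| ≤ R := by
      intro z hz
      have h3 := abs_re_le_norm (z - s)
      have h4 := abs_im_le_norm (z - s)
      simp only [sub_re, sub_im, hs3] at h3 h4
      exact ⟨h3.trans hz, h4.trans hz⟩
    have hcb : DiffContOnCl ℂ G (Metric.ball s R) := by
      apply DifferentiableOn.diffContOnCl
      intro z hz
      rw [closure_ball _ hR0.ne', Metric.mem_closedBall, dist_eq_norm] at hz
      apply (hd z _).differentiableWithinAt
      have := abs_le.1 (key z hz).2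
      intro h
      rw [h] at this
      linarith [this.1]
    have hsph : ∀ z ∈ Metric.sphere s R, ‖G z‖ ≤ C * (2 * Real.log t) ^ k := by
      intro z hz
      rw [mem_sphere_iff_norm] at hz
      obtain ⟨h3, h4⟩ := key z hz.le
      rw [abs_le] at h3 h4
      have hz0 : 10 ≤ z.im := by linarith
      have hl0 : 0 < Real.log z.im := Real.log_pos (by linarith)
      have hl : Real.log z.im ≤ 2 * Real.log t := by
        have : 2 * Real.log t = Real.log (t ^ 2) := by rw [Real.log_pow]; norm_num
        rw [this]
        apply Real.log_le_log (by linarith); nlinarith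
      refine (hb z hz0 ?_ (by linarith)).trans ?_
      · have : R ≤ 1 / Real.log z.im := one_div_le_one_div_of_le hl0 hl
        linarith
      · gcongr
    refine (norm_deriv_le_of_forall_mem_sphere_norm_le hR0 hcb hsph).trans (le_of_eq ?_)
    rw [hR]
    field_simp
    ring
  have h := hS.norm_image_sub_le_of_norm_deriv_le (f := G) (x := 1 + t * I) (y := σ + t * I)
    (fun x hx => hd x (by rw [hx.2.2]; linarith)) hderiv (by simp [S]; norm_num) (by simp [S, h1, h2])
  refine h.trans (le_of_eq ?_)
  have : (σ + t * I : ℂ) - (1 + t * I) = ((σ - 1 : ℝ) : ℂ) := by push_cast; ring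
  rw [this, norm_real, Real.norm_of_nonneg (by linarith)]
  ring

variable {q : ℕ} [NeZero q] (χ : DirichletCharacter ℂ q)

lemma exists_norm_LFunction_sub_line_one_le : ∃ C : ℝ, 0 < C ∧ ∀ t σ : ℝ, 20 ≤ t → 1 ≤ σ →
    σ ≤ 3 / 2 → ‖χ.LFunction (σ + t * I) - χ.LFunction (1 + t * I)‖ ≤
      C * (σ - 1) * Real.log t ^ 2 := by
  obtain ⟨C, hC, h⟩ := norm_LFunction_le_log χ
  refine exists_norm_sub_line_one_le (k := 1) hC (fun s hs => ?_) (by simpa using h)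
  apply χ.differentiableAt_LFunction s
  left
  rintro rfl
  simp at hs

lemma riemannZeta_eq_LFunction (s : ℂ) : riemannZeta s =
    (1 : DirichletCharacter ℂ 1).LFunction s := by simp

lemma exists_norm_zl_sub_line_one_le (hχ1 : χ ≠ 1) : ∃ C : ℝ, 0 < C ∧ ∀ t σ : ℝ, 20 ≤ t → 1 ≤ σ →
    σ ≤ 3 / 2 → ‖zl χ (σ + t * I) - zl χ (1 + t * I)‖ ≤ C * (σ - 1) * Real.log t ^ 3 := by
  obtain ⟨C, hC, h⟩ := norm_LFunction_le_log χ
  obtain ⟨C1, hC1, h1⟩ := norm_LFunction_le_log (1 : DirichletCharacter ℂ 1)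
  refine exists_norm_sub_line_one_le (k := 2) (C := C1 * C) (by positivity) (fun s hs => ?_)
    (fun s hs1 hs2 hs3 => ?_)
  · apply differentiableAt_zl hχ1
    rintro rfl
    simp at hs
  · rw [zl, norm_mul, riemannZeta_eq_LFunction]
    calc _ ≤ (C1 * Real.log s.im) * (C * Real.log s.im) :=
          mul_le_mul (h1 s hs1 hs2 hs3) (h s hs1 hs2 hs3) (norm_nonneg _) ((norm_nonneg _).trans (h1 s hs1 hs2 hs3))
      _ = _ := by ring

/-- A weak explicit lower bound on the line `Re s = 1`, from the `3-4-1` inequality. -/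
lemma exists_le_norm_LFunction_one (hχ : χ ^ 2 = 1) : ∃ c T0 : ℝ, 0 < c ∧ 20 ≤ T0 ∧ ∀ t : ℝ, T0 ≤ t →
    c * (Real.log t ^ 8)⁻¹ ≤ ‖χ.LFunction (1 + t * I)‖ := by
  obtain ⟨C1, hC1, h1⟩ := norm_LFunction_le_log (1 : DirichletCharacter ℂ q)
  obtain ⟨C2, hC2, h2⟩ := exists_norm_LFunction_sub_line_one_le χ
  obtain ⟨C3, hC3, h3⟩ := (DirichletCharacter.LFunctionTrivChar_isBigO_near_one_horizontal (N := q)).exists_pos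
  rw [isBigOWith_iff, eventually_nhdsWithin_iff, Metric.eventually_nhds_iff] at h3
  obtain ⟨δ, hδ, h3⟩ := h3
  refine ⟨C2, max 20 (Real.exp (max (2 + δ⁻¹) (32 * C3 ^ 3 * C1 * C2 ^ 4 + 1))), hC2, le_max_left _ _, fun t ht => ?_⟩
  have ht20 : 20 ≤ t := (le_max_left _ _).trans ht
  have hlog : max (2 + δ⁻¹) (32 * C3 ^ 3 * C1 * C2 ^ 4 + 1) ≤ Real.log t := by
    rw [Real.le_log_iff_exp_le (by linarith)]
    exact (le_max_right _ _).trans ht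
  set l := Real.log t with hl
  have hl1 : 2 + δ⁻¹ ≤ l := (le_max_left _ _).trans hlog
  have hl2 : 32 * C3 ^ 3 * C1 * C2 ^ 4 + 1 ≤ l := (le_max_right _ _).trans hlog
  have hδ' : 0 < δ⁻¹ := by positivity
  have hl0 : 2 ≤ l := by linarith
  have hlpos : 0 < l := by linarith
  by_contra! hcon
  set x : ℝ := (l ^ 10)⁻¹ with hx
  have hx0 : 0 < x := by positivity
  have hll : l ≤ l ^ 10 := le_self_pow₀ (by linarith) (by norm_num)
  have hxl : x ≤ l⁻¹ := by rw [hx]; gcongr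
  have hx2 : x ≤ 1 / 2 := hxl.trans (by rw [inv_le_comm₀ hlpos (by norm_num)]; linarith)
  have hxδ : x < δ := hxl.trans_lt (by rw [inv_lt_comm₀ hlpos hδ]; linarith)
  have h34 := χ.norm_LFunction_product_ge_one hx0 t
  rw [hχ, norm_mul, norm_mul, norm_pow, norm_pow] at h34
  have e1 := h3 (y := x) (by simpa [abs_of_pos hx0] using hxδ) hx0
  rw [norm_div, norm_one, norm_real, Real.norm_of_nonneg hx0.le] at e1
  have e2 : ‖χ.LFunction (1 + x + I * t)‖ ≤ 2 * C2 * (l ^ 8)⁻¹ := by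
    have h := h2 t (1 + x) ht20 (by linarith) (by linarith)
    have h' := norm_sub_norm_le (χ.LFunction ((1 + x : ℝ) + t * I)) (χ.LFunction (1 + t * I))
    have e : C2 * (1 + x - 1) * l ^ 2 = C2 * (l ^ 8)⁻¹ := by
      rw [hx]; field_simp; ring
    rw [e] at h
    have e' : ((1 + x : ℝ) + t * I : ℂ) = 1 + x + I * t := by push_cast; ring
    rw [e'] at h h'
    linarith
  have e3 : ‖(1 : DirichletCharacter ℂ q).LFunction (1 + x + 2 * I * t)‖ ≤ C1 * (2 * l) := by
    have him : (1 + x + 2 * I * t : ℂ).im = 2 * t := by simp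
    have hre : (1 + x + 2 * I * t : ℂ).re = 1 + x := by simp
    have hl4 : Real.log (2 * t) ≤ 2 * l := by
      rw [hl, show 2 * Real.log t = Real.log (t ^ 2) by rw [Real.log_pow]; norm_num]
      apply Real.log_le_log (by linarith); nlinarith
    have hp : 0 < 1 / Real.log (2 * t) := one_div_pos.2 (Real.log_pos (by linarith))
    refine (h1 _ (by rw [him]; linarith) (by rw [him, hre]; linarith) (by rw [hre]; linarith)).trans ?_
    rw [him]
    gcongr
  have hprod : (1:ℝ) ≤ (C3 * (1 / x)) ^ 3 * (2 * C2 * (l ^ 8)⁻¹) ^ 4 * (C1 * (2 * l)) := by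
    refine h34.trans ?_
    gcongr
  have : (C3 * (1 / x)) ^ 3 * (2 * C2 * (l ^ 8)⁻¹) ^ 4 * (C1 * (2 * l)) =
      32 * C3 ^ 3 * C1 * C2 ^ 4 / l := by
    rw [hx]; field_simp; ring
  rw [this, one_le_div hlpos] at hprod
  linarith

end MSW

namespace MSW

/-- The coefficients of the sum over primes `∑ χ(p) p^(-s)`. -/
noncomputable def primeCoeff {q : ℕ} (χ : DirichletCharacter ℂ q) (n : ℕ) : ℝ :=
  if n.Prime then (χ n).re else 0

section
variable {q : ℕ} {χ : DirichletCharacter ℂ q}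

lemma ofReal_re_of_sq_eq_one (hχ : χ ^ 2 = 1) (n : ℕ) : (((χ n).re : ℝ) : ℂ) = χ n := by
  by_cases hu : IsUnit (n : ZMod q)
  · have h : (χ n) ^ 2 = 1 := by
      rw [← MulChar.pow_apply' _ two_ne_zero, hχ, MulChar.one_apply hu]
    rcases eq_or_eq_neg_of_sq_eq_sq _ _ (h.trans (one_pow 2).symm) with h | h <;> simp [h]
  · simp [MulChar.map_nonunit _ hu]

lemma abs_primeCoeff_le (n : ℕ) : |primeCoeff χ n| ≤ 1 := by
  rw [primeCoeff]
  split_ifs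
  · exact (abs_re_le_norm _).trans (χ.norm_le_one _)
  · simp

lemma norm_primeCoeff_mul_cpow_le (s : ℂ) (n : ℕ) :
    ‖(primeCoeff χ n : ℂ) * (n:ℂ) ^ (-s)‖ ≤ (n:ℝ) ^ (-s.re) := by
  rcases n.eq_zero_or_pos with rfl | hn
  · simp only [primeCoeff, Nat.not_prime_zero, if_false, ofReal_zero, zero_mul, norm_zero]
    positivity
  · rw [norm_mul, norm_real, norm_natCast_cpow_of_pos hn, neg_re]
    exact mul_le_of_le_one_left (by positivity) (abs_primeCoeff_le n)

lemma summable_primeCoeff {s : ℂ} (hs : 1 < s.re) :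
    Summable fun n : ℕ => (primeCoeff χ n : ℂ) * (n:ℂ) ^ (-s) :=
  Summable.of_norm_bounded (Real.summable_nat_rpow.2 (by linarith)) (norm_primeCoeff_mul_cpow_le s)

lemma tsum_primes {f : ℕ → ℂ} (hf : ∀ n, ¬ n.Prime → f n = 0) :
    ∑' p : Nat.Primes, f p = ∑' n, f n :=
  Function.Injective.tsum_eq Subtype.val_injective fun n hn =>
    ⟨⟨n, by by_contra h; exact hn (hf n h)⟩, rfl⟩

lemma LFunction_ne_zero_of_one_lt [NeZero q] {s : ℂ} (hs : 1 < s.re) : χ.LFunction s ≠ 0 :=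
  χ.LFunction_ne_zero_of_one_le_re (Or.inr (by rintro rfl; simp at hs)) hs.le

/-- The logarithm of `|L(s, χ)|` is the sum over primes, up to a bounded error. -/
lemma abs_log_norm_LFunction_sub_le [NeZero q] (hχ : χ ^ 2 = 1) {s : ℂ} (hs : 1 < s.re) :
    |Real.log ‖χ.LFunction s‖ - (∑' n : ℕ, (primeCoeff χ n : ℂ) * (n:ℂ) ^ (-s)).re| ≤ 2 := by
  have hE := DirichletCharacter.LSeries_eulerProduct_exp_log χ hs
  rw [← χ.LFunction_eq_LSeries hs] at hE
  rw [← hE, norm_exp, Real.log_exp, ← sub_re]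
  refine (abs_re_le_norm _).trans ?_
  have hz : ∀ n : ℕ, n.Prime → (primeCoeff χ n : ℂ) * (n:ℂ) ^ (-s) = χ n * (n:ℂ) ^ (-s) := by
    intro n hn
    rw [primeCoeff, if_pos hn, ofReal_re_of_sq_eq_one hχ]
  have hsP : Summable fun p : Nat.Primes => (primeCoeff χ p : ℂ) * ((p:ℕ):ℂ) ^ (-s) :=
    (summable_primeCoeff hs).comp_injective (i := fun p : Nat.Primes => (p:ℕ)) Subtype.val_injective
  rw [← tsum_primes (f := fun n => (primeCoeff χ n : ℂ) * (n:ℂ) ^ (-s))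
    (fun n hn => by simp [primeCoeff, hn]),
    ← Summable.tsum_sub (DirichletCharacter.summable_neg_log_one_sub_mul_prime_cpow χ hs) hsP]
  have hsum : Summable fun n : ℕ => (1:ℝ) / (n:ℝ) ^ 2 := Real.summable_one_div_nat_pow.2 one_lt_two
  have hsum' : Summable fun p : Nat.Primes => (1:ℝ) / ((p:ℕ):ℝ) ^ 2 :=
    hsum.comp_injective Subtype.val_injective
  have hterm : ∀ p : Nat.Primes, ‖-Complex.log (1 - χ p * (p:ℂ) ^ (-s)) -
      (primeCoeff χ p : ℂ) * ((p:ℕ):ℂ) ^ (-s)‖ ≤ 1 / ((p:ℕ):ℝ) ^ 2 := by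
    intro p
    have hp2 : (2:ℝ) ≤ ((p:ℕ):ℝ) := by exact_mod_cast p.2.two_le
    rw [hz p p.2]
    set z := χ p * ((p:ℕ):ℂ) ^ (-s) with hzdef
    have hzn : ‖z‖ ≤ 1 / ((p:ℕ):ℝ) := by
      rw [hzdef, norm_mul, norm_natCast_cpow_of_pos p.2.pos, neg_re]
      calc _ ≤ 1 * ((p:ℕ):ℝ) ^ (-1:ℝ) := by
            gcongr
            · exact χ.norm_le_one _
            · linarith
        _ = _ := by rw [Real.rpow_neg_one, one_mul, one_div]
    have hz2 : ‖z‖ ≤ 1 / 2 := hzn.trans (one_div_le_one_div_of_le (by norm_num) hp2)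
    have h := norm_log_one_add_sub_self_le (z := -z) (by rw [norm_neg]; linarith)
    rw [norm_neg] at h
    have e : -Complex.log (1 - z) - z = -(Complex.log (1 + -z) - -z) := by
      rw [sub_eq_add_neg 1 z]; ring
    rw [e, norm_neg]
    refine h.trans ?_
    have h1 : (1 - ‖z‖)⁻¹ ≤ 2 := by
      rw [inv_le_comm₀ (by linarith) (by norm_num)]; linarith
    calc ‖z‖ ^ 2 * (1 - ‖z‖)⁻¹ / 2 ≤ ‖z‖ ^ 2 * 2 / 2 := by gcongr
      _ = ‖z‖ ^ 2 := by ring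
      _ ≤ (1 / ((p:ℕ):ℝ)) ^ 2 := by gcongr
      _ = _ := by rw [one_div_pow]
  refine (tsum_of_norm_bounded hsum'.hasSum hterm).trans ?_
  calc _ ≤ ∑' n : ℕ, (1:ℝ) / (n:ℝ) ^ 2 :=
        tsum_comp_le_tsum_of_inj hsum (fun n => by positivity) Subtype.val_injective
    _ = Real.pi ^ 2 / 6 := hasSum_zeta_two.tsum_eq
    _ ≤ 2 := by nlinarith [Real.pi_lt_d2, Real.pi_pos]

lemma exists_abs_log_norm_le {f : ℝ → ℂ} (hf : ContinuousOn f (Set.Icc 1 2))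
    (h0 : ∀ x ∈ Set.Icc (1:ℝ) 2, f x ≠ 0) :
    ∃ C : ℝ, ∀ x ∈ Set.Icc (1:ℝ) 2, |Real.log ‖f x‖| ≤ C := by
  have : ContinuousOn (fun x => Real.log ‖f x‖) (Set.Icc 1 2) :=
    hf.norm.log fun x hx => norm_ne_zero_iff.2 (h0 x hx)
  exact isCompact_Icc.exists_bound_of_continuousOn this

lemma exists_abs_log_norm_LFunction_le [NeZero q] (hχ1 : χ ≠ 1) : ∃ C : ℝ, ∀ σ ∈ Set.Icc (1:ℝ) 2,
    |Real.log ‖χ.LFunction σ‖| ≤ C :=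
  exists_abs_log_norm_le ((DirichletCharacter.differentiable_LFunction hχ1).continuous.comp
    continuous_ofReal).continuousOn
    fun x hx => χ.LFunction_ne_zero_of_one_le_re (Or.inl hχ1) (by simpa using hx.1)

lemma exists_abs_log_norm_riemannZeta_le : ∃ C : ℝ, ∀ σ : ℝ, 1 < σ → σ ≤ 2 →
    |Real.log ‖riemannZeta σ‖ - Real.log (1 / (σ - 1))| ≤ C := by
  let g : ℂ → ℂ := Function.update (fun s => (s - 1) * riemannZeta s) 1 1
  have hg : Continuous g := by
    rw [continuous_iff_continuousAt]
    intro s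
    rcases eq_or_ne s 1 with rfl | hs
    · exact continuousAt_update_same.2 riemannZeta_residue_one
    · rw [continuousAt_update_of_ne hs]
      exact ((continuous_id.sub continuous_const).continuousAt).mul
        (differentiableAt_riemannZeta hs).continuousAt
  obtain ⟨C, hC⟩ := exists_abs_log_norm_le (hg.comp continuous_ofReal).continuousOn (fun x hx => by
    rcases eq_or_ne x 1 with rfl | hs
    · simp [g]
    · have : (x:ℂ) ≠ 1 := by exact_mod_cast hs
      simp only [g, Function.comp, Function.update_of_ne this]
      exact mul_ne_zero (sub_ne_zero.2 this) (riemannZeta_ne_zero_of_one_le_re (by simpa using hx.1)))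
  refine ⟨C, fun σ h1 h2 => ?_⟩
  have h := hC σ ⟨h1.le, h2⟩
  have hne : (σ:ℂ) ≠ 1 := by exact_mod_cast h1.ne'
  simp only [g, Function.comp, Function.update_of_ne hne] at h
  have e : (σ - 1 : ℂ) = ((σ - 1 : ℝ) : ℂ) := by push_cast; rfl
  rw [norm_mul, Real.log_mul (norm_ne_zero_iff.2 (sub_ne_zero.2 hne))
    (norm_ne_zero_iff.2 (riemannZeta_ne_zero_of_one_le_re (by simpa using h1.le))), e, norm_real,
    Real.norm_of_nonneg (by linarith)] at h
  rw [one_div, Real.log_inv]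
  convert h using 2
  ring

/-- A function whose logarithm is a sum over primes with bounded nonnegative coefficients, with a
simple pole at `1`. -/
structure LogPrimeSum (F : ℂ → ℂ) (b : ℕ → ℝ) (C : ℝ) : Prop where
  nonneg : ∀ n, 0 ≤ b n
  le_two : ∀ n, b n ≤ 2
  prime_of_ne_zero : ∀ n, b n ≠ 0 → n.Prime
  ne_zero : ∀ s : ℂ, 1 < s.re → F s ≠ 0
  neg_le_log_norm : ∀ s : ℂ, 1 < s.re →
    -‖∑' n : ℕ, (b n : ℂ) * (n:ℂ) ^ (-s)‖ - C ≤ Real.log ‖F s‖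
  abs_tsum_sub_le : ∀ σ : ℝ, 1 < σ → σ ≤ 2 →
    |∑' n : ℕ, b n * (n:ℝ) ^ (-σ) - Real.log (1 / (σ - 1))| ≤ C

lemma LogPrimeSum.of_abs_sub_le {F : ℂ → ℂ} {b : ℕ → ℝ} {C C' : ℝ} (h0 : ∀ n, 0 ≤ b n)
    (h2 : ∀ n, b n ≤ 2) (hp : ∀ n, b n ≠ 0 → n.Prime) (hF : ∀ s : ℂ, 1 < s.re → F s ≠ 0)
    (h : ∀ s : ℂ, 1 < s.re → |Real.log ‖F s‖ - (∑' n : ℕ, (b n : ℂ) * (n:ℂ) ^ (-s)).re| ≤ C)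
    (h' : ∀ σ : ℝ, 1 < σ → σ ≤ 2 → |Real.log ‖F σ‖ - Real.log (1 / (σ - 1))| ≤ C') :
    LogPrimeSum F b (C + |C'|) where
  nonneg := h0
  le_two := h2
  prime_of_ne_zero := hp
  ne_zero := hF
  neg_le_log_norm s hs := by
    have h3 := (abs_le.1 (h s hs)).1
    have h4 := (abs_le.1 (abs_re_le_norm (∑' n : ℕ, (b n : ℂ) * (n:ℂ) ^ (-s)))).1
    linarith [abs_nonneg C']
  abs_tsum_sub_le σ h1 h2 := by
    have h3 := h σ (by simpa using h1)
    have e : (∑' n : ℕ, (b n : ℂ) * (n:ℂ) ^ (-(σ:ℂ))) = ((∑' n : ℕ, b n * (n:ℝ) ^ (-σ) : ℝ) : ℂ) := by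
      rw [ofReal_tsum]
      congr 1
      ext n
      rw [ofReal_mul, ofReal_cpow n.cast_nonneg]
      push_cast
      rfl
    rw [e, ofReal_re] at h3
    have h4 := (h' σ h1 h2).trans (le_abs_self _)
    rw [abs_le] at *
    constructor <;> linarith [h3.1, h3.2, h4.1, h4.2]

lemma exists_logPrimeSum_riemannZeta : ∃ C, LogPrimeSum riemannZeta
    (primeCoeff (1 : DirichletCharacter ℂ 1)) C := by
  obtain ⟨C, hC⟩ := exists_abs_log_norm_riemannZeta_le
  refine ⟨2 + |C|, LogPrimeSum.of_abs_sub_le (fun n => ?_) (fun n => ?_) (fun n hn => ?_)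
    (fun s hs => riemannZeta_ne_zero_of_one_le_re hs.le) (fun s hs => ?_) hC⟩
  · rw [primeCoeff]; split_ifs
    · rw [MulChar.one_apply (isUnit_of_subsingleton _)]; simp
    · rfl
  · linarith [(abs_le.1 (abs_primeCoeff_le (χ := (1 : DirichletCharacter ℂ 1)) n)).2]
  · by_contra h; simp [primeCoeff, h] at hn
  · rw [riemannZeta_eq_LFunction]
    exact abs_log_norm_LFunction_sub_le (one_pow 2) hs

lemma exists_logPrimeSum_zl [NeZero q] (hχ : χ ^ 2 = 1) (hχ1 : χ ≠ 1) : ∃ C, LogPrimeSum (zl χ)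
    (fun n => primeCoeff (1 : DirichletCharacter ℂ 1) n + primeCoeff χ n) C := by
  obtain ⟨C, hC⟩ := exists_abs_log_norm_riemannZeta_le
  obtain ⟨C2, hC2⟩ := exists_abs_log_norm_LFunction_le hχ1
  have hb := fun n => abs_le.1 (abs_primeCoeff_le (χ := χ) n)
  have hb1 := fun n => abs_le.1 (abs_primeCoeff_le (χ := (1 : DirichletCharacter ℂ 1)) n)
  have hz : ∀ s : ℂ, 1 < s.re → riemannZeta s ≠ 0 := fun s hs => riemannZeta_ne_zero_of_one_le_re hs.le
  have hsplit : ∀ s : ℂ, 1 < s.re → Real.log ‖zl χ s‖ =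
      Real.log ‖riemannZeta s‖ + Real.log ‖χ.LFunction s‖ := by
    intro s hs
    rw [zl, norm_mul, Real.log_mul (norm_ne_zero_iff.2 (hz s hs))
      (norm_ne_zero_iff.2 (LFunction_ne_zero_of_one_lt hs))]
  refine ⟨4 + |C + C2|, LogPrimeSum.of_abs_sub_le (fun n => ?_) (fun n => ?_) (fun n hn => ?_)
    (fun s hs => mul_ne_zero (hz s hs) (LFunction_ne_zero_of_one_lt hs))
    (fun s hs => ?_) (fun σ h1 h2 => ?_)⟩
  · by_cases h : n.Prime
    · have := (hb n).1
      have e : primeCoeff (1 : DirichletCharacter ℂ 1) n = 1 := by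
        rw [primeCoeff, if_pos h, MulChar.one_apply (isUnit_of_subsingleton _)]; simp
      rw [e]; linarith
    · simp [primeCoeff, h]
  · linarith [(hb n).2, (hb1 n).2]
  · by_contra h; simp [primeCoeff, h] at hn
  · have h1 := abs_log_norm_LFunction_sub_le hχ hs
    have h2 := abs_log_norm_LFunction_sub_le (one_pow 2 : (1 : DirichletCharacter ℂ 1) ^ 2 = 1) hs
    rw [← riemannZeta_eq_LFunction] at h2
    rw [hsplit s hs]
    simp only [ofReal_add, add_mul]
    rw [Summable.tsum_add (summable_primeCoeff hs) (summable_primeCoeff hs), add_re]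
    rw [abs_le] at *
    constructor <;> linarith [h1.1, h1.2, h2.1, h2.2]
  · have h3 := hC σ h1 h2
    have h4 := hC2 σ ⟨h1.le, h2⟩
    rw [hsplit σ (by simpa using h1)]
    rw [abs_le] at *
    constructor <;> linarith [h3.1, h3.2, h4.1, h4.2]

end

end MSW

namespace MSW

/-- At most `k ^ k` tuples of `k` primes have a given product. -/
lemma card_prime_tuples_le {k : ℕ} (S : Finset ℕ) (hS : ∀ n ∈ S, n.Prime) (m : ℕ) :
    ((Fintype.piFinset fun _ : Fin k => S).filter fun f => ∏ i, f i = m).card ≤ k ^ k := by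
  rcases Finset.eq_empty_or_nonempty
    ((Fintype.piFinset fun _ : Fin k => S).filter fun f => ∏ i, f i = m) with h | ⟨g, hg⟩
  · simp [h]
  have key : ∀ f ∈ (Fintype.piFinset fun _ : Fin k => S).filter (fun f => ∏ i, f i = m),
      m.primeFactors = Finset.univ.image f := by
    intro f hf
    rw [Finset.mem_filter, Fintype.mem_piFinset] at hf
    rw [← hf.2]
    ext p
    rw [Nat.mem_primeFactors, Finset.mem_image]
    constructor
    · rintro ⟨hp, hd, -⟩
      obtain ⟨i, hi, hdi⟩ := (hp.prime.dvd_finset_prod_iff _).1 hd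
      exact ⟨i, hi, ((Nat.prime_dvd_prime_iff_eq hp (hS _ (hf.1 i))).1 hdi).symm⟩
    · rintro ⟨i, hi, rfl⟩
      exact ⟨hS _ (hf.1 i), Finset.dvd_prod_of_mem _ hi,
        Finset.prod_ne_zero_iff.2 fun j _ => (hS _ (hf.1 j)).ne_zero⟩
  have hcard : m.primeFactors.card ≤ k := by
    rw [key g hg]
    exact Finset.card_image_le.trans (by simp)
  calc _ ≤ (Fintype.piFinset fun _ : Fin k => m.primeFactors).card := by
        apply Finset.card_le_card
        intro f hf
        rw [Fintype.mem_piFinset]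
        intro i
        rw [key f hf]
        exact Finset.mem_image_of_mem _ (Finset.mem_univ _)
    _ = m.primeFactors.card ^ k := by simp
    _ ≤ k ^ k := Nat.pow_le_pow_left hcard k

lemma integral_prime_sum_pow_le (S : Finset ℕ) (hS : ∀ n ∈ S, n.Prime) {N : ℕ} (hN : 1 ≤ N)
    (hSN : S ⊆ Finset.Ioc N (2 * N)) (x : ℕ → ℂ) (hx : ∀ n ∈ S, ‖x n‖ ≤ 2 / N) (k : ℕ) {T : ℝ}
    (hT : 0 < T) (hTk : T ≤ (N:ℝ) ^ k) :
    ∫ t in T..(2 * T), ‖∑ n ∈ S, x n * (n:ℂ) ^ (-(t * I))‖ ^ (2 * k) ≤ 400 * (8 * k) ^ k := by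
  have hN0 : (0:ℝ) < N := by exact_mod_cast hN
  have hpow : ∀ t : ℝ, ‖∑ n ∈ S, x n * (n:ℂ) ^ (-(t * I))‖ ^ (2 * k) =
      ‖∑ f ∈ Fintype.piFinset (fun _ : Fin k => S), (∏ i, x (f i)) * ((∏ i, f i : ℕ) : ℂ) ^ (-(t * I))‖ ^ 2 := by
    intro t
    rw [mul_comm 2 k, pow_mul, ← norm_pow]
    congr 2
    have := Finset.prod_univ_sum (fun _ : Fin k => S) (fun _ n => x n * (n:ℂ) ^ (-(t * I)))
    rw [Finset.prod_const, Finset.card_univ, Fintype.card_fin] at this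
    rw [this]
    refine Finset.sum_congr rfl fun f _ => ?_
    rw [Finset.prod_mul_distrib]
    congr 1
    rw [Nat.cast_prod]
    have e : ∀ s : Finset (Fin k), (∏ i ∈ s, ((f i : ℕ) : ℂ)) ^ (-(t * I)) = ∏ i ∈ s, ((f i : ℕ) : ℂ) ^ (-(t * I)) := by
      intro s
      induction s using Finset.induction_on with
      | empty => simp
      | insert a s ha ih =>
        rw [Finset.prod_insert ha, Finset.prod_insert ha, ← ih, ← Nat.cast_prod,
          natCast_mul_natCast_cpow]
    exact (e _).symm
  simp_rw [hpow]
  have h := mean_value_family (Fintype.piFinset (fun _ : Fin k => S)) (fun f => ∏ i, x (f i))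
    (fun f => ∏ i, f i) ((2 * N) ^ k) (T / 2) (3 * T / 2) (k ^ k) (by linarith) (fun f hf => by
      rw [Fintype.mem_piFinset] at hf
      refine ⟨Finset.one_le_prod' fun i _ => (hS _ (hf i)).one_le, ?_⟩
      have : ∏ i, f i ≤ (2 * N) ^ k := by
        calc ∏ i, f i ≤ ∏ _i : Fin k, 2 * N :=
              Finset.prod_le_prod' fun i _ => (Finset.mem_Ioc.1 (hSN (hf i))).2
          _ = _ := by simp
      exact_mod_cast this) (fun n => by exact_mod_cast card_prime_tuples_le S hS n) (by positivity)
  have e1 : 3 * T / 2 - T / 2 = T := by ring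
  have e2 : 3 * T / 2 + T / 2 = 2 * T := by ring
  rw [e1, e2] at h
  refine h.trans ?_
  have hsum : ∑ f ∈ Fintype.piFinset (fun _ : Fin k => S), ‖∏ i, x (f i)‖ ^ 2 ≤ (4 / (N:ℝ)) ^ k := by
    have := Finset.prod_univ_sum (fun _ : Fin k => S) (fun _ n => ‖x n‖ ^ 2)
    rw [Finset.prod_const, Finset.card_univ, Fintype.card_fin] at this
    simp_rw [norm_prod, ← Finset.prod_pow]
    rw [← this]
    gcongr
    calc ∑ n ∈ S, ‖x n‖ ^ 2 ≤ ∑ n ∈ S, (2 / (N:ℝ)) ^ 2 := by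
          apply Finset.sum_le_sum; intro n hn; gcongr; exact hx n hn
      _ = S.card * (2 / (N:ℝ)) ^ 2 := by simp
      _ ≤ N * (2 / (N:ℝ)) ^ 2 := by
          gcongr
          have := Finset.card_le_card hSN
          simp only [Nat.card_Ioc] at this
          omega
      _ = _ := by field_simp; norm_num
  calc 200 * (T / 2 + (2 * N) ^ k) * (k:ℝ) ^ k * ∑ f ∈ Fintype.piFinset (fun _ : Fin k => S), ‖∏ i, x (f i)‖ ^ 2
      ≤ 200 * ((2 * N) ^ k + (2 * N) ^ k) * (k:ℝ) ^ k * (4 / (N:ℝ)) ^ k := by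
        gcongr
        rw [mul_pow]
        have : (1:ℝ) ≤ 2 ^ k := one_le_pow₀ (by norm_num)
        nlinarith
    _ = 400 * ((2 * N) * k * (4 / (N:ℝ))) ^ k := by rw [mul_pow, mul_pow]; ring
    _ = _ := by
        congr 2
        field_simp
        ring

lemma volume_large_values_le (S : Finset ℕ) (hS : ∀ n ∈ S, n.Prime) {N : ℕ} (hN : 1 ≤ N)
    (hSN : S ⊆ Finset.Ioc N (2 * N)) (x : ℕ → ℂ) (hx : ∀ n ∈ S, ‖x n‖ ≤ 2 / N) (k : ℕ) {T : ℝ}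
    (hT : 0 < T) (hTk : T ≤ (N:ℝ) ^ k) {η : ℝ} (hη : 0 < η) :
    MeasureTheory.volume.real
      {t : ℝ | t ∈ Set.Ioc T (2 * T) ∧ η ≤ ‖∑ n ∈ S, x n * (n:ℂ) ^ (-(t * I))‖} ≤
        400 * (8 * k / η ^ 2) ^ k := by
  have h := integral_prime_sum_pow_le S hS hN hSN x hx k hT hTk
  rw [intervalIntegral.integral_of_le (by linarith)] at h
  have hc : Continuous fun t : ℝ => ‖∑ n ∈ S, x n * (n:ℂ) ^ (-(t * I))‖ :=
    (continuous_dirichlet_sum S (fun n hn => (hS n hn).one_le) x).norm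
  have hm := MeasureTheory.mul_meas_ge_le_integral_of_nonneg
    (μ := MeasureTheory.volume.restrict (Set.Ioc T (2 * T)))
    (f := fun t : ℝ => ‖∑ n ∈ S, x n * (n:ℂ) ^ (-(t * I))‖ ^ (2 * k))
    (Eventually.of_forall fun t => by positivity)
    (((hc.pow _).intervalIntegrable T (2 * T)).1) (η ^ (2 * k))
  rw [MeasureTheory.measureReal_restrict_apply
    (measurableSet_le measurable_const (by exact (hc.pow (2 * k)).measurable))] at hm
  have hsub : MeasureTheory.volume.real
      {t : ℝ | t ∈ Set.Ioc T (2 * T) ∧ η ≤ ‖∑ n ∈ S, x n * (n:ℂ) ^ (-(t * I))‖} ≤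
      MeasureTheory.volume.real ({t : ℝ | η ^ (2 * k) ≤ ‖∑ n ∈ S, x n * (n:ℂ) ^ (-(t * I))‖ ^ (2 * k)} ∩
        Set.Ioc T (2 * T)) := by
    apply MeasureTheory.measureReal_mono
    · rintro t ⟨ht, h⟩
      exact ⟨pow_le_pow_left₀ hη.le h _, ht⟩
    · exact ((MeasureTheory.measure_mono Set.inter_subset_right).trans_lt (by simp)).ne
  have hη' : 0 < η ^ (2 * k) := by positivity
  calc _ ≤ _ := hsub
    _ ≤ 400 * (8 * k) ^ k / η ^ (2 * k) := by
        rw [le_div_iff₀ hη', mul_comm]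
        exact hm.trans h
    _ = _ := by rw [div_pow, pow_mul]; ring

section
variable {F : ℂ → ℂ} {b : ℕ → ℝ} {C : ℝ}

lemma LogPrimeSum.summable (h : LogPrimeSum F b C) {σ : ℝ} (hσ : 1 < σ) :
    Summable fun n : ℕ => b n * (n:ℝ) ^ (-σ) :=
  Summable.of_nonneg_of_le (fun n => mul_nonneg (h.nonneg n) (by positivity))
    (fun n => mul_le_mul_of_nonneg_right (h.le_two n) (by positivity))
    ((Real.summable_nat_rpow.2 (by linarith)).mul_left 2)

lemma LogPrimeSum.norm_term (h : LogPrimeSum F b C) (s : ℂ) (n : ℕ) :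
    ‖(b n : ℂ) * (n:ℂ) ^ (-s)‖ = b n * (n:ℝ) ^ (-s.re) := by
  rcases n.eq_zero_or_pos with rfl | hn
  · have : b 0 = 0 := by
      by_contra h0
      exact Nat.not_prime_zero (h.prime_of_ne_zero 0 h0)
    simp [this]
  · rw [norm_mul, norm_real, Real.norm_of_nonneg (h.nonneg n), norm_natCast_cpow_of_pos hn, neg_re]

/-- A form of Mertens' theorem. -/
lemma LogPrimeSum.sum_div_le (h : LogPrimeSum F b C) {N : ℕ} (hN : 8 ≤ N) :
    ∑ n ∈ Finset.range (N + 1), b n * (n:ℝ) ^ (-1:ℝ) ≤ Real.log (Real.log N) + (8 * |C| + 3) := by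
  have hl := two_le_log hN
  set l := Real.log N with hldef
  set e := Real.exp 1 with he
  have he0 : 0 < e := Real.exp_pos 1
  have he3 : e < 3 := by linarith [Real.exp_one_lt_d9]
  set ε : ℝ := 1 / l with hε
  have hε0 : 0 < ε := by positivity
  have hε2 : ε ≤ 1 / 2 := one_div_le_one_div_of_le (by norm_num) hl
  have hs1 := h.summable (σ := 1 + ε) (by linarith)
  have hs2 := h.summable (σ := 1 + 2 * ε) (by linarith)
  have hb1 := (abs_le.1 (h.abs_tsum_sub_le (1 + ε) (by linarith) (by linarith))).2
  have hb2 := (abs_le.1 (h.abs_tsum_sub_le (1 + 2 * ε) (by linarith) (by linarith))).1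
  have e1 : 1 / (1 + ε - 1) = l := by rw [hε]; field_simp; ring
  have e2 : 1 / (1 + 2 * ε - 1) = l / 2 := by rw [hε]; field_simp; ring
  rw [e1] at hb1
  rw [e2, Real.log_div (by linarith) (by norm_num)] at hb2
  have hx : ∀ n : ℕ, 1 ≤ n → (n:ℝ) ^ (-(1 + ε)) = (n:ℝ) ^ (-1:ℝ) * (n:ℝ) ^ (-ε) ∧
      (n:ℝ) ^ (-(1 + 2 * ε)) = (n:ℝ) ^ (-1:ℝ) * ((n:ℝ) ^ (-ε)) ^ 2 := by
    intro n hn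
    have hn0 : (0:ℝ) < n := by exact_mod_cast hn
    constructor
    · rw [← Real.rpow_add hn0]; congr 1; ring
    · rw [← Real.rpow_natCast, ← Real.rpow_mul hn0.le, ← Real.rpow_add hn0]; congr 1; push_cast; ring
  have hx1 : ∀ n : ℕ, 1 ≤ n → (n:ℝ) ^ (-ε) ≤ 1 := fun n hn =>
    Real.rpow_le_one_of_one_le_of_nonpos (by exact_mod_cast hn) (by linarith)
  have hb0 : b 0 = 0 := by
    by_contra h0
    exact Nat.not_prime_zero (h.prime_of_ne_zero 0 h0)
  have hsum : Summable fun n : ℕ => (1 + e) * (b n * (n:ℝ) ^ (-(1 + ε))) - e * (b n * (n:ℝ) ^ (-(1 + 2 * ε))) :=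
    (hs1.mul_left _).sub (hs2.mul_left _)
  calc _ ≤ ∑ n ∈ Finset.range (N + 1),
        ((1 + e) * (b n * (n:ℝ) ^ (-(1 + ε))) - e * (b n * (n:ℝ) ^ (-(1 + 2 * ε)))) := by
        apply Finset.sum_le_sum
        intro n hn
        rcases n.eq_zero_or_pos with rfl | hn1
        · simp [hb0]
        obtain ⟨h1, h2⟩ := hx n hn1
        rw [h1, h2]
        set x := (n:ℝ) ^ (-ε) with hxdef
        have hxl : 1 ≤ e * x := by
          have : e⁻¹ ≤ x := by
            rw [hxdef, Real.rpow_neg n.cast_nonneg]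
            apply inv_anti₀ (by positivity)
            rw [he, ← rpow_inv_log (t := (N:ℝ)) (by exact_mod_cast (by omega : 1 < N))]
            rw [Finset.mem_range] at hn
            exact Real.rpow_le_rpow n.cast_nonneg (by exact_mod_cast (by omega : n ≤ N)) hε0.le
          rw [inv_le_iff_one_le_mul₀' he0] at this
          exact this
        have hxu := hx1 n hn1
        have hbn : 0 ≤ b n * (n:ℝ) ^ (-1:ℝ) := mul_nonneg (h.nonneg n) (by positivity)
        have : 1 ≤ (1 + e) * x - e * x ^ 2 := by nlinarith
        nlinarith
    _ ≤ ∑' n : ℕ, ((1 + e) * (b n * (n:ℝ) ^ (-(1 + ε))) - e * (b n * (n:ℝ) ^ (-(1 + 2 * ε)))) := by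
        apply hsum.sum_le_tsum
        intro n _
        rcases n.eq_zero_or_pos with rfl | hn1
        · simp [hb0]
        obtain ⟨h1, h2⟩ := hx n hn1
        rw [h1, h2]
        set x := (n:ℝ) ^ (-ε) with hxdef
        have hxu := hx1 n hn1
        have hx0 : 0 ≤ x := by positivity
        have hbn : 0 ≤ b n * (n:ℝ) ^ (-1:ℝ) := mul_nonneg (h.nonneg n) (by positivity)
        have : 0 ≤ (1 + e) * x - e * x ^ 2 := by nlinarith [mul_nonneg he0.le (mul_nonneg hx0 (sub_nonneg.2 hxu))]
        nlinarith
    _ = (1 + e) * ∑' n : ℕ, b n * (n:ℝ) ^ (-(1 + ε)) - e * ∑' n : ℕ, b n * (n:ℝ) ^ (-(1 + 2 * ε)) := by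
        rw [Summable.tsum_sub (hs1.mul_left _) (hs2.mul_left _), tsum_mul_left, tsum_mul_left]
    _ ≤ (1 + e) * (Real.log l + |C|) - e * (Real.log l - Real.log 2 - |C|) := by
        have := le_abs_self C
        apply sub_le_sub
        · gcongr; linarith
        · gcongr; linarith
    _ ≤ _ := by
        nlinarith [Real.log_two_lt_d9, abs_nonneg C, Real.log_two_gt_d9]

end

end MSW

namespace MSW

section
variable {F : ℂ → ℂ} {b : ℕ → ℝ} {C : ℝ}

lemma LogPrimeSum.norm_tsum_le (h : LogPrimeSum F b C) {N : ℕ} (J : ℕ) (hN : 1 ≤ N) {δ : ℝ} (hδ : 0 < δ)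
    (hδ1 : δ ≤ 1) (t : ℝ) :
    ‖∑' n : ℕ, (b n : ℂ) * (n:ℂ) ^ (-((1 + δ : ℝ) + t * I : ℂ))‖ ≤
      ∑ n ∈ Finset.range (N + 1), b n * (n:ℝ) ^ (-1:ℝ) +
      ∑ j ∈ Finset.range J, ‖∑ n ∈ (Finset.Ioc (N * 2 ^ j) (2 * (N * 2 ^ j))).filter Nat.Prime,
        ((b n * (n:ℝ) ^ (-(1 + δ)) : ℝ) : ℂ) * (n:ℂ) ^ (-(t * I))‖ +
      ((2:ℝ) ^ J) ^ (-(δ / 2)) * (Real.log (2 / δ) + |C|) := by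
  have hb0 : ∀ n, ¬ n.Prime → b n = 0 := fun n hn => by
    by_contra h0
    exact hn (h.prime_of_ne_zero n h0)
  set s : ℂ := (1 + δ : ℝ) + t * I with hs
  have hsre : s.re = 1 + δ := by simp [hs]
  set f : ℕ → ℂ := fun n => (b n : ℂ) * (n:ℂ) ^ (-s) with hf
  have hfn : ∀ n, ‖f n‖ = b n * (n:ℝ) ^ (-(1 + δ)) := fun n => by
    rw [hf]; simp only []; rw [h.norm_term, hsre]
  have hsum : Summable f := Summable.of_norm (by simp_rw [hfn]; exact h.summable (by linarith))
  have hf' : ∀ n : ℕ, f n = ((b n * (n:ℝ) ^ (-(1 + δ)) : ℝ) : ℂ) * (n:ℂ) ^ (-(t * I)) := by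
    intro n
    rcases n.eq_zero_or_pos with rfl | hn
    · simp [hf, hb0 0 Nat.not_prime_zero]
    · have hn0 : (n:ℂ) ≠ 0 := by exact_mod_cast hn.ne'
      rw [ofReal_mul, ofReal_cpow n.cast_nonneg, mul_assoc, ofReal_natCast, ← cpow_add _ _ hn0]
      simp only [hf, hs]
      congr 2
      push_cast
      ring
  set M := N * 2 ^ J with hM
  have hNM : N ≤ M := Nat.le_mul_of_pos_right _ (by positivity)
  have hMpos : (0:ℝ) < M := by exact_mod_cast (by omega : 0 < M)
  have h2M : (2:ℝ) ^ J ≤ M := by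
    rw [hM]; push_cast
    exact le_mul_of_one_le_left (by positivity) (by exact_mod_cast hN)
  rw [← hsum.sum_add_tsum_nat_add (M + 1)]
  refine (norm_add_le _ _).trans (add_le_add ?_ ?_)
  · have hsplit : ∑ n ∈ Finset.range (M + 1), f n = ∑ n ∈ Finset.range (N + 1), f n +
        ∑ n ∈ Finset.Ioc N M, f n := by
      rw [Finset.range_eq_Ico, Finset.range_eq_Ico, ← Finset.sum_Ico_consecutive f (Nat.zero_le _)
        (by omega : N + 1 ≤ M + 1)]
      congr 1
      exact Finset.sum_congr (by ext n; simp only [Finset.mem_Ico, Finset.mem_Ioc]; omega) fun _ _ => rfl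
    rw [hsplit, hM, sum_Ioc_dyadic f N J]
    refine (norm_add_le _ _).trans (add_le_add ?_ ?_)
    · refine (norm_sum_le _ _).trans (Finset.sum_le_sum fun n _ => ?_)
      rw [hfn]
      rcases n.eq_zero_or_pos with rfl | hn
      · simp [hb0 0 Nat.not_prime_zero]
      · exact mul_le_mul_of_nonneg_left (Real.rpow_le_rpow_of_exponent_le (by exact_mod_cast hn)
          (by linarith)) (h.nonneg n)
    · refine (norm_sum_le _ _).trans (Finset.sum_le_sum fun j _ => le_of_eq ?_)
      congr 1
      rw [Finset.sum_filter_of_ne (p := Nat.Prime)]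
      · rw [pow_succ', mul_left_comm]
        exact Finset.sum_congr rfl fun n _ => hf' n
      · intro n _ hne
        by_contra hp
        simp [hb0 n hp] at hne
  · have hsum2 : Summable fun n : ℕ => b n * (n:ℝ) ^ (-(1 + δ / 2)) := h.summable (by linarith)
    have hsum3 := (summable_nat_add_iff (M + 1)).2 hsum2
    have hbd : ∀ n : ℕ, ‖f (n + (M + 1))‖ ≤
        (M:ℝ) ^ (-(δ / 2)) * (b (n + (M + 1)) * ((n + (M + 1) : ℕ) : ℝ) ^ (-(1 + δ / 2))) := by
      intro n
      rw [hfn]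
      set m := n + (M + 1) with hm
      have hm0 : (0:ℝ) < m := by exact_mod_cast (by omega : 0 < m)
      have : (m:ℝ) ^ (-(1 + δ)) = (m:ℝ) ^ (-(δ / 2)) * (m:ℝ) ^ (-(1 + δ / 2)) := by
        rw [← Real.rpow_add hm0]; congr 1; ring
      rw [this]
      have : (m:ℝ) ^ (-(δ / 2)) ≤ (M:ℝ) ^ (-(δ / 2)) :=
        Real.rpow_le_rpow_of_nonpos hMpos (by exact_mod_cast (by omega : M ≤ m)) (by linarith)
      calc _ = (m:ℝ) ^ (-(δ / 2)) * (b m * (m:ℝ) ^ (-(1 + δ / 2))) := by ring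
        _ ≤ _ := mul_le_mul_of_nonneg_right this (mul_nonneg (h.nonneg _) (by positivity))
    refine (tsum_of_norm_bounded (hsum3.mul_left _).hasSum hbd).trans ?_
    rw [tsum_mul_left]
    have h1 : ∑' n : ℕ, b (n + (M + 1)) * ((n + (M + 1) : ℕ) : ℝ) ^ (-(1 + δ / 2)) ≤
        ∑' n : ℕ, b n * (n:ℝ) ^ (-(1 + δ / 2)) := by
      rw [← hsum2.sum_add_tsum_nat_add (M + 1)]
      exact le_add_of_nonneg_left (Finset.sum_nonneg fun n _ => mul_nonneg (h.nonneg n) (by positivity))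
    have h2 := (abs_le.1 (h.abs_tsum_sub_le (1 + δ / 2) (by linarith) (by linarith))).2
    have e : 1 / (1 + δ / 2 - 1) = 2 / δ := by rw [add_sub_cancel_left, one_div_div]
    rw [e] at h2
    have h3 : 0 ≤ Real.log (2 / δ) := Real.log_nonneg (by rw [le_div_iff₀ hδ]; linarith)
    have h4 := le_abs_self C
    have h5 := abs_nonneg C
    apply mul_le_mul
    · exact Real.rpow_le_rpow_of_nonpos (by positivity) h2M (by linarith)
    · linarith
    · exact tsum_nonneg fun n => mul_nonneg (h.nonneg _) (by positivity)
    · positivity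

end
end MSW

namespace MSW

section
variable {F : ℂ → ℂ} {b : ℕ → ℝ} {C : ℝ}

set_option maxHeartbeats 1000000 in
/-- Off a set of measure at most `T^(1/500)` the function `F` is at least of order `1 / log log T`
on the line `Re s = 1`. -/
theorem LogPrimeSum.exists_exceptional_set (h : LogPrimeSum F b C)
    (hsub : ∃ C' : ℝ, 0 < C' ∧ ∀ t σ : ℝ, 20 ≤ t → 1 ≤ σ → σ ≤ 3 / 2 →
      ‖F (σ + t * I) - F (1 + t * I)‖ ≤ C' * (σ - 1) * Real.log t ^ 3) :
    ∃ c : ℝ, 0 < c ∧ ∀ᶠ T : ℝ in atTop, ∃ E : Set ℝ, MeasurableSet E ∧ E ⊆ Set.Ioc T (2 * T) ∧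
      MeasureTheory.volume.real E ≤ T ^ (1 / 500 : ℝ) ∧
      ∀ t ∈ Set.Ioc T (2 * T), t ∉ E → c / Real.log (Real.log T) ≤ ‖F (1 + t * I)‖ := by
  obtain ⟨C', hC', hsub⟩ := hsub
  obtain ⟨A, hA⟩ : ∃ A : ℕ, (A:ℝ) = 24000 := ⟨24000, by norm_num⟩
  set c : ℝ := Real.exp (-(8 * |C| + 5 + C)) / (4 * A) with hc
  have hApos : (0:ℝ) < A := by rw [hA]; norm_num
  have hc0 : 0 < c := by positivity
  have hlog2 : 0 < Real.log 2 := Real.log_pos one_lt_two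
  have ev1 : ∀ᶠ l : ℝ in atTop, l ^ 5 ≤ Real.exp (Real.log 2 / 2 * l) := by
    filter_upwards [(isLittleO_pow_exp_pos_mul_atTop 5 (half_pos hlog2)).bound one_pos,
      eventually_ge_atTop 0] with l hl h0
    rw [one_mul, Real.norm_of_nonneg (by positivity), Real.norm_of_nonneg (by positivity)] at hl
    exact hl
  have ev2 : ∀ᶠ l : ℝ in atTop, l ^ 6 ≤ Real.exp (1 / 1000 * l) := by
    filter_upwards [(isLittleO_pow_exp_pos_mul_atTop 6 (by norm_num : (0:ℝ) < 1 / 1000)).bound one_pos,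
      eventually_ge_atTop 0] with l hl h0
    rw [one_mul, Real.norm_of_nonneg (by positivity), Real.norm_of_nonneg (by positivity)] at hl
    exact hl
  have ev3 : ∀ c' : ℝ, 0 < c' → ∀ᶠ l : ℝ in atTop, Real.log l ≤ c' * l := by
    intro c' hc'
    filter_upwards [Real.isLittleO_log_id_atTop.bound hc', eventually_ge_atTop 1] with l hl h0
    rw [Real.norm_of_nonneg (Real.log_nonneg h0), id, Real.norm_of_nonneg (by linarith)] at hl
    exact hl
  have ev : ∀ᶠ l : ℝ in atTop, l ^ 5 ≤ Real.exp (Real.log 2 / 2 * l) ∧ l ^ 6 ≤ Real.exp (1 / 1000 * l) ∧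
      Real.log l ≤ c / (8 * C') * l ∧ Real.log l ≤ 1 / A * l ∧ 800 ≤ l ∧ |C| + 3 ≤ l := by
    filter_upwards [ev1, ev2, ev3 _ (by positivity : 0 < c / (8 * C')), ev3 _ (by positivity : 0 < 1 / (A:ℝ)),
      eventually_ge_atTop 800, eventually_ge_atTop (|C| + 3)] with l h1 h2 h3 h4 h5 h6
    exact ⟨h1, h2, h3, h4, h5, h6⟩
  refine ⟨c, hc0, ?_⟩
  filter_upwards [Real.tendsto_log_atTop.eventually ev, eventually_ge_atTop 20] with T hT hT20
  have hT0 : 0 < T := by linarith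
  set l := Real.log T with hl
  have hTl : T = Real.exp l := (Real.exp_log hT0).symm
  obtain ⟨h1, h2, h3, h4, h5, h6⟩ := hT
  set L := Real.log l with hL
  have hl0 : 0 < l := by linarith
  have hlL : l = Real.exp L := (Real.exp_log hl0).symm
  have hL1 : 1 ≤ L := by
    rw [hL, Real.le_log_iff_exp_le hl0]; linarith [Real.exp_one_lt_d9]
  set N := ⌈l ^ A⌉₊ with hN
  set J := ⌈l ^ 5⌉₊ with hJ
  set k := ⌈l / (A * L)⌉₊ with hk
  set δ : ℝ := (l ^ 4)⁻¹ with hδ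
  have hAone : 1 ≤ A := by
    have : (1:ℝ) ≤ A := by rw [hA]; norm_num
    exact_mod_cast this
  have hlA : l ≤ l ^ A := le_self_pow₀ (by linarith) (by omega)
  have hNge : l ^ A ≤ N := Nat.le_ceil _
  have hNle : (N:ℝ) ≤ 2 * l ^ A := by
    have := (Nat.ceil_lt_add_one (by positivity : 0 ≤ l ^ A)).le
    linarith
  have hl5 : l ≤ l ^ 5 := le_self_pow₀ (by linarith) (by norm_num)
  have hJge : l ^ 5 ≤ J := Nat.le_ceil _
  have hJle : (J:ℝ) ≤ 2 * l ^ 5 := by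
    have := (Nat.ceil_lt_add_one (by positivity : 0 ≤ l ^ 5)).le
    linarith
  have hkge : l / (A * L) ≤ k := Nat.le_ceil _
  have hAL : 1 ≤ l / (A * L) := by
    rw [le_div_iff₀ (by positivity)]
    have := mul_le_mul_of_nonneg_left h4 hApos.le
    have e : (A:ℝ) * (1 / A * l) = l := by field_simp
    linarith
  have hkle : (k:ℝ) ≤ 2 * (l / (A * L)) := by
    have := (Nat.ceil_lt_add_one (by positivity : 0 ≤ l / (A * L))).le
    linarith
  have hkl : (k:ℝ) ≤ l := by
    refine hkle.trans ?_
    rw [← mul_div_assoc, div_le_iff₀ (by positivity)]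
    have : 2 ≤ A * L := by rw [hA]; linarith
    nlinarith
  have hkL : L * k ≤ 1 / 12000 * l := by
    calc L * k ≤ L * (2 * (l / (A * L))) := by gcongr
      _ = 2 / A * l := by field_simp
      _ = _ := by rw [hA]; norm_num
  have hN8 : 8 ≤ N := by
    have : (8:ℝ) ≤ N := by linarith
    exact_mod_cast this
  have hJpos : (0:ℝ) < J := by linarith
  have hδ0 : 0 < δ := by positivity
  have hl4 : l ≤ l ^ 4 := le_self_pow₀ (by linarith) (by norm_num)
  have hδ1 : δ ≤ 1 / 2 := by
    rw [hδ, inv_le_comm₀ (by positivity) (by norm_num)]; linarith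
  have hTk : T ≤ (N:ℝ) ^ k := by
    calc T = Real.exp l := hTl
      _ ≤ Real.exp (L * A * k) := by
          apply Real.exp_le_exp.2
          have := mul_le_mul_of_nonneg_left hkge (by positivity : 0 ≤ L * A)
          have e : L * A * (l / (A * L)) = l := by field_simp
          linarith
      _ = (l ^ A) ^ k := by
          conv_rhs => rw [hlL]
          rw [← Real.exp_nat_mul, ← Real.exp_nat_mul]
          congr 1; ring
      _ ≤ _ := by gcongr
  clear_value N J k δ L l
  let D : ℕ → ℝ → ℂ := fun j t => ∑ n ∈ (Finset.Ioc (N * 2 ^ j) (2 * (N * 2 ^ j))).filter Nat.Prime,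
        ((b n * (n:ℝ) ^ (-(1 + δ)) : ℝ) : ℂ) * (n:ℂ) ^ (-(t * I))
  let E : ℕ → Set ℝ := fun j => {t : ℝ | t ∈ Set.Ioc T (2 * T) ∧ 1 / (J:ℝ) ≤ ‖D j t‖}
  have hEmeas : ∀ j, MeasurableSet (E j) := fun j =>
    measurableSet_Ioc.inter (measurableSet_le measurable_const
      (continuous_dirichlet_sum _ (fun n hn => (Finset.mem_filter.1 hn).2.one_le) _).norm.measurable)
  have hEvol : ∀ j, MeasureTheory.volume.real (E j) ≤ 400 * (l ^ 12) ^ k := by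
    intro j
    have hNj : 1 ≤ N * 2 ^ j := Nat.one_le_iff_ne_zero.2 (by positivity)
    have hNNj : N ≤ N * 2 ^ j := Nat.le_mul_of_pos_right _ (by positivity)
    have hNjpos : (0:ℝ) < ((N * 2 ^ j : ℕ) : ℝ) := by exact_mod_cast hNj
    refine (volume_large_values_le _ (fun n hn => (Finset.mem_filter.1 hn).2) hNj
      (Finset.filter_subset _ _) _ (fun n hn => ?_) k hT0
      (hTk.trans (by gcongr)) (by positivity : 0 < 1 / (J:ℝ))).trans ?_
    · have hn1 := (Finset.mem_Ioc.1 (Finset.mem_filter.1 hn).1).1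
      have hn2 : ((N * 2 ^ j : ℕ):ℝ) ≤ n := by exact_mod_cast hn1.le
      have hn3 : (1:ℝ) ≤ n := by exact_mod_cast (by omega : 1 ≤ n)
      rw [norm_real, Real.norm_of_nonneg (mul_nonneg (h.nonneg n) (by positivity))]
      calc b n * (n:ℝ) ^ (-(1 + δ)) ≤ 2 * (n:ℝ) ^ (-1:ℝ) := by
            exact mul_le_mul (h.le_two n) (Real.rpow_le_rpow_of_exponent_le hn3 (by linarith))
              (by positivity) (by norm_num)
        _ = 2 / n := by rw [Real.rpow_neg_one]; rfl
        _ ≤ _ := by gcongr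
    · gcongr
      calc 8 * k / (1 / (J:ℝ)) ^ 2 = 8 * k * (J:ℝ) ^ 2 := by field_simp
        _ ≤ 8 * l * (2 * l ^ 5) ^ 2 := by gcongr
        _ = 32 * l ^ 11 := by ring
        _ ≤ l * l ^ 11 := by gcongr; linarith
        _ = _ := by ring
  refine ⟨⋃ j ∈ Finset.range J, E j, Finset.measurableSet_biUnion _ fun j _ => hEmeas j,
    Set.iUnion₂_subset fun j _ t ht => ht.1, ?_, fun t ht htE => ?_⟩
  · calc _ ≤ ∑ j ∈ Finset.range J, MeasureTheory.volume.real (E j) :=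
          MeasureTheory.measureReal_biUnion_finset_le _ _
      _ ≤ ∑ j ∈ Finset.range J, 400 * (l ^ 12) ^ k := Finset.sum_le_sum fun j _ => hEvol j
      _ = J * (400 * (l ^ 12) ^ k) := by simp
      _ ≤ (2 * l ^ 5) * (400 * (l ^ 12) ^ k) := by gcongr
      _ = (800 * l ^ 5) * Real.exp (12 * (L * k)) := by
          have : (l ^ 12) ^ k = Real.exp (12 * (L * k)) := by
            conv_lhs => rw [hlL]
            rw [← Real.exp_nat_mul, ← Real.exp_nat_mul]
            congr 1; push_cast; ring
          rw [this]; ring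
      _ ≤ l ^ 6 * Real.exp (1 / 1000 * l) := by
          apply mul_le_mul _ (Real.exp_le_exp.2 (by linarith)) (by positivity) (by positivity)
          nlinarith [pow_pos hl0 5]
      _ ≤ Real.exp (1 / 1000 * l) * Real.exp (1 / 1000 * l) := by gcongr
      _ = T ^ (1 / 500 : ℝ) := by
          rw [← Real.exp_add, Real.rpow_def_of_pos hT0, ← hl]; congr 1; ring
  · have hD : ∀ j ∈ Finset.range J, ‖D j t‖ ≤ 1 / J := by
      intro j hj
      by_contra! hcon
      exact htE (Set.mem_biUnion hj ⟨ht, hcon.le⟩)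
    have hsum : ∑ j ∈ Finset.range J, ‖D j t‖ ≤ 1 := by
      refine (Finset.sum_le_sum hD).trans (le_of_eq ?_)
      rw [Finset.sum_const, Finset.card_range, nsmul_eq_mul, mul_one_div_cancel hJpos.ne']
    have htail : ((2:ℝ) ^ J) ^ (-(δ / 2)) * (Real.log (2 / δ) + |C|) ≤ 1 := by
      have e1 : ((2:ℝ) ^ J) ^ (-(δ / 2)) ≤ Real.exp (-(Real.log 2 / 2 * l)) := by
        rw [Real.rpow_def_of_pos (by positivity), Real.log_pow]
        apply Real.exp_le_exp.2
        have : l ≤ J * δ := by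
          rw [hδ, ← div_eq_mul_inv, le_div_iff₀ (by positivity)]
          calc (l:ℝ) * l ^ 4 = l ^ 5 := by ring
            _ ≤ (J:ℝ) := hJge
        nlinarith
      have e2 : Real.log (2 / δ) + |C| ≤ l ^ 5 := by
        have e3 : Real.log (2 / δ) ≤ 2 / δ := (Real.log_le_sub_one_of_pos (by positivity)).trans (by linarith)
        have e4 : 2 / δ = 2 * l ^ 4 := by rw [hδ, div_inv_eq_mul]
        have e5 : |C| ≤ |C| * l ^ 4 := le_mul_of_one_le_right (abs_nonneg C) (by linarith)
        nlinarith [pow_pos hl0 4]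
      calc _ ≤ Real.exp (-(Real.log 2 / 2 * l)) * l ^ 5 :=
            mul_le_mul e1 e2 (add_nonneg (Real.log_nonneg (by rw [le_div_iff₀ hδ0]; linarith)) (abs_nonneg C)) (by positivity)
        _ ≤ Real.exp (-(Real.log 2 / 2 * l)) * Real.exp (Real.log 2 / 2 * l) := by gcongr
        _ = 1 := by rw [← Real.exp_add]; simp
    have hP := h.norm_tsum_le J (by omega : 1 ≤ N) hδ0 (by linarith) t
    have hM := h.sum_div_le hN8
    have hF := h.neg_le_log_norm ((1 + δ : ℝ) + t * I) (by simp [hδ0])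
    set Z := F ((1 + δ : ℝ) + t * I) with hZ
    have hZ0 : 0 < ‖Z‖ := norm_pos_iff.2 (h.ne_zero _ (by simp [hδ0]))
    have hlogN : 0 < Real.log N := by linarith [two_le_log hN8]
    have hlogNle : Real.log N ≤ 2 * A * L := by
      calc Real.log N ≤ Real.log (2 * l ^ A) := Real.log_le_log (by exact_mod_cast (by omega : 0 < N)) hNle
        _ = Real.log 2 + A * L := by rw [Real.log_mul (by norm_num) (by positivity), Real.log_pow, hL]
        _ ≤ _ := by
          have : 1 ≤ A * L := by rw [hA]; linarith
          linarith [Real.log_two_lt_d9]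
    have hZlow : 2 * (c / L) ≤ ‖Z‖ := by
      have e1 : -(8 * |C| + 5 + C) - Real.log (Real.log N) ≤ Real.log ‖Z‖ := by linarith
      rw [Real.le_log_iff_exp_le hZ0, Real.exp_sub, Real.exp_log hlogN] at e1
      refine le_trans ?_ e1
      rw [hc]
      calc _ = Real.exp (-(8 * |C| + 5 + C)) / (2 * A * L) := by field_simp; norm_num
        _ ≤ _ := by gcongr
    have hs := hsub t (1 + δ) (by linarith [ht.1]) (by linarith) (by linarith)
    have hlt : Real.log t ≤ 2 * l := by
      calc Real.log t ≤ Real.log (T ^ 2) := by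
            apply Real.log_le_log (by linarith [ht.1])
            nlinarith [ht.2]
        _ = 2 * l := by rw [Real.log_pow, hl]; norm_num
    have hlt0 : 0 ≤ Real.log t := Real.log_nonneg (by linarith [ht.1])
    have hs2 : C' * (1 + δ - 1) * Real.log t ^ 3 ≤ c / L := by
      calc C' * (1 + δ - 1) * Real.log t ^ 3 ≤ C' * (1 + δ - 1) * (2 * l) ^ 3 := by
            gcongr; rw [add_sub_cancel_left]; positivity
        _ = 8 * C' / l := by rw [add_sub_cancel_left, hδ]; field_simp; ring
        _ ≤ c / L := by
          rw [div_le_div_iff₀ hl0 (by linarith)]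
          calc 8 * C' * L ≤ 8 * C' * (c / (8 * C') * l) := by gcongr
            _ = c * l := by field_simp
    have := norm_sub_norm_le Z (F (1 + t * I))
    linarith

end
end MSW

namespace MSW

section
variable {q : ℕ} [NeZero q] {χ : DirichletCharacter ℂ q}

lemma exists_norm_zl_critical_sq_le (χ : DirichletCharacter ℂ q) : ∃ C : ℝ, 0 < C ∧ ∀ t : ℝ, 10 ≤ t →
    ‖zl χ ((1/2:ℝ) + t * I)‖ ^ 2 ≤ C * t ^ (996/1000:ℝ) := by
  obtain ⟨C1, hC1, h1⟩ := norm_LFunction_critical_le (1 : DirichletCharacter ℂ 1)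
  obtain ⟨C2, hC2, h2⟩ := norm_LFunction_critical_le χ
  refine ⟨(C1 * C2) ^ 2, by positivity, fun t ht => ?_⟩
  rw [zl, norm_mul, riemannZeta_eq_LFunction]
  calc _ ≤ ((C1 * t ^ (249/1000:ℝ)) * (C2 * t ^ (249/1000:ℝ))) ^ 2 := by
        gcongr
        · exact h1 t ht
        · exact h2 t ht
    _ = (C1 * C2) ^ 2 * (t ^ (249/1000:ℝ)) ^ 4 := by ring
    _ = _ := by
        rw [← Real.rpow_natCast (t ^ (249/1000:ℝ)), ← Real.rpow_mul (by linarith)]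
        norm_num

lemma exists_le_norm_zl_one (hχ : χ ^ 2 = 1) : ∃ c T0 : ℝ, 0 < c ∧ ∀ t : ℝ, T0 ≤ t →
    c * (Real.log t ^ 16)⁻¹ ≤ ‖zl χ (1 + t * I)‖ := by
  obtain ⟨c1, T1, hc1, hT1, h1⟩ := exists_le_norm_LFunction_one (1 : DirichletCharacter ℂ 1) (one_pow 2)
  obtain ⟨c2, T2, hc2, hT2, h2⟩ := exists_le_norm_LFunction_one χ hχ
  refine ⟨c1 * c2, max T1 T2, by positivity, fun t ht => ?_⟩
  have ht1 := (le_max_left _ _).trans ht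
  have hlog : 0 < Real.log t := Real.log_pos (by linarith)
  rw [zl, norm_mul, riemannZeta_eq_LFunction]
  calc c1 * c2 * (Real.log t ^ 16)⁻¹ = (c1 * (Real.log t ^ 8)⁻¹) * (c2 * (Real.log t ^ 8)⁻¹) := by
        field_simp
    _ ≤ _ := mul_le_mul (h1 t ht1) (h2 t ((le_max_right _ _).trans ht)) (by positivity) (norm_nonneg _)

lemma div_mul_pow_le {x a b u v : ℝ} (hx : 0 ≤ x) (hu : 0 < u) (hv : 0 < v) (ha : u ≤ a) (hb : v ≤ b)
    (m₁ m₂ : ℕ) : x / (a ^ m₁ * b ^ m₂) ≤ x / (u ^ m₁ * v ^ m₂) := by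
  have ha0 : 0 < a := hu.trans_le ha
  gcongr

theorem mean_square_of_comparison (hχp : χ.IsPrimitive) (hχ1 : χ ≠ 1) (hχ : χ ^ 2 = 1) (Z : ℂ → ℂ)
    {c₁ c₂ : ℝ} (hc₁ : 0 < c₁) (hc₂ : 0 < c₂)
    (hZ₁ : ∀ t : ℝ, ‖Z ((1/2:ℝ) + t * I)‖ ≤ c₁ * ‖zl χ ((1/2:ℝ) + t * I)‖)
    (hZ₂ : ∀ t : ℝ, 1 ≤ t → c₂ * ‖zl χ (1 + t * I)‖ ≤ ‖Z (1 + t * I)‖) (m₁ m₂ : ℕ) :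
    (fun T : ℝ => ∫ t in T..(2 * T), ‖Z ((1 + t * I) / 2)‖ ^ 2 /
      (‖riemannZeta (1 + t * I)‖ ^ m₁ * ‖Z (1 + t * I)‖ ^ m₂))
      =O[atTop] fun T : ℝ => T * Real.log T ^ 2 * Real.log (Real.log T) ^ (m₁ + m₂) := by
  obtain ⟨Ca, Ta, hCa, hmom⟩ := exists_integral_zl_sq_le hχp hχ1 hχ
  obtain ⟨Cb, hCb, hcrit⟩ := exists_norm_zl_critical_sq_le χ
  obtain ⟨c3, T3, hc3, hlow1⟩ : ∃ c T0 : ℝ, 0 < c ∧ ∀ t : ℝ, T0 ≤ t →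
      c * (Real.log t ^ 8)⁻¹ ≤ ‖riemannZeta (1 + t * I)‖ := by
    obtain ⟨c, T0, hc, -, h⟩ := exists_le_norm_LFunction_one (1 : DirichletCharacter ℂ 1) (one_pow 2)
    exact ⟨c, T0, hc, fun t ht => by rw [riemannZeta_eq_LFunction]; exact h t ht⟩
  obtain ⟨c4, T4, hc4, hlow2⟩ := exists_le_norm_zl_one hχ
  obtain ⟨C5, hP1⟩ := exists_logPrimeSum_riemannZeta
  obtain ⟨C6, hP2⟩ := exists_logPrimeSum_zl hχ hχ1
  obtain ⟨c5, hc5, hE1⟩ := hP1.exists_exceptional_set (by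
    obtain ⟨C', hC', h⟩ := exists_norm_LFunction_sub_line_one_le (1 : DirichletCharacter ℂ 1)
    refine ⟨C', hC', fun t σ ht h1 h2 => ?_⟩
    rw [riemannZeta_eq_LFunction, riemannZeta_eq_LFunction]
    refine (h t σ ht h1 h2).trans ?_
    have : 1 ≤ Real.log t := by
      rw [Real.le_log_iff_exp_le (by linarith)]; linarith [Real.exp_one_lt_d9]
    have h0 : 0 ≤ C' * (σ - 1) := mul_nonneg hC'.le (by linarith)
    gcongr
    norm_num)
  obtain ⟨c6, hc6, hE2⟩ := hP2.exists_exceptional_set (exists_norm_zl_sub_line_one_le χ hχ1)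
  set K := 8 * m₁ + 16 * m₂ with hK
  set M1 : ℝ := c₁ ^ 2 / (c5 ^ m₁ * (c₂ * c6) ^ m₂) with hM1
  set M2 : ℝ := c₁ ^ 2 * Cb / (c3 ^ m₁ * (c₂ * c4) ^ m₂) with hM2
  have hM1pos : 0 < M1 := by positivity
  have hM2pos : 0 < M2 := by positivity
  have hev : ∀ᶠ T : ℝ in atTop, M2 * 2 ^ K * Real.log T ^ K * (2 * T ^ (1/500:ℝ)) * (2 * T ^ (996/1000:ℝ)) ≤ T := by
    have h0 := (isLittleO_log_rpow_rpow_atTop (K:ℝ) (by norm_num : (0:ℝ) < 2/1000)).bound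
      (by positivity : 0 < (M2 * 2 ^ K * 4)⁻¹)
    filter_upwards [h0, eventually_ge_atTop 1] with T hT hT1
    have hlog := Real.log_nonneg hT1
    rw [Real.rpow_natCast, Real.norm_of_nonneg (by positivity), Real.norm_of_nonneg (by positivity)] at hT
    have hT0 : 0 < T := by linarith
    have e : T ^ (2/1000:ℝ) * T ^ (1/500:ℝ) * T ^ (996/1000:ℝ) = T := by
      rw [← Real.rpow_add hT0, ← Real.rpow_add hT0]
      conv_rhs => rw [← Real.rpow_one T]
      norm_num
    calc _ = (M2 * 2 ^ K * 4) * Real.log T ^ K * (T ^ (1/500:ℝ) * T ^ (996/1000:ℝ)) := by ring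
      _ ≤ (M2 * 2 ^ K * 4) * ((M2 * 2 ^ K * 4)⁻¹ * T ^ (2/1000:ℝ)) * (T ^ (1/500:ℝ) * T ^ (996/1000:ℝ)) := by gcongr
      _ = T ^ (2/1000:ℝ) * T ^ (1/500:ℝ) * T ^ (996/1000:ℝ) := by field_simp
      _ = T := e
  refine IsBigO.of_bound (M1 * Ca + 1) ?_
  filter_upwards [hE1, hE2, hev, eventually_ge_atTop (2 * Ta), eventually_ge_atTop T3, eventually_ge_atTop T4,
    eventually_ge_atTop (Real.exp (Real.exp 1)), eventually_ge_atTop 20]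
    with T ⟨E1, hE1m, hE1s, hE1v, hE1b⟩ ⟨E2, hE2m, hE2s, hE2v, hE2b⟩ hT hTa hT3 hT4 hTe hT20
  have hT0 : 0 < T := by linarith
  have hlogT : Real.exp 1 ≤ Real.log T := (Real.le_log_iff_exp_le hT0).2 hTe
  have hlog1 : 1 ≤ Real.log T := by linarith [Real.add_one_le_exp (1:ℝ)]
  have hlog0 : 0 < Real.log T := by linarith
  set LL := Real.log (Real.log T) with hLL
  have hLL1 : 1 ≤ LL := (Real.le_log_iff_exp_le hlog0).2 hlogT
  have hLL0 : 0 < LL := by linarith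
  set E := E1 ∪ E2 with hE
  have hEm : MeasurableSet E := hE1m.union hE2m
  have hEs : E ⊆ Set.Ioc T (2 * T) := Set.union_subset hE1s hE2s
  have hEv : MeasureTheory.volume.real E ≤ 2 * T ^ (1/500:ℝ) := by
    refine (MeasureTheory.measureReal_union_le _ _).trans ?_
    linarith
  have hEfin : MeasureTheory.volume E ≠ ⊤ :=
    ((MeasureTheory.measure_mono hEs).trans_lt (by simp)).ne
  set B : ℝ := M2 * 2 ^ K * Real.log T ^ K * (2 * T ^ (996/1000:ℝ)) with hB
  have hB0 : 0 ≤ B := by positivity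
  let g : ℝ → ℝ := fun t => M1 * LL ^ (m₁ + m₂) * ‖zl χ ((1/2:ℝ) + (t / 2 : ℝ) * I)‖ ^ 2 + E.indicator (fun _ => B) t
  have hcont : Continuous fun t : ℝ => ‖zl χ ((1/2:ℝ) + (t / 2 : ℝ) * I)‖ ^ 2 :=
    (((continuous_zl_line hχ1 (by norm_num : (1/2:ℝ) ≠ 1)).comp
      (continuous_id.div_const (2:ℝ))).norm).pow 2
  have hg1 : IntervalIntegrable (fun t : ℝ => M1 * LL ^ (m₁ + m₂) * ‖zl χ ((1/2:ℝ) + (t / 2 : ℝ) * I)‖ ^ 2)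
      MeasureTheory.volume T (2 * T) := (hcont.const_mul _).intervalIntegrable _ _
  have hg2 : MeasureTheory.Integrable (E.indicator fun _ : ℝ => B) MeasureTheory.volume :=
    (MeasureTheory.integrable_indicator_iff hEm).2 (MeasureTheory.integrableOn_const hEfin)
  have hbound : ∀ t ∈ Set.Ioc T (2 * T), ‖‖Z ((1 + t * I) / 2)‖ ^ 2 /
      (‖riemannZeta (1 + t * I)‖ ^ m₁ * ‖Z (1 + t * I)‖ ^ m₂)‖ ≤ g t := by
    intro t ht
    rw [Real.norm_of_nonneg (by positivity)]
    have e : ((1 + t * I) / 2 : ℂ) = (1/2:ℝ) + (t / 2 : ℝ) * I := by push_cast; ring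
    rw [e]
    set z := ‖zl χ ((1/2:ℝ) + (t / 2 : ℝ) * I)‖ with hz
    have hz1 : ‖Z ((1/2:ℝ) + (t / 2 : ℝ) * I)‖ ^ 2 ≤ c₁ ^ 2 * z ^ 2 := by
      rw [← mul_pow]
      gcongr
      exact hZ₁ _
    have hZt := hZ₂ t (by linarith [ht.1])
    have hnum : 0 ≤ c₁ ^ 2 * z ^ 2 := by positivity
    have step : ∀ u v : ℝ, 0 < u → 0 < v → u ≤ ‖riemannZeta (1 + t * I)‖ → v ≤ ‖zl χ (1 + t * I)‖ →
        ‖Z ((1/2:ℝ) + (t / 2 : ℝ) * I)‖ ^ 2 / (‖riemannZeta (1 + t * I)‖ ^ m₁ * ‖Z (1 + t * I)‖ ^ m₂) ≤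
          c₁ ^ 2 * z ^ 2 / (u ^ m₁ * (c₂ * v) ^ m₂) := by
      intro u v hu hv h1 h2
      refine le_trans ?_ (div_mul_pow_le hnum hu (by positivity) h1
        ((mul_le_mul_of_nonneg_left h2 hc₂.le).trans hZt) m₁ m₂)
      gcongr
    by_cases htE : t ∈ E
    · have hlt : Real.log t ≤ 2 * Real.log T := by
        calc Real.log t ≤ Real.log (T ^ 2) := by
              apply Real.log_le_log (by linarith [ht.1])
              nlinarith [ht.2]
          _ = 2 * Real.log T := by rw [Real.log_pow]; norm_num
      have hlt0 : 0 < Real.log t := Real.log_pos (by linarith [ht.1])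
      have hzB : z ^ 2 ≤ Cb * (2 * T ^ (996/1000:ℝ)) := by
        refine (hcrit (t / 2) (by linarith [ht.1])).trans ?_
        have : (t / 2) ^ (996/1000:ℝ) ≤ T ^ (996/1000:ℝ) := by
          apply Real.rpow_le_rpow (by linarith [ht.1]) (by linarith [ht.2]) (by norm_num)
        have h0 : 0 ≤ T ^ (996/1000:ℝ) := by positivity
        gcongr
        linarith
      simp only [g, Set.indicator_of_mem htE]
      refine (step _ _ (by positivity) (by positivity) (hlow1 t (by linarith [ht.1]))
        (hlow2 t (by linarith [ht.1]))).trans ?_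
      refine le_trans ?_ (le_add_of_nonneg_left (by positivity))
      calc c₁ ^ 2 * z ^ 2 / ((c3 * (Real.log t ^ 8)⁻¹) ^ m₁ * (c₂ * (c4 * (Real.log t ^ 16)⁻¹)) ^ m₂)
          = c₁ ^ 2 / (c3 ^ m₁ * (c₂ * c4) ^ m₂) * z ^ 2 * Real.log t ^ K := by
            rw [hK, pow_add, pow_mul, pow_mul, ← mul_assoc c₂, mul_pow c3, mul_pow (c₂ * c4), inv_pow, inv_pow]
            field_simp
        _ ≤ c₁ ^ 2 / (c3 ^ m₁ * (c₂ * c4) ^ m₂) * (Cb * (2 * T ^ (996/1000:ℝ))) * (2 * Real.log T) ^ K := by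
            gcongr
        _ = B := by rw [hB, hM2, mul_pow]; ring
    · simp only [g, Set.indicator_of_notMem htE, add_zero]
      have h1 := hE1b t ht (fun h => htE (Or.inl h))
      have h2 := hE2b t ht (fun h => htE (Or.inr h))
      refine (step _ _ (by positivity) (by positivity) h1 h2).trans (le_of_eq ?_)
      rw [hM1, pow_add, ← mul_div_assoc, div_pow, div_pow, ← hz]
      field_simp
  have hI := intervalIntegral.norm_integral_le_of_norm_le (by linarith : T ≤ 2 * T)
    (Eventually.of_forall hbound) (hg1.add hg2.intervalIntegrable)
  refine hI.trans ?_
  have hint1 : ∫ t in T..(2 * T), ‖zl χ ((1/2:ℝ) + (t / 2 : ℝ) * I)‖ ^ 2 ≤ Ca * (T * Real.log T ^ 2) := by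
    have := intervalIntegral.integral_comp_div (a := T) (b := 2 * T)
      (fun t : ℝ => ‖zl χ ((1/2:ℝ) + t * I)‖ ^ 2) (two_ne_zero)
    rw [this, smul_eq_mul]
    have h2 := hmom (T / 2) (by linarith)
    have e : 2 * (T / 2) = 2 * T / 2 := by ring
    rw [e] at h2
    have hl : Real.log (T / 2) ≤ Real.log T := Real.log_le_log (by linarith) (by linarith)
    have hl0 : 0 ≤ Real.log (T / 2) := Real.log_nonneg (by linarith)
    calc _ ≤ 2 * (Ca * (T / 2 * Real.log (T / 2) ^ 2)) := by linarith
      _ ≤ 2 * (Ca * (T / 2 * Real.log T ^ 2)) := by gcongr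
      _ = _ := by ring
  have hint2 : ∫ t in T..(2 * T), E.indicator (fun _ => B) t ≤ T := by
    rw [intervalIntegral.integral_of_le (by linarith)]
    rw [MeasureTheory.setIntegral_indicator hEm, Set.inter_eq_right.2 hEs, MeasureTheory.setIntegral_const,
      smul_eq_mul]
    calc _ ≤ 2 * T ^ (1/500:ℝ) * B := by gcongr
      _ ≤ T := by rw [hB]; linarith
  rw [intervalIntegral.integral_add hg1 hg2.intervalIntegrable, intervalIntegral.integral_const_mul,
    Real.norm_of_nonneg (by positivity)]
  have hbig : T ≤ T * Real.log T ^ 2 * LL ^ (m₁ + m₂) := by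
    rw [mul_assoc]
    exact le_mul_of_one_le_right hT0.le (one_le_mul_of_one_le_of_one_le (one_le_pow₀ hlog1) (one_le_pow₀ hLL1))
  calc _ ≤ M1 * LL ^ (m₁ + m₂) * (Ca * (T * Real.log T ^ 2)) + T * Real.log T ^ 2 * LL ^ (m₁ + m₂) := by
        apply add_le_add _ (hint2.trans hbig)
        gcongr
    _ = _ := by ring

end
end MSW

namespace MSW
open NumberField

variable {K : Type*} [Field K] [NumberField K]

lemma rK_zero : rK K 0 = 0 := by
  unfold rK
  rw [Nat.card_eq_zero]
  left
  refine ⟨fun ⟨I, h1, h2⟩ => h2 (Ideal.absNorm_eq_zero_iff.1 h1)⟩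

lemma rK_eq_ncard {n : ℕ} (hn : n ≠ 0) :
    rK K n = {I : Ideal (𝓞 K) | Ideal.absNorm I = n}.ncard := by
  unfold rK
  rw [← Nat.card_coe_set_eq]
  refine Nat.card_congr (Equiv.subtypeEquivRight fun I => ⟨fun h => h.1, fun h => ⟨h, ?_⟩⟩)
  rintro rfl
  simp only [Set.mem_setOf_eq, Ideal.absNorm_bot] at h
  exact hn h.symm

lemma rK_one : rK K 1 = 1 := by
  rw [rK_eq_ncard one_ne_zero]
  simp [Ideal.absNorm_eq_one_iff]

lemma ideal_isCoprime_of_absNorm {I J : Ideal (𝓞 K)}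
    (h : (Ideal.absNorm I).Coprime (Ideal.absNorm J)) : IsCoprime I J := by
  rw [Ideal.isCoprime_iff_sup_eq, Ideal.eq_top_iff_one]
  obtain ⟨u, v, huv⟩ := Nat.isCoprime_iff_coprime.2 h
  have : (1 : 𝓞 K) = (u : 𝓞 K) * (Ideal.absNorm I : ℕ) + (v : 𝓞 K) * (Ideal.absNorm J : ℕ) := by
    exact_mod_cast (congrArg (Int.cast : ℤ → 𝓞 K) huv).symm
  rw [this]
  exact Submodule.add_mem_sup (Ideal.mul_mem_left _ _ (Ideal.absNorm_mem I))
    (Ideal.mul_mem_left _ _ (Ideal.absNorm_mem J))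

lemma dvd_span_natCast_of_absNorm_eq {I : Ideal (𝓞 K)} {n : ℕ} (h : Ideal.absNorm I = n) :
    I ∣ Ideal.span {(n : 𝓞 K)} := by
  rw [Ideal.dvd_span_singleton, ← h]
  exact Ideal.absNorm_mem I

lemma rK_mul {m n : ℕ} (h : m.Coprime n) : rK K (m * n) = rK K m * rK K n := by
  rcases eq_or_ne m 0 with rfl | hm
  · simp [rK_zero]
  rcases eq_or_ne n 0 with rfl | hn
  · simp [rK_zero]
  rw [rK_eq_ncard hm, rK_eq_ncard hn, rK_eq_ncard (mul_ne_zero hm hn), ← Set.ncard_prod]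
  symm
  refine Set.ncard_congr (fun x _ => x.1 * x.2) ?_ ?_ ?_
  · rintro ⟨I, J⟩ ⟨hI, hJ⟩
    simp only [Set.mem_setOf_eq] at hI hJ ⊢
    rw [map_mul, hI, hJ]
  · rintro ⟨I, J⟩ ⟨I', J'⟩ ⟨hI, hJ⟩ ⟨hI', hJ'⟩ he
    simp only [Set.mem_setOf_eq] at hI hJ hI' hJ' he
    have key : ∀ {I J I' J' : Ideal (𝓞 K)}, (Ideal.absNorm I).Coprime (Ideal.absNorm J') →
        I * J = I' * J' → I ∣ I' := fun hc he =>
      (ideal_isCoprime_of_absNorm hc).dvd_of_dvd_mul_right (he ▸ dvd_mul_right _ _)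
    have h1 : I = I' := dvd_antisymm (key (by rw [hI, hJ']; exact h) he)
      (key (by rw [hI', hJ]; exact h) he.symm)
    have he' : J * I = J' * I' := by rw [mul_comm, he, mul_comm]
    have h2 : J = J' := dvd_antisymm (key (by rw [hJ, hI']; exact h.symm) he')
      (key (by rw [hJ', hI]; exact h.symm) he'.symm)
    rw [h1, h2]
  · intro A hA
    simp only [Set.mem_setOf_eq] at hA
    have hd : A ∣ Ideal.span {(m : 𝓞 K)} * Ideal.span {(n : 𝓞 K)} := by
      rw [Ideal.span_singleton_mul_span_singleton]
      simpa using dvd_span_natCast_of_absNorm_eq hA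
    obtain ⟨I, J, hI, hJ, rfl⟩ := exists_dvd_and_dvd_of_dvd_mul hd
    have hI' := map_dvd Ideal.absNorm hI
    have hJ' := map_dvd Ideal.absNorm hJ
    rw [Ideal.absNorm_span_natCast] at hI' hJ'
    rw [map_mul] at hA
    have c1 : (Ideal.absNorm I).Coprime n := (h.pow_left _).of_dvd_left hI'
    have c2 : (Ideal.absNorm J).Coprime m := (h.symm.pow_left _).of_dvd_left hJ'
    have d1 : Ideal.absNorm I ∣ m := c1.dvd_of_dvd_mul_right (hA ▸ dvd_mul_right _ _)
    have d2 : Ideal.absNorm J ∣ n := c2.dvd_of_dvd_mul_left (hA ▸ dvd_mul_left _ _)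
    have d3 : m ∣ Ideal.absNorm I :=
      (c2.symm).dvd_of_dvd_mul_right (hA ▸ dvd_mul_right _ _)
    have d4 : n ∣ Ideal.absNorm J :=
      (c1.symm).dvd_of_dvd_mul_left (hA ▸ dvd_mul_left _ _)
    exact ⟨(I, J), ⟨Nat.dvd_antisymm d1 d3, Nat.dvd_antisymm d2 d4⟩, rfl⟩

/-- The three possible shapes of a rational prime in a quadratic field. -/
lemma prime_trichotomy (hK2 : Module.finrank ℚ K = 2) {p : ℕ} (hp : p.Prime) :
    (∃ P : Ideal (𝓞 K), Prime P ∧ Ideal.absNorm P = p ^ 2 ∧ Ideal.span {(p : 𝓞 K)} = P) ∨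
    (∃ P : Ideal (𝓞 K), Prime P ∧ Ideal.absNorm P = p ∧ Ideal.span {(p : 𝓞 K)} = P ^ 2) ∨
    (∃ P Q : Ideal (𝓞 K), Prime P ∧ Prime Q ∧ P ≠ Q ∧ Ideal.absNorm P = p ∧
      Ideal.absNorm Q = p ∧ Ideal.span {(p : 𝓞 K)} = P * Q) := by
  have hN : Ideal.absNorm (Ideal.span {(p : 𝓞 K)}) = p ^ 2 := by
    rw [Ideal.absNorm_span_natCast, RingOfIntegers.rank, hK2]
  have h0 : Ideal.span {(p : 𝓞 K)} ≠ ⊥ := by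
    intro h
    rw [h, Ideal.absNorm_bot] at hN
    exact (pow_ne_zero 2 hp.ne_zero) hN.symm
  have ht : Ideal.span {(p : 𝓞 K)} ≠ ⊤ := by
    intro h
    rw [h, Ideal.absNorm_top] at hN
    have := hp.one_lt
    nlinarith
  have hprime : ∀ {P : Ideal (𝓞 K)}, Ideal.absNorm P = p → Prime P := by
    intro P hP
    refine Ideal.prime_of_isPrime ?_ (Ideal.isPrime_of_irreducible_absNorm (by rw [hP]; exact hp))
    rintro rfl
    rw [Ideal.absNorm_bot] at hP
    exact hp.ne_zero hP.symm
  obtain ⟨P, hPm, hPle⟩ := Ideal.exists_le_maximal _ ht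
  obtain ⟨Q, hQ⟩ := Ideal.dvd_iff_le.2 hPle
  have hP0 : P ≠ ⊥ := by
    rintro rfl
    exact h0 (by simpa using hQ)
  have hNPQ : Ideal.absNorm P * Ideal.absNorm Q = p ^ 2 := by rw [← map_mul, ← hQ, hN]
  have hP1 : Ideal.absNorm P ≠ 1 := fun h => hPm.ne_top (Ideal.absNorm_eq_one_iff.1 h)
  obtain ⟨k, hk2, hk⟩ := (Nat.dvd_prime_pow hp).1 (hNPQ ▸ dvd_mul_right _ _)
  interval_cases k
  · simp at hk; exact absurd hk (by simpa using hP1)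
  · right
    rw [pow_one] at hk
    have hQp : Ideal.absNorm Q = p := by
      rw [hk, pow_two] at hNPQ
      exact Nat.eq_of_mul_eq_mul_left hp.pos hNPQ
    by_cases hPQ : P = Q
    · left
      exact ⟨P, hprime hk, hk, by rw [hQ, ← hPQ, pow_two]⟩
    · right
      exact ⟨P, Q, hprime hk, hprime hQp, hPQ, hk, hQp, hQ⟩
  · left
    refine ⟨P, Ideal.prime_of_isPrime hP0 hPm.isPrime, hk, ?_⟩
    rw [hk] at hNPQ
    have : Ideal.absNorm Q = 1 := Nat.eq_of_mul_eq_mul_left (pow_pos hp.pos 2) (by rw [hNPQ, mul_one])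
    rw [hQ, Ideal.absNorm_eq_one_iff.1 this, Ideal.mul_top]

lemma rK_prime_pow_of_inert {p : ℕ} (hp : p.Prime) {P : Ideal (𝓞 K)} (hP : Prime P)
    (hN : Ideal.absNorm P = p ^ 2) (hPp : Ideal.span {(p : 𝓞 K)} = P) (k : ℕ) :
    rK K (p ^ k) = if Even k then 1 else 0 := by
  rw [rK_eq_ncard (pow_ne_zero _ hp.ne_zero)]
  have : {I : Ideal (𝓞 K) | Ideal.absNorm I = p ^ k} = if Even k then {P ^ (k / 2)} else ∅ := by
    ext I
    have hI : Ideal.absNorm I = p ^ k ↔ ∃ j, 2 * j = k ∧ I = P ^ j := by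
      constructor
      · intro h
        have hd := dvd_span_natCast_of_absNorm_eq h
        rw [Nat.cast_pow, ← Ideal.span_singleton_pow, hPp] at hd
        obtain ⟨j, -, hj⟩ := (dvd_prime_pow hP _).1 hd
        rw [associated_iff_eq] at hj
        refine ⟨j, ?_, hj⟩
        rw [hj, map_pow, hN, ← pow_mul] at h
        exact Nat.pow_right_injective hp.two_le h
      · rintro ⟨j, rfl, rfl⟩
        rw [map_pow, hN, pow_mul]
    rw [Set.mem_setOf_eq, hI]
    split_ifs with he
    · obtain ⟨r, rfl⟩ := he
      constructor
      · rintro ⟨j, hj, rfl⟩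
        have : (r + r) / 2 = j := by omega
        rw [this]; rfl
      · intro h
        exact ⟨(r + r) / 2, by omega, h⟩
    · simp only [Set.mem_empty_iff_false, iff_false]
      rintro ⟨j, hj, -⟩
      exact he ⟨j, by omega⟩
  rw [this]
  split_ifs <;> simp

lemma rK_prime_pow_of_ramified {p : ℕ} (hp : p.Prime) {P : Ideal (𝓞 K)} (hP : Prime P)
    (hN : Ideal.absNorm P = p) (hPp : Ideal.span {(p : 𝓞 K)} = P ^ 2) (k : ℕ) :
    rK K (p ^ k) = 1 := by
  rw [rK_eq_ncard (pow_ne_zero _ hp.ne_zero), Set.ncard_eq_one]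
  refine ⟨P ^ k, ?_⟩
  ext I
  simp only [Set.mem_setOf_eq, Set.mem_singleton_iff]
  constructor
  · intro h
    have hd := dvd_span_natCast_of_absNorm_eq h
    rw [Nat.cast_pow, ← Ideal.span_singleton_pow, hPp, ← pow_mul] at hd
    obtain ⟨j, -, hj⟩ := (dvd_prime_pow hP _).1 hd
    rw [associated_iff_eq] at hj
    rw [hj, map_pow, hN] at h
    rw [hj, Nat.pow_right_injective hp.two_le h]
  · rintro rfl
    rw [map_pow, hN]

lemma rK_prime_pow_of_split {p : ℕ} (hp : p.Prime) {P Q : Ideal (𝓞 K)} (hP : Prime P)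
    (hQ : Prime Q) (hPQ : P ≠ Q) (hN : Ideal.absNorm P = p) (hN' : Ideal.absNorm Q = p)
    (hPp : Ideal.span {(p : 𝓞 K)} = P * Q) (k : ℕ) : rK K (p ^ k) = k + 1 := by
  rw [rK_eq_ncard (pow_ne_zero _ hp.ne_zero)]
  have hset : {I : Ideal (𝓞 K) | Ideal.absNorm I = p ^ k} =
      ((Finset.range (k + 1)).image fun a => P ^ a * Q ^ (k - a) : Finset _) := by
    ext I
    simp only [Set.mem_setOf_eq, Finset.coe_image, Finset.coe_range, Set.mem_image, Set.mem_Iio]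
    constructor
    · intro h
      have hd := dvd_span_natCast_of_absNorm_eq h
      rw [Nat.cast_pow, ← Ideal.span_singleton_pow, hPp, mul_pow] at hd
      obtain ⟨A, B, hA, hB, rfl⟩ := exists_dvd_and_dvd_of_dvd_mul hd
      obtain ⟨a, -, ha⟩ := (dvd_prime_pow hP _).1 hA
      obtain ⟨b, -, hb⟩ := (dvd_prime_pow hQ _).1 hB
      rw [associated_iff_eq] at ha hb
      rw [ha, hb, map_mul, map_pow, map_pow, hN, hN', ← pow_add] at h
      have hab := Nat.pow_right_injective hp.two_le h
      refine ⟨a, by omega, ?_⟩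
      rw [ha, hb, show k - a = b by omega]
    · rintro ⟨a, ha, rfl⟩
      rw [map_mul, map_pow, map_pow, hN, hN', ← pow_add]
      congr 1; omega
  rw [hset, Set.ncard_coe_finset, Finset.card_image_of_injOn, Finset.card_range]
  have key : ∀ a b : ℕ, a < b → b ≤ k → P ^ a * Q ^ (k - a) ≠ P ^ b * Q ^ (k - b) := by
    intro a b hab hbk he
    obtain ⟨c, rfl⟩ := Nat.exists_eq_add_of_lt hab
    rw [pow_add _ (a + c), pow_add, mul_assoc, mul_assoc] at he
    have he' := mul_left_cancel₀ (pow_ne_zero a hP.ne_zero) he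
    have : P ∣ Q ^ (k - a) := by
      rw [he', pow_one]
      exact dvd_mul_of_dvd_right (dvd_mul_right _ _) _
    have h3 := (hP.dvd_prime_iff_associated hQ).1 (hP.dvd_of_dvd_pow this)
    exact hPQ (associated_iff_eq.1 h3)
  intro a ha b hb he
  simp only [Finset.coe_range, Set.mem_Iio] at ha hb
  rcases lt_trichotomy a b with h | h | h
  · exact absurd he (key a b h (by omega))
  · exact h
  · exact absurd he.symm (key b a h (by omega))

/-- The local splitting symbol of a quadratic field, as an integer. -/
noncomputable def eps (K : Type*) [Field K] [NumberField K] (p : ℕ) : ℤ := (rK K p : ℤ) - 1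

lemma eps_cases_and_rK_prime_pow (hK2 : Module.finrank ℚ K = 2) {p : ℕ} (hp : p.Prime) :
    (eps K p = -1 ∨ eps K p = 0 ∨ eps K p = 1) ∧
    ∀ k, (rK K (p ^ k) : ℤ) = ∑ j ∈ Finset.range (k + 1), eps K p ^ j := by
  rcases prime_trichotomy hK2 hp with ⟨P, hP, hN, h⟩ | ⟨P, hP, hN, h⟩ | ⟨P, Q, hP, hQ, hPQ, hN, hN', h⟩
  · have hk := rK_prime_pow_of_inert hp hP hN h
    have he : eps K p = -1 := by
      have := hk 1
      simp at this
      simp [eps, this]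
    refine ⟨Or.inl he, fun k => ?_⟩
    rw [hk, he, neg_one_geom_sum]
    simp only [Nat.even_add_one]
    split_ifs <;> simp
  · have hk := rK_prime_pow_of_ramified hp hP hN h
    have he : eps K p = 0 := by
      have := hk 1
      simp at this
      simp [eps, this]
    refine ⟨Or.inr (Or.inl he), fun k => ?_⟩
    rw [hk, he, Finset.sum_range_succ', Finset.sum_eq_zero] <;> simp
  · have hk := rK_prime_pow_of_split hp hP hQ hPQ hN hN' h
    have he : eps K p = 1 := by
      have := hk 1
      simp at this
      simp [eps, this]
    refine ⟨Or.inr (Or.inr he), fun k => ?_⟩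
    rw [hk, he]
    simp

end MSW

namespace MSW
open NumberField

variable {K : Type*} [Field K] [NumberField K]

lemma exists_sq_eq_int (hK2 : Module.finrank ℚ K = 2) :
    ∃ (θ : 𝓞 K) (d : ℤ), d ≠ 0 ∧ θ ^ 2 = (d : 𝓞 K) ∧ Algebra.trace ℚ K (θ : K) = 0 := by
  haveI : Algebra.IsQuadraticExtension ℚ K := ⟨hK2⟩
  have hprim : (primitiveRoots (Module.finrank ℚ K) ℚ).Nonempty := by
    rw [hK2]
    exact ⟨-1, (mem_primitiveRoots two_pos).2 (IsPrimitiveRoot.neg_one 0 (by norm_num))⟩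
  obtain ⟨α, ⟨r, hr⟩, hα⟩ := exists_root_adjoin_eq_top_of_isCyclic ℚ K hprim
  have hirr := irreducible_X_pow_sub_C_of_root_adjoin_eq_top hr.symm hα
  rw [hK2] at hr hirr
  have hmin : Polynomial.X ^ 2 - Polynomial.C r = minpoly ℚ α :=
    minpoly.eq_of_irreducible_of_monic hirr (by simp [hr]) (Polynomial.monic_X_pow_sub_C r two_ne_zero)
  have htr : Algebra.trace ℚ K α = 0 := by
    rw [trace_eq_finrank_mul_minpoly_nextCoeff, ← hmin, Polynomial.nextCoeff_of_natDegree_pos]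
    · rw [Polynomial.natDegree_X_pow_sub_C]
      simp
    · rw [Polynomial.natDegree_X_pow_sub_C]; norm_num
  have hr0 : r ≠ 0 := by
    rintro rfl
    rw [Polynomial.C_0, sub_zero] at hirr
    exact not_irreducible_pow (by norm_num) hirr
  have hsq : ((r.den : K) * α) ^ 2 = ((r.num * r.den : ℤ) : K) := by
    rw [mul_pow, ← hr]
    have : (r.den : ℚ) ^ 2 * r = ((r.num * r.den : ℤ) : ℚ) := by
      push_cast
      nth_rewrite 2 [← Rat.num_div_den r]
      field_simp
    have h2 := congrArg (algebraMap ℚ K) this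
    simpa using h2
  have hint : IsIntegral ℤ ((r.den : K) * α) := by
    refine IsIntegral.of_pow two_pos ?_
    rw [hsq]
    exact isIntegral_algebraMap (R := ℤ) (A := K)
  refine ⟨⟨(r.den : K) * α, hint⟩, r.num * r.den, ?_, ?_, ?_⟩
  · exact mul_ne_zero (Rat.num_ne_zero.2 hr0) (by exact_mod_cast r.den_nz)
  · apply RingOfIntegers.ext
    change ((r.den : K) * α) ^ 2 = algebraMap (𝓞 K) K ((r.num * r.den : ℤ) : 𝓞 K)
    rw [hsq, map_intCast]
  · change Algebra.trace ℚ K ((r.den : K) * α) = 0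
    have : (r.den : K) * α = (r.den : ℚ) • α := by rw [Algebra.smul_def]; simp
    rw [this, map_smul, htr, smul_zero]

lemma not_natCast_dvd_sub (hK2 : Module.finrank ℚ K = 2) {θ : 𝓞 K}
    (htr : Algebra.trace ℚ K (θ : K) = 0) {p : ℕ} {a : ℤ} (h : ¬ (p : ℤ) ∣ 2 * a) :
    ¬ (p : 𝓞 K) ∣ θ - a := by
  rintro ⟨β, hβ⟩
  have h1 : (θ : K) - a = (p : K) * β := by
    have := congrArg (fun x : 𝓞 K => (x : K)) hβ
    simpa using this
  have h2 := congrArg (Algebra.trace ℚ K) h1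
  have e1 : (p : K) * (β : K) = (p : ℚ) • (β : K) := by rw [Algebra.smul_def]; simp
  have e2 : (a : K) = algebraMap ℚ K a := by simp
  rw [map_sub, htr, e1, map_smul, e2, Algebra.trace_algebraMap, hK2] at h2
  obtain ⟨b, hb⟩ := IsIntegrallyClosed.isIntegral_iff.1
    (Algebra.isIntegral_trace (L := ℚ) (RingOfIntegers.isIntegral_coe β))
  rw [← hb] at h2
  apply h
  refine ⟨-b, ?_⟩
  have : -(2 * (a : ℚ)) = p * b := by simpa using h2
  have h3 : -(2 * a) = p * b := by exact_mod_cast this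
  linarith

lemma intCast_dvd_of_mem {P : Ideal (𝓞 K)} {p : ℕ} (hp : p.Prime) (hP : P ≠ ⊤) (hpP : (p : 𝓞 K) ∈ P)
    {z : ℤ} (hz : (z : 𝓞 K) ∈ P) : (p : ℤ) ∣ z := by
  by_contra hnd
  obtain ⟨u, v, huv⟩ := (Int.isCoprime_iff_gcd_eq_one.2
    (Int.isCoprime_iff_gcd_eq_one.1 ((Nat.prime_iff_prime_int.1 hp).coprime_iff_not_dvd.2 hnd)))
  apply hP
  rw [Ideal.eq_top_iff_one]
  have : (1 : 𝓞 K) = (u : 𝓞 K) * (p : 𝓞 K) + (v : 𝓞 K) * (z : 𝓞 K) := by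
    exact_mod_cast (congrArg (Int.cast : ℤ → 𝓞 K) huv).symm
  rw [this]
  exact P.add_mem (P.mul_mem_left _ hpP) (P.mul_mem_left _ hz)

lemma exists_intCast_sub_mem {P : Ideal (𝓞 K)} {p : ℕ} (hp : p.Prime) (hN : Ideal.absNorm P = p)
    (x : 𝓞 K) : ∃ a : ℤ, x - a ∈ P := by
  haveI : Fact p.Prime := ⟨hp⟩
  have hc : Nat.card (𝓞 K ⧸ P) = p := by
    rw [← hN]; rfl
  haveI : Finite (𝓞 K ⧸ P) := Nat.finite_of_card_ne_zero (by rw [hc]; exact hp.ne_zero)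
  have hbij : Function.Surjective (Int.cast : ℤ → 𝓞 K ⧸ P) := by
    letI := Fintype.ofFinite (𝓞 K ⧸ P)
    have hc' : Fintype.card (𝓞 K ⧸ P) = p := by rw [← Nat.card_eq_fintype_card, hc]
    intro y
    obtain ⟨z, hz⟩ := (ZMod.ringEquivOfPrime (𝓞 K ⧸ P) hp hc').surjective y
    obtain ⟨a, rfl⟩ := ZMod.intCast_surjective z
    exact ⟨a, by rw [← hz]; simp⟩
  obtain ⟨a, ha⟩ := hbij (Ideal.Quotient.mk P x)
  refine ⟨a, ?_⟩
  rw [← Ideal.Quotient.eq, ← ha]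
  simp

lemma eps_eq_legendreSym (hK2 : Module.finrank ℚ K = 2) {θ : 𝓞 K} {d : ℤ}
    (hθ : θ ^ 2 = (d : 𝓞 K)) (htr : Algebra.trace ℚ K (θ : K) = 0) {p : ℕ} [Fact p.Prime]
    (hpd : ¬ (p : ℤ) ∣ 2 * d) : eps K p = legendreSym p d := by
  have hp : p.Prime := Fact.out
  have hpp : Prime (p : ℤ) := Nat.prime_iff_prime_int.1 hp
  have hp2 : ¬ (p : ℤ) ∣ 2 := fun h => hpd (h.mul_right _)
  have hd : ¬ (p : ℤ) ∣ d := fun h => hpd (h.mul_left _)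
  have hd0 : ((d : ℤ) : ZMod p) ≠ 0 := by
    rwa [Ne, ZMod.intCast_zmod_eq_zero_iff_dvd]
  have hsq_of : ∀ {P : Ideal (𝓞 K)}, Prime P → Ideal.absNorm P = p → legendreSym p d = 1 := by
    intro P hP hN
    obtain ⟨a, ha⟩ := exists_intCast_sub_mem hp hN θ
    rw [legendreSym.eq_one_iff p hd0]
    have hm : ((d - a ^ 2 : ℤ) : 𝓞 K) ∈ P := by
      have : ((d - a ^ 2 : ℤ) : 𝓞 K) = (θ + a) * (θ - a) := by
        push_cast; rw [← hθ]; ring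
      rw [this]
      exact P.mul_mem_left _ ha
    have := intCast_dvd_of_mem hp (fun h => hP.not_isUnit (Ideal.isUnit_iff.2 h))
      (hN ▸ Ideal.absNorm_mem P) hm
    refine ⟨(a : ZMod p), ?_⟩
    rw [← ZMod.intCast_zmod_eq_zero_iff_dvd] at this
    push_cast at this
    linear_combination this
  have hnot : ∀ {P : Ideal (𝓞 K)} (m : ℕ), Prime P → Ideal.span {(p : 𝓞 K)} = P ^ m → m ≠ 0 →
      legendreSym p d ≠ 1 := by
    intro P m hP hPm hm0 hl
    rw [legendreSym.eq_one_iff p hd0] at hl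
    obtain ⟨x, hx⟩ := hl
    obtain ⟨a, rfl⟩ := ZMod.intCast_surjective x
    have hpa : (p : ℤ) ∣ d - a ^ 2 := by
      rw [← ZMod.intCast_zmod_eq_zero_iff_dvd]; push_cast; rw [hx]; ring
    have ha2 : ¬ (p : ℤ) ∣ 2 * a := by
      intro h
      rcases hpp.dvd_or_dvd h with h | h
      · exact hp2 h
      · apply hd
        have := dvd_add hpa (h.trans (Dvd.intro_left a (by ring : a * a = a ^ 2)))
        simpa using this
    have hpP : (p : 𝓞 K) ∈ P := by
      have : P ∣ Ideal.span {(p : 𝓞 K)} := hPm ▸ dvd_pow_self P hm0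
      rwa [Ideal.dvd_span_singleton] at this
    have hPt : P ≠ ⊤ := fun h => hP.not_isUnit (Ideal.isUnit_iff.2 h)
    have hprod : P ^ m ∣ Ideal.span {θ - a} * Ideal.span {θ + a} := by
      rw [← hPm, Ideal.span_singleton_mul_span_singleton, Ideal.dvd_span_singleton, Ideal.mem_span_singleton]
      obtain ⟨c, hc⟩ := hpa
      refine ⟨c, ?_⟩
      have : ((d - a ^ 2 : ℤ) : 𝓞 K) = (p : 𝓞 K) * c := by rw [hc]; push_cast; rfl
      rw [← this]; push_cast; rw [← hθ]; ring
    have hone : ¬ P ∣ Ideal.span {θ - (a : 𝓞 K)} ∨ ¬ P ∣ Ideal.span {θ + (a : 𝓞 K)} := by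
      by_contra hcon
      push Not at hcon
      obtain ⟨h1, h2⟩ := hcon
      rw [Ideal.dvd_span_singleton] at h1 h2
      apply ha2
      refine intCast_dvd_of_mem hp hPt hpP ?_
      have := P.sub_mem h2 h1
      have e : ((2 * a : ℤ) : 𝓞 K) = θ + a - (θ - a) := by push_cast; ring
      rwa [e]
    rcases hone with h | h
    · have := hP.pow_dvd_of_dvd_mul_left m h hprod
      rw [← hPm, Ideal.dvd_span_singleton, Ideal.mem_span_singleton] at this
      refine not_natCast_dvd_sub hK2 htr (a := -a) (by simpa using ha2) ?_
      simpa using this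
    · have := hP.pow_dvd_of_dvd_mul_right m h hprod
      rw [← hPm, Ideal.dvd_span_singleton, Ideal.mem_span_singleton] at this
      exact not_natCast_dvd_sub hK2 htr ha2 this
  rcases prime_trichotomy hK2 hp with ⟨P, hP, hN, h⟩ | ⟨P, hP, hN, h⟩ | ⟨P, Q, hP, hQ, hPQ, hN, hN', h⟩
  · have hk := rK_prime_pow_of_inert hp hP hN h 1
    simp at hk
    have := (legendreSym.eq_one_or_neg_one p hd0).resolve_left (hnot 1 hP (by rw [h, pow_one]) one_ne_zero)
    rw [eps, hk, this]; norm_num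
  · exact absurd (hsq_of hP hN) (hnot 2 hP h two_ne_zero)
  · have hk := rK_prime_pow_of_split hp hP hQ hPQ hN hN' h 1
    simp at hk
    rw [eps, hk, hsq_of hP hN]; norm_num

end MSW

namespace MSW

lemma odd_of_coprime_four_mul {n m : ℕ} (h : n.Coprime (4 * m)) : Odd n :=
  Nat.coprime_two_right.1 (h.of_dvd_right ⟨2 * m, by ring⟩)

/-- The Jacobi symbol `n ↦ (d / n)` as a homomorphism on units modulo `4|d|`. -/
noncomputable def jacobiHom (d : ℤ) [NeZero (4 * d.natAbs)] : (ZMod (4 * d.natAbs))ˣ →* ℂ where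
  toFun u := (jacobiSym d (u : ZMod (4 * d.natAbs)).val : ℂ)
  map_one' := by
    have h1 : ((1 : (ZMod (4 * d.natAbs))ˣ) : ZMod (4 * d.natAbs)) = ((1 : ℕ) : ZMod (4 * d.natAbs)) := by
      simp
    rw [h1, ZMod.val_natCast, ← jacobiSym.mod_right d odd_one, jacobiSym.one_right]
    simp
  map_mul' u v := by
    have hodd : ∀ u : (ZMod (4 * d.natAbs))ˣ, Odd (u : ZMod (4 * d.natAbs)).val := fun u =>
      odd_of_coprime_four_mul (ZMod.val_coe_unit_coprime u)
    rw [Units.val_mul, ZMod.val_mul, ← jacobiSym.mod_right d ((hodd u).mul (hodd v)),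
      jacobiSym.mul_right' d (by have := hodd u; intro h; simp [h] at this)
        (by have := hodd v; intro h; simp [h] at this)]
    push_cast
    rfl

lemma exists_quadratic_character {d : ℤ} (hd : d ≠ 0) :
    ∃ (q : ℕ) (_ : NeZero q) (χ : DirichletCharacter ℂ q), χ.IsPrimitive ∧ χ ^ 2 = 1 ∧
      ∀ p : ℕ, ∀ _ : Fact p.Prime, ¬ (p : ℤ) ∣ 2 * d → χ p = (legendreSym p d : ℂ) := by
  haveI : NeZero (4 * d.natAbs) := ⟨by simpa using hd⟩
  set χ₀ : DirichletCharacter ℂ (4 * d.natAbs) := MulChar.ofUnitHom (jacobiHom d).toHomUnits with hχ₀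
  have hval : ∀ n : ℕ, Odd n → n.Coprime (4 * d.natAbs) → χ₀ n = (jacobiSym d n : ℂ) := by
    intro n ho hn
    have : (n : ZMod (4 * d.natAbs)) = (ZMod.unitOfCoprime n hn : ZMod _) := by simp
    rw [this, hχ₀, MulChar.ofUnitHom_coe]
    change (jacobiSym d (ZMod.unitOfCoprime n hn : ZMod (4 * d.natAbs)).val : ℂ) = _
    rw [ZMod.coe_unitOfCoprime, ZMod.val_natCast, ← jacobiSym.mod_right d ho]
  have hsq : χ₀ ^ 2 = 1 := by
    ext u
    rw [MulChar.pow_apply_coe, MulChar.one_apply_coe]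
    have hc := ZMod.val_coe_unit_coprime u
    have ho : Odd (u : ZMod (4 * d.natAbs)).val :=
      odd_of_coprime_four_mul hc
    have := hval _ ho hc
    rw [ZMod.natCast_zmod_val] at this
    rw [this]
    have hg : d.gcd ((u : ZMod (4 * d.natAbs)).val) = 1 := by
      rw [Int.gcd]
      exact (hc.coprime_mul_left_right).symm
    exact_mod_cast jacobiSym.sq_one hg
  refine ⟨χ₀.conductor, ⟨χ₀.conductor_ne_zero⟩, χ₀.primitiveCharacter, χ₀.primitiveCharacter_isPrimitive, ?_, ?_⟩
  · apply DirichletCharacter.changeLevel_injective χ₀.conductor_dvd_level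
    rw [map_pow, DirichletCharacter.changeLevel_primitiveCharacter, hsq, map_one]
  · intro p hp hpd
    have hp2 : p ≠ 2 := by
      rintro rfl
      exact hpd (by simp)
    have hcop : p.Coprime (4 * d.natAbs) := by
      rw [hp.out.coprime_iff_not_dvd]
      intro h
      rcases hp.out.dvd_mul.1 h with h | h
      · rw [show 4 = 2 ^ 2 by norm_num] at h
        exact hp2 ((Nat.prime_dvd_prime_iff_eq hp.out Nat.prime_two).1 (hp.out.dvd_of_dvd_pow h))
      · exact hpd ((Int.natCast_dvd.2 h).mul_left 2)
    have := DirichletCharacter.primitiveCharacter_apply_of_isCoprime (χ := χ₀) (a := (p : ℤ))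
      (Nat.isCoprime_iff_coprime.2 hcop)
    simp only [Int.cast_natCast] at this
    rw [this, hval p (hp.out.odd_of_ne_two hp2) hcop, jacobiSym.legendreSym.to_jacobiSym]

end MSW

namespace MSW
open NumberField ArithmeticFunction
open scoped ArithmeticFunction.zeta

variable {K : Type*} [Field K] [NumberField K]

/-- The completely multiplicative function extending a function on the primes. -/
noncomputable def primeExt (e : ℕ → ℂ) : ℕ →*₀ ℂ where
  toFun n := if n = 0 then 0 else n.factorization.prod fun p k => e p ^ k
  map_zero' := by simp
  map_one' := by simp
  map_mul' m n := by
    by_cases hm : m = 0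
    · simp [hm]
    by_cases hn : n = 0
    · simp [hn]
    rw [if_neg hm, if_neg hn, if_neg (mul_ne_zero hm hn), Nat.factorization_mul hm hn,
      Finsupp.prod_add_index' (by simp) (fun p a b => pow_add _ a b)]

lemma primeExt_prime (e : ℕ → ℂ) {p : ℕ} (hp : p.Prime) : primeExt e p = e p := by
  change (if p = 0 then 0 else p.factorization.prod fun p k => e p ^ k) = _
  rw [if_neg hp.ne_zero, hp.factorization, Finsupp.prod_single_index (by simp), pow_one]

lemma norm_primeExt_le_one {e : ℕ → ℂ} (he : ∀ p : ℕ, p.Prime → ‖e p‖ ≤ 1) (n : ℕ) :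
    ‖primeExt e n‖ ≤ 1 := by
  change ‖(if n = 0 then 0 else n.factorization.prod fun p k => e p ^ k)‖ ≤ 1
  split_ifs with hn
  · simp
  · rw [Finsupp.prod, norm_prod]
    refine Finset.prod_le_one (fun _ _ => norm_nonneg _) fun p hp => ?_
    rw [norm_pow]
    exact pow_le_one₀ (norm_nonneg _)
      (he p (Nat.prime_of_mem_primeFactors (by simpa using hp)))

/-- The Euler product of a completely multiplicative function bounded by one. -/
lemma hasProd_LSeries_primeExt {e : ℕ → ℂ} (he : ∀ p : ℕ, p.Prime → ‖e p‖ ≤ 1) {s : ℂ}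
    (hs : 1 < s.re) :
    HasProd (fun p : Nat.Primes => (1 - e p * (p : ℂ) ^ (-s))⁻¹) (LSeries (primeExt e) s) := by
  let f : ℕ →*₀ ℂ := primeExt e * riemannZetaSummandHom (ne_zero_of_one_lt_re hs)
  have hf : ∀ n : ℕ, f n = primeExt e n * (n : ℂ) ^ (-s) := fun n => rfl
  have hsum : Summable (‖f ·‖) := by
    refine (summable_riemannZetaSummand hs).of_nonneg_of_le (fun _ => norm_nonneg _) fun n => ?_
    change ‖primeExt e n * _‖ ≤ _
    rw [norm_mul]
    exact mul_le_of_le_one_left (norm_nonneg _) (norm_primeExt_le_one he n)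
  have h := EulerProduct.eulerProduct_completely_multiplicative_hasProd hsum
  convert h using 1
  · funext p
    rw [hf, primeExt_prime e p.2]
  · rw [LSeries]
    refine tsum_congr fun n => ?_
    rw [hf, LSeries.term_of_ne_zero' (ne_zero_of_one_lt_re hs), cpow_neg, div_eq_mul_inv]

/-- The finite product of Euler factors (in the denominator) over the primes in `S`. -/
noncomputable def eulerFactor (e : ℕ → ℂ) (S : Finset Nat.Primes) (s : ℂ) : ℂ :=
  ∏ p ∈ S, (1 - e p * (p : ℂ) ^ (-s))

lemma norm_natCast_prime_cpow (p : Nat.Primes) (s : ℂ) : ‖(p : ℂ) ^ (-s)‖ = (p : ℝ) ^ (-s.re) := by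
  have := Complex.norm_natCast_cpow_of_pos p.2.pos (-s)
  simpa using this

lemma norm_mul_prime_cpow_le {e : ℕ → ℂ} (he : ∀ p : ℕ, p.Prime → ‖e p‖ ≤ 1) (p : Nat.Primes) (s : ℂ) :
    ‖e p * (p : ℂ) ^ (-s)‖ ≤ (p : ℝ) ^ (-s.re) := by
  rw [norm_mul, norm_natCast_prime_cpow]
  exact mul_le_of_le_one_left (by positivity) (he p p.2)

lemma prime_rpow_neg_lt_one (p : Nat.Primes) {σ : ℝ} (hσ : 0 < σ) : (p : ℝ) ^ (-σ) < 1 :=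
  Real.rpow_lt_one_of_one_lt_of_neg (by exact_mod_cast p.2.one_lt) (by linarith)

lemma norm_eulerFactor_le {e : ℕ → ℂ} (he : ∀ p : ℕ, p.Prime → ‖e p‖ ≤ 1) (S : Finset Nat.Primes)
    {s : ℂ} (hs : 0 < s.re) : ‖eulerFactor e S s‖ ≤ 2 ^ S.card := by
  rw [eulerFactor, norm_prod]
  rw [← Finset.prod_const]
  refine Finset.prod_le_prod (fun _ _ => norm_nonneg _) fun p _ => ?_
  have h1 := norm_mul_prime_cpow_le he p s
  have h2 := prime_rpow_neg_lt_one p hs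
  have h3 := norm_sub_le 1 (e p * (p : ℂ) ^ (-s))
  rw [norm_one] at h3
  linarith

lemma le_norm_eulerFactor {e : ℕ → ℂ} (he : ∀ p : ℕ, p.Prime → ‖e p‖ ≤ 1) (S : Finset Nat.Primes)
    {s : ℂ} (hs : 0 < s.re) : ∏ p ∈ S, (1 - (p : ℝ) ^ (-s.re)) ≤ ‖eulerFactor e S s‖ := by
  rw [eulerFactor, norm_prod]
  refine Finset.prod_le_prod (fun p _ => ?_) fun p _ => ?_
  · linarith [prime_rpow_neg_lt_one p hs]
  · have h1 := norm_mul_prime_cpow_le he p s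
    have h3 := norm_sub_norm_le 1 (e p * (p : ℂ) ^ (-s))
    rw [norm_one] at h3
    linarith

lemma prod_one_sub_prime_rpow_pos (S : Finset Nat.Primes) {σ : ℝ} (hσ : 0 < σ) :
    0 < ∏ p ∈ S, (1 - (p : ℝ) ^ (-σ)) :=
  Finset.prod_pos fun p _ => by linarith [prime_rpow_neg_lt_one p hσ]

lemma eulerFactor_ne_zero {e : ℕ → ℂ} (he : ∀ p : ℕ, p.Prime → ‖e p‖ ≤ 1) (S : Finset Nat.Primes)
    {s : ℂ} (hs : 0 < s.re) : eulerFactor e S s ≠ 0 :=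
  norm_pos_iff.1 ((prod_one_sub_prime_rpow_pos S hs).trans_le (le_norm_eulerFactor he S hs))

lemma differentiable_eulerFactor (e : ℕ → ℂ) (S : Finset Nat.Primes) :
    Differentiable ℂ (eulerFactor e S) := by
  unfold eulerFactor
  have h : ∀ p ∈ S, Differentiable ℂ fun s : ℂ => 1 - e p * (p : ℂ) ^ (-s) := fun p _ =>
    ((differentiable_id.neg.const_cpow (Or.inl (by exact_mod_cast p.2.ne_zero))).const_mul _).const_sub _
  simpa using Differentiable.fun_finsetProd h

/-- Two Euler products that differ only at finitely many primes. -/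
lemma mul_eulerFactor_eq {e e' : ℕ → ℂ} (he : ∀ p : ℕ, p.Prime → ‖e p‖ ≤ 1)
    (he' : ∀ p : ℕ, p.Prime → ‖e' p‖ ≤ 1) {S : Finset Nat.Primes}
    (hS : ∀ p : Nat.Primes, p ∉ S → e p = e' p) {s a b : ℂ} (hs : 0 < s.re)
    (ha : HasProd (fun p : Nat.Primes => (1 - e p * (p : ℂ) ^ (-s))⁻¹) a)
    (hb : HasProd (fun p : Nat.Primes => (1 - e' p * (p : ℂ) ^ (-s))⁻¹) b) :
    a * eulerFactor e S s = b * eulerFactor e' S s := by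
  classical
  have hfin : ∀ e : ℕ → ℂ, HasProd (fun p : Nat.Primes => if p ∈ S then 1 - e p * (p : ℂ) ^ (-s) else 1)
      (eulerFactor e S s) := by
    intro e
    have h := hasProd_prod_of_ne_finset_one (s := S)
      (f := fun p : Nat.Primes => if p ∈ S then 1 - e p * (p : ℂ) ^ (-s) else 1)
      (L := .unconditional _) (fun p hp => if_neg hp)
    convert h using 1
    exact Finset.prod_congr rfl fun p hp => (if_pos hp).symm
  have hne : ∀ {e : ℕ → ℂ}, (∀ p : ℕ, p.Prime → ‖e p‖ ≤ 1) → ∀ p : Nat.Primes,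
      1 - e p * (p : ℂ) ^ (-s) ≠ 0 := by
    intro e he p h
    have h1 := norm_mul_prime_cpow_le he p s
    rw [← sub_eq_zero.1 h, norm_one] at h1
    exact absurd (prime_rpow_neg_lt_one p hs) (not_lt.2 h1)
  refine (ha.mul (hfin e)).unique ?_
  convert hb.mul (hfin e') using 1
  funext p
  split_ifs with hp
  · rw [inv_mul_cancel₀ (hne he p), inv_mul_cancel₀ (hne he' p)]
  · rw [hS p hp]

lemma norm_eps_le_one (hK2 : Module.finrank ℚ K = 2) {p : ℕ} (hp : p.Prime) :
    ‖((eps K p : ℤ) : ℂ)‖ ≤ 1 := by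
  rcases (eps_cases_and_rK_prime_pow hK2 hp).1 with h | h | h <;> simp [h]

lemma LSeries_rK_eq (hK2 : Module.finrank ℚ K = 2) {s : ℂ} (hs : 1 < s.re) :
    LSeries (fun n => (rK K n : ℂ)) s =
      riemannZeta s * LSeries (primeExt fun p => ((eps K p : ℤ) : ℂ)) s := by
  set E := primeExt fun p => ((eps K p : ℤ) : ℂ) with hE
  let R : ArithmeticFunction ℂ := ⟨fun n => (rK K n : ℂ), by simp [rK_zero]⟩
  let F : ArithmeticFunction ℂ := ⟨E, map_zero E⟩
  have hR : R.IsMultiplicative := ⟨by simp [R, rK_one], fun {m n} h => by simp [R, rK_mul h]⟩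
  have hF : F.IsMultiplicative := ⟨map_one E, fun {m n} _ => map_mul E m n⟩
  have hRF : R = (ζ : ArithmeticFunction ℂ) * F := by
    rw [IsMultiplicative.eq_iff_eq_on_prime_powers R hR _ (isMultiplicative_zeta.natCast.mul hF)]
    intro p k hp
    rw [coe_zeta_mul_apply, Nat.sum_divisors_prime_pow hp]
    have h1 := (eps_cases_and_rK_prime_pow hK2 hp).2 k
    have h2 : (rK K (p ^ k) : ℂ) = ∑ j ∈ Finset.range (k + 1), ((eps K p : ℤ) : ℂ) ^ j := by
      exact_mod_cast congrArg (Int.cast : ℤ → ℂ) h1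
    change (rK K (p ^ k) : ℂ) = ∑ j ∈ Finset.range (k + 1), E (p ^ j)
    rw [h2]
    refine Finset.sum_congr rfl fun j _ => ?_
    rw [map_pow, hE, primeExt_prime _ hp]
  have hFs : LSeriesSummable F s :=
    LSeriesSummable_of_bounded_of_one_lt_re (m := 1)
      (fun n _ => norm_primeExt_le_one (fun p hp => norm_eps_le_one hK2 hp) n) hs
  have hzs : LSeriesSummable (fun n => (ζ : ArithmeticFunction ℂ) n) s := by
    simpa using LSeriesSummable_zeta_iff.2 hs
  change LSeries (fun n => R n) s = riemannZeta s * LSeries (fun n => F n) s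
  rw [hRF, LSeries_mul' hzs hFs, ← LSeries_zeta_eq_riemannZeta hs]
  simp

end MSW

namespace MSW
open NumberField Topology DirichletCharacter

variable {K : Type*} [Field K] [NumberField K]

lemma exists_character_comparison (hK2 : Module.finrank ℚ K = 2) :
    ∃ (q : ℕ) (_ : NeZero q) (χ : DirichletCharacter ℂ q) (S : Finset Nat.Primes),
      χ.IsPrimitive ∧ χ ^ 2 = 1 ∧ ∀ s : ℂ, 1 < s.re →
        LSeries (fun n => (rK K n : ℂ)) s * eulerFactor (fun p => ((eps K p : ℤ) : ℂ)) S s =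
          zl χ s * eulerFactor (fun p => χ p) S s := by
  obtain ⟨θ, d, hd, hθ, htr⟩ := exists_sq_eq_int hK2
  obtain ⟨q, hq, χ, hχp, hχ, hχv⟩ := exists_quadratic_character hd
  refine ⟨q, hq, χ, (2 * d).natAbs.primeFactors.subtype Nat.Prime, hχp, hχ, fun s hs => ?_⟩
  rw [LSeries_rK_eq hK2 hs, zl, LFunction_eq_LSeries χ hs, mul_assoc, mul_assoc]
  congr 1
  refine mul_eulerFactor_eq (fun p hp => norm_eps_le_one hK2 hp) (fun p _ => χ.norm_le_one _) ?_
    (by linarith) (hasProd_LSeries_primeExt (fun p hp => norm_eps_le_one hK2 hp) hs)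
    (LSeries_eulerProduct_hasProd χ hs)
  intro p hp
  haveI : Fact (p : ℕ).Prime := ⟨p.2⟩
  have hpd : ¬ ((p : ℕ) : ℤ) ∣ 2 * d := by
    intro h
    apply hp
    exact Finset.mem_subtype.2
      (Nat.mem_primeFactors.2 ⟨p.2, Int.natCast_dvd.1 h, by simpa using hd⟩)
  rw [eps_eq_legendreSym hK2 hθ htr hpd, hχv p _ hpd]

/-- The comparison character is nontrivial, as the Dedekind zeta function has only a simple pole. -/
lemma character_ne_one {q : ℕ} [NeZero q] {χ : DirichletCharacter ℂ q} {S : Finset Nat.Primes}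
    (hK2 : Module.finrank ℚ K = 2) (hχp : χ.IsPrimitive)
    (h : ∀ s : ℂ, 1 < s.re →
        LSeries (fun n => (rK K n : ℂ)) s * eulerFactor (fun p => ((eps K p : ℤ) : ℂ)) S s =
          zl χ s * eulerFactor (fun p => χ p) S s) : χ ≠ 1 := by
  rintro rfl
  have hq : q = 1 := ((isPrimitive_def _).1 hχp).symm.trans conductor_one
  subst hq
  set A := eulerFactor (fun p => ((eps K p : ℤ) : ℂ)) S
  set B := eulerFactor (fun p => (1 : DirichletCharacter ℂ 1) p) S
  have hto : Tendsto (fun s : ℝ => (s : ℂ)) (𝓝[>] 1) (𝓝[≠] 1) := by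
    refine tendsto_nhdsWithin_iff.2 ⟨?_, ?_⟩
    · exact (Complex.continuous_ofReal.tendsto' 1 1 (by simp)).mono_left nhdsWithin_le_nhds
    · filter_upwards [self_mem_nhdsWithin] with s hs
      simp only [Set.mem_compl_iff, Set.mem_singleton_iff]
      exact_mod_cast (ne_of_gt hs)
  have hz := riemannZeta_residue_one.comp hto
  have hA : Tendsto (fun s : ℝ => A s) (𝓝[>] 1) (𝓝 (A 1)) :=
    ((differentiable_eulerFactor _ S).continuous.tendsto 1).comp (hto.mono_right nhdsWithin_le_nhds)
  have hB : Tendsto (fun s : ℝ => B s) (𝓝[>] 1) (𝓝 (B 1)) :=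
    ((differentiable_eulerFactor _ S).continuous.tendsto 1).comp (hto.mono_right nhdsWithin_le_nhds)
  have hD := tendsto_sub_one_mul_dedekindZeta_nhdsGT K
  have hs0 : Tendsto (fun s : ℝ => (s : ℂ) - 1) (𝓝[>] 1) (𝓝 0) := by
    have := (hto.mono_right nhdsWithin_le_nhds).sub_const 1
    simpa using this
  have hL := (hs0.mul (hD.mul hA))
  have hR := (hz.mul hz).mul hB
  rw [zero_mul] at hL
  have hBne : B 1 ≠ 0 := eulerFactor_ne_zero
    (fun p _ => (1 : DirichletCharacter ℂ 1).norm_le_one _) S (by simp)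
  refine (mul_ne_zero (mul_ne_zero one_ne_zero one_ne_zero) hBne)
    (tendsto_nhds_unique (hR.congr' ?_) hL)
  filter_upwards [self_mem_nhdsWithin] with s hs
  have h1 := h s (by simpa using hs)
  have hde : dedekindZeta K s = LSeries (fun n => (rK K n : ℂ)) s := by
    rw [dedekindZeta]
    refine LSeries_congr (fun {n} hn => ?_) _
    rw [rK_eq_ncard hn, ← Nat.card_coe_set_eq]
    rfl
  rw [zl, LFunction_modOne_eq] at h1
  simp only [Function.comp_apply]
  rw [hde]
  linear_combination -((s : ℂ) - 1) ^ 2 * h1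

lemma comparison_extends {q : ℕ} [NeZero q] {χ : DirichletCharacter ℂ q} (hχ1 : χ ≠ 1)
    {Z A B : ℂ → ℂ} (hZ : ∀ s : ℂ, s ≠ 1 → DifferentiableAt ℂ Z s)
    (hA : Differentiable ℂ A) (hB : Differentiable ℂ B)
    (h : ∀ s : ℂ, 1 < s.re → Z s * A s = zl χ s * B s) {s : ℂ} (hs : s ≠ 1) :
    Z s * A s = zl χ s * B s := by
  have hopen : IsOpen ({1}ᶜ : Set ℂ) := isOpen_compl_singleton
  have h1 : AnalyticOnNhd ℂ (fun s => Z s * A s) {1}ᶜ :=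
    DifferentiableOn.analyticOnNhd
      (fun s hs => ((hZ s hs).mul (hA s)).differentiableWithinAt) hopen
  have h2 : AnalyticOnNhd ℂ (fun s => zl χ s * B s) {1}ᶜ :=
    DifferentiableOn.analyticOnNhd
      (fun s hs => ((differentiableAt_zl hχ1 hs).mul (hB s)).differentiableWithinAt) hopen
  have hpre : IsPreconnected ({1}ᶜ : Set ℂ) :=
    (isConnected_compl_singleton_of_one_lt_rank (by simp) 1).isPreconnected
  refine h1.eqOn_of_preconnected_of_eventuallyEq h2 hpre (z₀ := 2) (by simp) ?_ hs
  filter_upwards [(isOpen_lt continuous_const Complex.continuous_re).mem_nhds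
    (show (1 : ℝ) < (2 : ℂ).re by norm_num)] with z hz
  exact h z hz

end MSW

/-- For a quadratic number field `K` with Dedekind zeta function `ζK` and `m₁ m₂ : ℕ`,
`∫_T^{2T} |ζK((1+it)/2)|² / (|ζ(1+it)|^{m₁} |ζK(1+it)|^{m₂}) dt
  ≪ T (log T)² (log log T)^{m₁+m₂}` as `T → ∞`. -/
theorem mean_square_weighted_bound
    (K : Type) [Field K] [NumberField K] (hK2 : Module.finrank ℚ K = 2)
    (m₁ m₂ : ℕ)
    (ζK : ℂ → ℂ)
    (hζK_holo : ∀ s : ℂ, s ≠ 1 → DifferentiableAt ℂ ζK s)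
    (hζK_eq : ∀ s : ℂ, 1 < s.re → ζK s = LSeries (fun n => (rK K n : ℂ)) s) :
    (fun T : ℝ => ∫ t in T..(2 * T),
        ‖ζK ((1 + t * Complex.I) / 2)‖ ^ 2 /
          (‖riemannZeta (1 + t * Complex.I)‖ ^ m₁ * ‖ζK (1 + t * Complex.I)‖ ^ m₂))
      =O[atTop]
      fun T : ℝ => T * Real.log T ^ 2 * Real.log (Real.log T) ^ (m₁ + m₂) := by
  obtain ⟨q, hq, χ, S, hχp, hχ, hcomp⟩ := MSW.exists_character_comparison (K := K) hK2
  have hχ1 := MSW.character_ne_one hK2 hχp hcomp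
  have he := fun (p : ℕ) (hp : p.Prime) => MSW.norm_eps_le_one (K := K) hK2 hp
  have he' : ∀ p : ℕ, p.Prime → ‖χ p‖ ≤ 1 := fun p _ => χ.norm_le_one _
  have key : ∀ s : ℂ, s ≠ 1 →
      ‖ζK s‖ * ‖MSW.eulerFactor (fun p => ((MSW.eps K p : ℤ) : ℂ)) S s‖ =
        ‖MSW.zl χ s‖ * ‖MSW.eulerFactor (fun p => χ p) S s‖ := fun s hs => by
    rw [← norm_mul, ← norm_mul]
    exact congrArg norm (MSW.comparison_extends hχ1 hζK_holo (MSW.differentiable_eulerFactor _ S)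
      (MSW.differentiable_eulerFactor _ S) (fun s hs => by rw [hζK_eq s hs, hcomp s hs]) hs)
  have ha := MSW.prod_one_sub_prime_rpow_pos S (σ := 1 / 2) (by norm_num)
  have hb := MSW.prod_one_sub_prime_rpow_pos S (σ := 1) one_pos
  set a := ∏ p ∈ S, (1 - (p : ℝ) ^ (-(1 / 2 : ℝ)))
  set b := ∏ p ∈ S, (1 - (p : ℝ) ^ (-(1 : ℝ)))
  have h2 : (0 : ℝ) < 2 ^ S.card := by positivity
  refine MSW.mean_square_of_comparison hχp hχ1 hχ ζK (div_pos h2 ha) (div_pos hb h2)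
    (fun t => ?_) (fun t ht => ?_) m₁ m₂
  · have hre : ((1 / 2 : ℝ) + t * I : ℂ).re = 1 / 2 := by simp
    have hk := key ((1 / 2 : ℝ) + t * I) (fun h => by
      have := congrArg Complex.re h
      rw [hre] at this
      norm_num at this)
    have h3 := MSW.le_norm_eulerFactor he S (s := (1 / 2 : ℝ) + t * I) (by rw [hre]; norm_num)
    have h4 := MSW.norm_eulerFactor_le he' S (s := (1 / 2 : ℝ) + t * I) (by rw [hre]; norm_num)
    rw [hre] at h3
    rw [div_mul_eq_mul_div, le_div_iff₀ ha]
    calc _ ≤ _ := mul_le_mul_of_nonneg_left h3 (norm_nonneg _)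
      _ = _ := hk
      _ ≤ _ := mul_le_mul_of_nonneg_left h4 (norm_nonneg _)
      _ = _ := mul_comm _ _
  · have hre : (1 + t * I : ℂ).re = 1 := by simp
    have hk := key (1 + t * I) (fun h => by
      have := congrArg Complex.im h
      simp at this
      linarith)
    have h3 := MSW.le_norm_eulerFactor he' S (s := 1 + t * I) (by rw [hre]; norm_num)
    have h4 := MSW.norm_eulerFactor_le he S (s := 1 + t * I) (by rw [hre]; norm_num)
    rw [hre] at h3
    rw [div_mul_eq_mul_div, div_le_iff₀ h2]
    calc _ = _ := mul_comm _ _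
      _ ≤ _ := mul_le_mul_of_nonneg_left h3 (norm_nonneg _)
      _ = _ := hk.symm
      _ ≤ _ := mul_le_mul_of_nonneg_left h4 (norm_nonneg _)
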